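/- Assume the inverse temperature sequence (β_N)_{N≥1} with β_N ∈ (0,1) satisfies lim_{N→∞} β_N = 1 and lim_{N→∞} N^{1/3}(1 − β_N²) = c where c ∈ (0,∞) or c = ∞. Then there exists a finite constant L (depending on (β_N)) such that for all t ∈ [0,1] and all N ≥ 1, | N·E⟨R(σ,τ)²⟩_t − 1/(1 − β_N² t) | ≤ L·N^{−1/2}·(1 − β_N²)^{−1}·(1 − β_N² t)^{−3/2}. -/

import Mathlib

open MeasureTheory ProbabilityTheory Real Finset Filter

noncomputable section

/-- Spin configurations: each of the `N` sites carries a `±1` spin, encoded by a `Bool`. -/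
abbrev Config (N : ℕ) := Fin N → Bool

/-- The `±1` value of a spin. -/
def spin (b : Bool) : ℝ := if b then 1 else -1

/-- The value of the last spin `σ_N` (junk value `0` when `N = 0`). -/
def spinLast {N : ℕ} (σ : Config N) : ℝ :=
  if h : 0 < N then spin (σ ⟨N - 1, Nat.sub_lt h Nat.one_pos⟩) else 0

/-- The Gaussian disorder: i.i.d. standard Gaussians indexed by pairs `(i, j)`
(only the entries with `i < j` are used). -/
def gaussPi (N : ℕ) : Measure (Fin N × Fin N → ℝ) :=
  Measure.pi fun _ => gaussianReal 0 1

instance (N : ℕ) : IsProbabilityMeasure (gaussPi N) := by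
  unfold gaussPi; infer_instance

/-- Three independent copies `g, g', g''` of the disorder. -/
def disM3 (N : ℕ) :
    Measure ((Fin N × Fin N → ℝ) × (Fin N × Fin N → ℝ) × (Fin N × Fin N → ℝ)) :=
  (gaussPi N).prod ((gaussPi N).prod (gaussPi N))

/-- The SK Hamiltonian `H_{N,β}(σ) = (β/√N) ∑_{i<j} g_{ij} σ_i σ_j`. -/
def ham (N : ℕ) (β : ℝ) (g : Fin N × Fin N → ℝ) (σ : Config N) : ℝ :=
  (β / Real.sqrt N) *
    ∑ p ∈ Finset.univ.filter (fun p : Fin N × Fin N => p.1 < p.2),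
      g p * spin (σ p.1) * spin (σ p.2)

/-- The cavity Hamiltonian `H⁻_N(σ) = (β/√N) ∑_{i<j<N} g_{ij} σ_i σ_j` on the first
`N - 1` spins. -/
def hamCav (N : ℕ) (β : ℝ) (g : Fin N × Fin N → ℝ) (σ : Config N) : ℝ :=
  (β / Real.sqrt N) *
    ∑ p ∈ Finset.univ.filter
        (fun p : Fin N × Fin N => p.1 < p.2 ∧ (p.2 : ℕ) < N - 1),
      g p * spin (σ p.1) * spin (σ p.2)

/-- The overlap `R(σ¹,σ²) = (1/N) ∑_{i ≤ N} σ_i¹ σ_i²`. -/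
def ovlp (N : ℕ) (σ τ : Config N) : ℝ := (∑ i, spin (σ i) * spin (τ i)) / N

/-- The truncated overlap `R⁻(σ¹,σ²) = (1/N) ∑_{i ≤ N−1} σ_i¹ σ_i²`. -/
def ovlpm (N : ℕ) (σ τ : Config N) : ℝ :=
  (∑ i ∈ Finset.univ.filter (fun i : Fin N => (i : ℕ) < N - 1),
    spin (σ i) * spin (τ i)) / N

/-- The partition function `Z_N(β)`. -/
def partFun (N : ℕ) (β : ℝ) (g : Fin N × Fin N → ℝ) : ℝ :=
  ∑ σ : Config N, Real.exp (ham N β g σ)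

/-- The free energy `F_N(β) = ln Z_N(β)`. -/
def freeEnergy (N : ℕ) (β : ℝ) (g : Fin N × Fin N → ℝ) : ℝ :=
  Real.log (partFun N β g)

/-- Two-replica Gibbs average `⟨f⟩` for the single SK system. -/
def gibbs2 (N : ℕ) (β : ℝ) (g : Fin N × Fin N → ℝ)
    (f : Config N → Config N → ℝ) : ℝ :=
  (∑ σ : Config N, ∑ τ : Config N,
    f σ τ * Real.exp (ham N β g σ + ham N β g τ)) / (partFun N β g) ^ 2

/-- Disorder expectation of the two-replica Gibbs average. -/
def Egibbs2 (N : ℕ) (β : ℝ) (f : Config N → Config N → ℝ) : ℝ :=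
  ∫ g, gibbs2 N β g f ∂gaussPi N

/-- The interpolated Hamiltonian `√t · H_N + √(1−t) · H'_N`. -/
def hamT (N : ℕ) (β t : ℝ) (g g' : Fin N × Fin N → ℝ) (σ : Config N) : ℝ :=
  Real.sqrt t * ham N β g σ + Real.sqrt (1 - t) * ham N β g' σ

/-- The coupled Gibbs weight `exp(H¹_{N,t}(σ) + H²_{N,t}(τ))`. -/
def wT (N : ℕ) (β t : ℝ) (g g' g'' : Fin N × Fin N → ℝ)
    (ρ : Config N × Config N) : ℝ :=
  Real.exp (hamT N β t g g' ρ.1 + hamT N β t g g'' ρ.2)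

/-- The coupled Gibbs average `⟨f⟩_t` of a function of one pair `(σ, τ)`. -/
def gibbsT (N : ℕ) (β t : ℝ) (g g' g'' : Fin N × Fin N → ℝ)
    (f : Config N × Config N → ℝ) : ℝ :=
  (∑ ρ : Config N × Config N, f ρ * wT N β t g g' g'' ρ) /
    (∑ ρ : Config N × Config N, wT N β t g g' g'' ρ)

/-- The coupled Gibbs average `⟨f⟩_t` of a function of two pairs. -/
def gibbsT2 (N : ℕ) (β t : ℝ) (g g' g'' : Fin N × Fin N → ℝ)
    (f : Config N × Config N → Config N × Config N → ℝ) : ℝ :=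
  (∑ ρ₁ : Config N × Config N, ∑ ρ₂ : Config N × Config N,
    f ρ₁ ρ₂ * wT N β t g g' g'' ρ₁ * wT N β t g g' g'' ρ₂) /
    (∑ ρ : Config N × Config N, wT N β t g g' g'' ρ) ^ 2

/-- Disorder expectation `E⟨f⟩_t` (one pair). -/
def EgibbsT (N : ℕ) (β t : ℝ) (f : Config N × Config N → ℝ) : ℝ :=
  ∫ ω, gibbsT N β t ω.1 ω.2.1 ω.2.2 f ∂disM3 N

/-- Disorder expectation `E⟨f⟩_t` (two pairs). -/
def EgibbsT2 (N : ℕ) (β t : ℝ)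
    (f : Config N × Config N → Config N × Config N → ℝ) : ℝ :=
  ∫ ω, gibbsT2 N β t ω.1 ω.2.1 ω.2.2 f ∂disM3 N

/-- The `s`-dependent cavity field term
`(β/√N) σ_N ∑_{i<N} (√t g_{iN} + √(1−t) g'_{iN}) σ_i`. -/
def cavField (N : ℕ) (β t : ℝ) (g g' : Fin N × Fin N → ℝ) (σ : Config N) : ℝ :=
  if h : 0 < N then
    (β / Real.sqrt N) * spin (σ ⟨N - 1, Nat.sub_lt h Nat.one_pos⟩) *
      ∑ i ∈ Finset.univ.filter (fun i : Fin N => (i : ℕ) < N - 1),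
        (Real.sqrt t * g (i, ⟨N - 1, Nat.sub_lt h Nat.one_pos⟩) +
          Real.sqrt (1 - t) * g' (i, ⟨N - 1, Nat.sub_lt h Nat.one_pos⟩)) * spin (σ i)
  else 0

/-- The cavity-interpolated Hamiltonian `H^1_{N,t,s}` (resp. `H^2_{N,t,s}` with `g''`). -/
def hamTS (N : ℕ) (β t s : ℝ) (g g' : Fin N × Fin N → ℝ) (σ : Config N) : ℝ :=
  Real.sqrt t * hamCav N β g σ + Real.sqrt (1 - t) * hamCav N β g' σ +
    Real.sqrt s * cavField N β t g g' σ

/-- The coupled cavity Gibbs weight `exp(H¹_{N,t,s}(σ) + H²_{N,t,s}(τ))`. -/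
def wTS (N : ℕ) (β t s : ℝ) (g g' g'' : Fin N × Fin N → ℝ)
    (ρ : Config N × Config N) : ℝ :=
  Real.exp (hamTS N β t s g g' ρ.1 + hamTS N β t s g g'' ρ.2)

/-- The coupled cavity Gibbs average `⟨f⟩_{t,s}` of a function of one pair. -/
def gibbsTS1 (N : ℕ) (β t s : ℝ) (g g' g'' : Fin N × Fin N → ℝ)
    (f : Config N × Config N → ℝ) : ℝ :=
  (∑ ρ : Config N × Config N, f ρ * wTS N β t s g g' g'' ρ) /
    (∑ ρ : Config N × Config N, wTS N β t s g g' g'' ρ)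

/-- The coupled cavity Gibbs average `⟨f⟩_{t,s}` of a function of two pairs. -/
def gibbsTS2 (N : ℕ) (β t s : ℝ) (g g' g'' : Fin N × Fin N → ℝ)
    (f : Config N × Config N → Config N × Config N → ℝ) : ℝ :=
  (∑ ρ₁ : Config N × Config N, ∑ ρ₂ : Config N × Config N,
    f ρ₁ ρ₂ * wTS N β t s g g' g'' ρ₁ * wTS N β t s g g' g'' ρ₂) /
    (∑ ρ : Config N × Config N, wTS N β t s g g' g'' ρ) ^ 2

/-- The coupled cavity Gibbs average `⟨f⟩_{t,s}` of a function of `n` pairs. -/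
def gibbsTSn (N : ℕ) (β t s : ℝ) (g g' g'' : Fin N × Fin N → ℝ) {n : ℕ}
    (f : (Fin n → Config N × Config N) → ℝ) : ℝ :=
  (∑ ρ : Fin n → Config N × Config N, f ρ * ∏ l, wTS N β t s g g' g'' (ρ l)) /
    (∑ ρ₀ : Config N × Config N, wTS N β t s g g' g'' ρ₀) ^ n

/-- Disorder expectation `E⟨f⟩_{t,s}` (one pair). -/
def EgibbsTS1 (N : ℕ) (β t s : ℝ) (f : Config N × Config N → ℝ) : ℝ :=
  ∫ ω, gibbsTS1 N β t s ω.1 ω.2.1 ω.2.2 f ∂disM3 N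

/-- Disorder expectation `E⟨f⟩_{t,s}` (two pairs). -/
def EgibbsTS2 (N : ℕ) (β t s : ℝ)
    (f : Config N × Config N → Config N × Config N → ℝ) : ℝ :=
  ∫ ω, gibbsTS2 N β t s ω.1 ω.2.1 ω.2.2 f ∂disM3 N

/-- Disorder expectation `E⟨f⟩_{t,s}` (`n` pairs). -/
def EgibbsTSn (N : ℕ) (β t s : ℝ) {n : ℕ}
    (f : (Fin n → Config N × Config N) → ℝ) : ℝ :=
  ∫ ω, gibbsTSn N β t s ω.1 ω.2.1 ω.2.2 f ∂disM3 N

/-- The covariance kernel `U(ρ, ρ')` of the `s`-part of the coupled cavity Hamiltonians. -/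
def Ufun (N : ℕ) (β t : ℝ) (ρ ρ' : Config N × Config N) : ℝ :=
  β ^ 2 / 2 * (spinLast ρ.1 * spinLast ρ'.1 * ovlpm N ρ.1 ρ'.1 +
      spinLast ρ.2 * spinLast ρ'.2 * ovlpm N ρ.2 ρ'.2) +
    β ^ 2 * t / 2 * (spinLast ρ.1 * spinLast ρ'.2 * ovlpm N ρ.1 ρ'.2 +
      spinLast ρ.2 * spinLast ρ'.1 * ovlpm N ρ.2 ρ'.1)

/-- `ν(β) = −(1/2)·ln(1 − β²) − β²/2`. -/
def nuSK (b : ℝ) : ℝ := -(1 / 2) * Real.log (1 - b ^ 2) - b ^ 2 / 2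

/-! ### Prékopa–Leindler inequality for the standard Gaussian measure -/

/-- One-dimensional Brunn–Minkowski inequality. -/
lemma volume_add_volume_le_of_add_mem {A B C : Set ℝ} (hA : MeasurableSet A)
    (hB : MeasurableSet B) (hAn : A.Nonempty) (hBn : B.Nonempty)
    (h : ∀ a ∈ A, ∀ b ∈ B, a + b ∈ C) : volume A + volume B ≤ volume C := by
  obtain ⟨a₀, ha₀⟩ := hAn
  obtain ⟨b₀, hb₀⟩ := hBn
  have hAC : volume A ≤ volume C := by
    rw [← measure_preimage_add_right volume (-b₀) A]
    refine measure_mono fun x hx => ?_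
    have := h _ hx _ hb₀
    simpa using this
  have hBC : volume B ≤ volume C := by
    rw [← measure_preimage_add_right volume (-a₀) B]
    refine measure_mono fun x hx => ?_
    have := h _ ha₀ _ hx
    simpa using this
  by_cases hA0 : volume A = 0
  · simpa [hA0] using hBC
  by_cases hB0 : volume B = 0
  · simpa [hB0] using hAC
  have hsup : ∀ a' < volume A, ∀ b' < volume B, a' + b' ≤ volume C := by
    intro a' ha' b' hb'
    obtain ⟨K, hKA, hK, hKa⟩ := hA.exists_lt_isCompact ha'
    obtain ⟨L, hLB, hL, hLb⟩ := hB.exists_lt_isCompact hb'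
    have hKn : K.Nonempty := by
      rw [Set.nonempty_iff_ne_empty]; rintro rfl; simp at hKa
    have hLn : L.Nonempty := by
      rw [Set.nonempty_iff_ne_empty]; rintro rfl; simp at hLb
    obtain ⟨k, hk, hkmax⟩ := hK.exists_isGreatest hKn
    obtain ⟨l, hl, hlmin⟩ := hL.exists_isLeast hLn
    have e1 := measure_preimage_add_right volume (-l) K
    have e2 := measure_preimage_add_right volume (-k) L
    have hm : MeasurableSet ((fun x : ℝ => x + -k) ⁻¹' L) :=
      (measurable_id.add_const _) hL.measurableSet
    have hintg : volume (((fun x : ℝ => x + -l) ⁻¹' K) ∩ ((fun x : ℝ => x + -k) ⁻¹' L)) = 0 := by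
      refine measure_mono_null (t := {k + l}) ?_ (by simp)
      rintro x ⟨h1, h2⟩
      have i1 := hkmax h1
      have i2 := hlmin h2
      simp only [Set.mem_singleton_iff]
      linarith
    have hu := measure_union_add_inter (μ := volume) ((fun x : ℝ => x + -l) ⁻¹' K) hm
    rw [hintg, add_zero, e1, e2] at hu
    calc a' + b' ≤ volume K + volume L := add_le_add hKa.le hLb.le
      _ ≤ volume C := by
        rw [← hu]
        refine measure_mono ?_
        rintro x (hx | hx)
        · simpa using h _ (hKA hx) _ (hLB hl)
        · simpa using h _ (hKA hk) _ (hLB hx)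
  rcases eq_or_ne (volume A) ⊤ with hAt | hAt
  · rw [hAt, top_le_iff] at hAC
    simp [hAC]
  have hstep : ∀ b' < volume B, volume A + b' ≤ volume C := fun b' hb' => by
    rw [← ENNReal.le_sub_iff_add_le_right hb'.ne_top (hb'.le.trans hBC)]
    exact le_of_forall_lt_imp_le_of_dense fun a' ha' =>
      (ENNReal.le_sub_iff_add_le_right hb'.ne_top (hb'.le.trans hBC)).2 (hsup a' ha' b' hb')
  rw [add_comm, ← ENNReal.le_sub_iff_add_le_right hAt hAC]
  refine le_of_forall_lt_imp_le_of_dense fun b' hb' => ?_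
  rw [ENNReal.le_sub_iff_add_le_right hAt hAC, add_comm]
  exact hstep b' hb'

lemma ENNReal.four_mul_mul_le_sq_add (x y : ENNReal) : 4 * (x * y) ≤ (x + y) ^ 2 := by
  rcases eq_or_ne x ⊤ with rfl | hx
  · simp
  rcases eq_or_ne y ⊤ with rfl | hy
  · simp
  lift x to NNReal using hx
  lift y to NNReal using hy
  norm_cast
  have := four_mul_le_sq_add (x : ℝ) y
  rw [← NNReal.coe_le_coe]; push_cast; linarith

lemma lintegral_mul_le_sq_of_sup_one {u v h : ℝ → ℝ} (hu : Measurable u) (hv : Measurable v)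
    (hh : Measurable h) (hu0 : ∀ x, 0 ≤ u x) (hv0 : ∀ x, 0 ≤ v x) (hh0 : ∀ x, 0 ≤ h x)
    (hu1 : ∀ x, u x ≤ 1) (hv1 : ∀ x, v x ≤ 1)
    (hus : ∀ s < 1, ∃ x, s < u x) (hvs : ∀ s < 1, ∃ x, s < v x)
    (huvh : ∀ x y, u x * v y ≤ h ((x + y) / 2) ^ 2) :
    (∫⁻ x, ENNReal.ofReal (u x)) * (∫⁻ x, ENNReal.ofReal (v x)) ≤
      (∫⁻ x, ENNReal.ofReal (h x)) ^ 2 := by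
  have key : (∫⁻ x, ENNReal.ofReal (u x)) + (∫⁻ x, ENNReal.ofReal (v x)) ≤
      2 * (∫⁻ x, ENNReal.ofReal (h x)) := by
    rw [lintegral_eq_lintegral_meas_lt _ (ae_of_all _ hu0) hu.aemeasurable,
      lintegral_eq_lintegral_meas_lt _ (ae_of_all _ hv0) hv.aemeasurable,
      lintegral_eq_lintegral_meas_lt _ (ae_of_all _ hh0) hh.aemeasurable,
      ← lintegral_const_mul' _ _ (by simp), ← lintegral_add_left]
    · refine setLIntegral_mono' measurableSet_Ioi fun s hs => ?_
      rw [Set.mem_Ioi] at hs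
      by_cases h1 : s < 1
      · have hC : volume {z : ℝ | s < h (2⁻¹ * z)} = 2 * volume {a | s < h a} := by
          have := Real.volume_preimage_mul_left (a := 2⁻¹) (by norm_num) {a | s < h a}
          simpa using this
        rw [← hC]
        refine volume_add_volume_le_of_add_mem (measurableSet_lt measurable_const hu)
          (measurableSet_lt measurable_const hv) (hus s h1) (hvs s h1) ?_
        intro x hx y hy
        simp only [Set.mem_ofPred_eq] at hx hy ⊢
        have e : 2⁻¹ * (x + y) = (x + y) / 2 := by ring
        rw [e]
        refine lt_of_pow_lt_pow_left₀ 2 (hh0 _) (lt_of_lt_of_le ?_ (huvh x y))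
        nlinarith
      · push Not at h1
        have e1 : {a | s < u a} = ∅ := by
          ext a; simp; exact (hu1 a).trans h1
        have e2 : {a | s < v a} = ∅ := by
          ext a; simp; exact (hv1 a).trans h1
        simp [e1, e2]
    · exact (Antitone.measurable fun s t hst => measure_mono fun x hx => lt_of_le_of_lt hst hx)
  have h4 := ENNReal.four_mul_mul_le_sq_add (∫⁻ x, ENNReal.ofReal (u x)) (∫⁻ x, ENNReal.ofReal (v x))
  have h5 := h4.trans (pow_le_pow_left' key 2)
  rw [mul_pow] at h5
  have h2 : (2 : ENNReal) ^ 2 = 4 := by norm_num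
  rw [h2] at h5
  exact (ENNReal.mul_le_mul_iff_right (by norm_num) (by norm_num)).1 h5

/-- One-dimensional Prékopa–Leindler inequality (with midpoints) for bounded functions. -/
lemma lintegral_mul_le_sq {u v h : ℝ → ℝ} (hu : Measurable u) (hv : Measurable v)
    (hh : Measurable h) (hu0 : ∀ x, 0 ≤ u x) (hv0 : ∀ x, 0 ≤ v x) (hh0 : ∀ x, 0 ≤ h x)
    (hub : BddAbove (Set.range u)) (hvb : BddAbove (Set.range v))
    (huvh : ∀ x y, u x * v y ≤ h ((x + y) / 2) ^ 2) :
    (∫⁻ x, ENNReal.ofReal (u x)) * (∫⁻ x, ENNReal.ofReal (v x)) ≤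
      (∫⁻ x, ENNReal.ofReal (h x)) ^ 2 := by
  set a := ⨆ x, u x with ha
  set b := ⨆ x, v x with hb
  have hua : ∀ x, u x ≤ a := fun x => le_ciSup hub x
  have hvb' : ∀ x, v x ≤ b := fun x => le_ciSup hvb x
  rcases (hu0 0 |>.trans (hua 0)).eq_or_lt with ha0 | ha0
  · have : ∀ x, u x = 0 := fun x => le_antisymm (ha0 ▸ hua x) (hu0 x)
    simp [this]
  rcases (hv0 0 |>.trans (hvb' 0)).eq_or_lt with hb0 | hb0
  · have : ∀ x, v x = 0 := fun x => le_antisymm (hb0 ▸ hvb' x) (hv0 x)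
    simp [this]
  have hab : 0 < a * b := mul_pos ha0 hb0
  have main := lintegral_mul_le_sq_of_sup_one (u := fun x => u x / a) (v := fun x => v x / b)
    (h := fun x => h x / √(a * b)) (hu.div_const _) (hv.div_const _) (hh.div_const _)
    (fun x => div_nonneg (hu0 x) ha0.le) (fun x => div_nonneg (hv0 x) hb0.le)
    (fun x => div_nonneg (hh0 x) (Real.sqrt_nonneg _))
    (fun x => (div_le_one ha0).2 (hua x)) (fun x => (div_le_one hb0).2 (hvb' x))
    (fun s hs => by
      obtain ⟨x, hx⟩ := exists_lt_of_lt_ciSup (show s * a < ⨆ x, u x by rw [← ha]; nlinarith)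
      exact ⟨x, (lt_div_iff₀ ha0).2 hx⟩)
    (fun s hs => by
      obtain ⟨x, hx⟩ := exists_lt_of_lt_ciSup (show s * b < ⨆ x, v x by rw [← hb]; nlinarith)
      exact ⟨x, (lt_div_iff₀ hb0).2 hx⟩)
    (fun x y => by
      rw [div_pow, Real.sq_sqrt hab.le, div_mul_div_comm]
      exact div_le_div_of_nonneg_right (huvh x y) hab.le)
  have e : ∀ (w : ℝ → ℝ) (m : ℝ), 0 < m → (∫⁻ x, ENNReal.ofReal (w x / m)) =
      (ENNReal.ofReal m)⁻¹ * ∫⁻ x, ENNReal.ofReal (w x) := by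
    intro w m hm
    rw [← lintegral_const_mul' _ _ (by simpa using hm)]
    refine lintegral_congr fun x => ?_
    rw [ENNReal.ofReal_div_of_pos hm, mul_comm, div_eq_mul_inv]
  rw [e u a ha0, e v b hb0, e h _ (Real.sqrt_pos.2 hab), mul_pow, ← ENNReal.inv_pow,
    ← ENNReal.ofReal_pow (Real.sqrt_nonneg _), Real.sq_sqrt hab.le, ENNReal.ofReal_mul ha0.le,
    mul_mul_mul_comm, ← ENNReal.mul_inv (by simp) (by simp)] at main
  refine (ENNReal.mul_le_mul_iff_right ?_ ?_).1 main
  · simp [ENNReal.mul_eq_top]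
  · simp [ha0, hb0]

/-- Gaussian Prékopa–Leindler inequality in dimension one. -/
lemma gaussianReal_lintegral_mul_le {f g : ℝ → ENNReal} (hf : Measurable f) (hg : Measurable g)
    {c : ℝ} (hc : 0 ≤ c)
    (hfg : ∀ x y, f x * g y ≤ ENNReal.ofReal (c * rexp ((x - y) ^ 2 / 4))) :
    (∫⁻ x, f x ∂gaussianReal 0 1) * (∫⁻ x, g x ∂gaussianReal 0 1) ≤ ENNReal.ofReal c := by
  have hintg : ∀ w : ℝ → ENNReal, Measurable w → (∫⁻ x, w x ∂gaussianReal 0 1) =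
      ∫⁻ x, w x * ENNReal.ofReal (gaussianPDFReal 0 1 x) := by
    intro w hw
    rw [gaussianReal_of_var_ne_zero _ (by norm_num), lintegral_withDensity_eq_lintegral_mul _
      (measurable_gaussianPDF 0 1) hw]
    refine lintegral_congr fun x => ?_
    simp [gaussianPDF, mul_comm]
  have hpdf : ∀ x, gaussianPDFReal 0 1 x = (√(2 * π))⁻¹ * rexp (-x ^ 2 / 2) := by
    intro x; simp [gaussianPDFReal]
  have hpdf_le : ∀ x, gaussianPDFReal 0 1 x ≤ (√(2 * π))⁻¹ := by
    intro x
    rw [hpdf]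
    have : rexp (-x ^ 2 / 2) ≤ 1 := Real.exp_le_one_iff.2 (by nlinarith [sq_nonneg x])
    exact mul_le_of_le_one_right (by positivity) this
  have htrunc : ∀ n : ℕ, (∫⁻ x, min (f x) n ∂gaussianReal 0 1) *
      (∫⁻ x, min (g x) n ∂gaussianReal 0 1) ≤ ENNReal.ofReal c := by
    intro n
    have hmeas : ∀ w : ℝ → ENNReal, Measurable w →
        Measurable fun x => (min (w x) n).toReal * gaussianPDFReal 0 1 x := fun w hw =>
      (hw.min measurable_const).ennreal_toReal.mul (measurable_gaussianPDFReal 0 1)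
    have hne : ∀ y : ENNReal, min y (n : ENNReal) ≠ ⊤ := fun y =>
      ne_top_of_le_ne_top (ENNReal.natCast_ne_top n) (min_le_right _ _)
    have hbdd : ∀ w : ℝ → ENNReal,
        BddAbove (Set.range fun x => (min (w x) n).toReal * gaussianPDFReal 0 1 x) := by
      intro w
      refine ⟨n * (√(2 * π))⁻¹, ?_⟩
      rintro _ ⟨x, rfl⟩
      refine mul_le_mul ?_ (hpdf_le x) (gaussianPDFReal_nonneg _ _ _) (by positivity)
      have := ENNReal.toReal_mono (ENNReal.natCast_ne_top n) (min_le_right (w x) (n : ENNReal))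
      simpa using this
    have main := lintegral_mul_le_sq (u := fun x => (min (f x) n).toReal * gaussianPDFReal 0 1 x)
      (v := fun x => (min (g x) n).toReal * gaussianPDFReal 0 1 x)
      (h := fun x => √c * gaussianPDFReal 0 1 x) (hmeas f hf) (hmeas g hg)
      ((measurable_gaussianPDFReal 0 1).const_mul _)
      (fun x => mul_nonneg ENNReal.toReal_nonneg (gaussianPDFReal_nonneg _ _ _))
      (fun x => mul_nonneg ENNReal.toReal_nonneg (gaussianPDFReal_nonneg _ _ _))
      (fun x => mul_nonneg (Real.sqrt_nonneg _) (gaussianPDFReal_nonneg _ _ _))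
      (hbdd f) (hbdd g) ?_
    · have e : ∀ w : ℝ → ENNReal, Measurable w → (∫⁻ x, min (w x) n ∂gaussianReal 0 1) =
          ∫⁻ x, ENNReal.ofReal ((min (w x) n).toReal * gaussianPDFReal 0 1 x) := by
        intro w hw
        rw [hintg _ (hw.min measurable_const)]
        refine lintegral_congr fun x => ?_
        rw [ENNReal.ofReal_mul ENNReal.toReal_nonneg, ENNReal.ofReal_toReal (hne _)]
      rw [e f hf, e g hg]
      refine main.trans (le_of_eq ?_)
      have e2 : ∫⁻ x, ENNReal.ofReal (√c * gaussianPDFReal 0 1 x) = ENNReal.ofReal √c := by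
        simp_rw [ENNReal.ofReal_mul (Real.sqrt_nonneg c)]
        rw [lintegral_const_mul' _ _ (by simp), lintegral_gaussianPDFReal_eq_one _ (by norm_num),
          mul_one]
      rw [e2, ← ENNReal.ofReal_pow (Real.sqrt_nonneg _), Real.sq_sqrt hc]
    · intro x y
      have h1 : (min (f x) n).toReal * (min (g y) n).toReal ≤ c * rexp ((x - y) ^ 2 / 4) := by
        rw [← ENNReal.toReal_mul]
        refine ENNReal.toReal_le_of_le_ofReal (by positivity) (le_trans ?_ (hfg x y))
        exact mul_le_mul' (min_le_left _ _) (min_le_left _ _)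
      have h2 : c * rexp ((x - y) ^ 2 / 4) *
          (gaussianPDFReal 0 1 x * gaussianPDFReal 0 1 y) =
          (√c * gaussianPDFReal 0 1 ((x + y) / 2)) ^ 2 := by
        rw [mul_pow, Real.sq_sqrt hc, hpdf, hpdf, hpdf, mul_pow, ← Real.exp_nat_mul]
        have : rexp ((x - y) ^ 2 / 4) * (rexp (-x ^ 2 / 2) * rexp (-y ^ 2 / 2)) =
            rexp ((2 : ℕ) * (-((x + y) / 2) ^ 2 / 2)) := by
          rw [← Real.exp_add, ← Real.exp_add]; congr 1; push_cast; ring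
        rw [← this]; ring
      calc _ = ((min (f x) n).toReal * (min (g y) n).toReal) *
            (gaussianPDFReal 0 1 x * gaussianPDFReal 0 1 y) := by ring
        _ ≤ _ := by
          rw [← h2]
          exact mul_le_mul_of_nonneg_right h1
            (mul_nonneg (gaussianPDFReal_nonneg _ _ _) (gaussianPDFReal_nonneg _ _ _))
  have hlim : ∀ w : ℝ → ENNReal, Measurable w → Tendsto
      (fun n : ℕ => ∫⁻ x, min (w x) n ∂gaussianReal 0 1) atTop
      (nhds (∫⁻ x, w x ∂gaussianReal 0 1)) := by
    intro w hw
    refine lintegral_tendsto_of_tendsto_of_monotone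
      (fun n => (hw.min measurable_const).aemeasurable)
      (ae_of_all _ fun x n m hnm => min_le_min le_rfl (by exact_mod_cast hnm))
      (ae_of_all _ fun x => ?_)
    have := (tendsto_const_nhds (x := w x)).min ENNReal.tendsto_nat_nhds_top
    simpa using this
  have hsup : ∀ w : ℝ → ENNReal, Measurable w → ∀ a < ∫⁻ x, w x ∂gaussianReal 0 1,
      ∃ n₀ : ℕ, ∀ n ≥ n₀, a < ∫⁻ x, min (w x) n ∂gaussianReal 0 1 := by
    intro w hw a ha
    exact eventually_atTop.1 ((hlim w hw).eventually (lt_mem_nhds ha))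
  refine ENNReal.mul_le_of_forall_lt fun a ha b hb => ?_
  obtain ⟨n, hn⟩ := hsup f hf a ha
  obtain ⟨m, hm⟩ := hsup g hg b hb
  exact (mul_le_mul' (hn _ (le_max_left n m)).le (hm _ (le_max_right n m)).le).trans
    (htrunc (max n m))

/-- Gaussian Prékopa–Leindler inequality in product form. -/
lemma gaussian_lintegral_mul_le_one {ι : Type*} [Fintype ι] [DecidableEq ι]
    {f g : (ι → ℝ) → ENNReal} (hf : Measurable f) (hg : Measurable g)
    (hfg : ∀ x y, f x * g y ≤ ENNReal.ofReal (rexp (∑ i, (x i - y i) ^ 2 / 4))) :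
    (∫⁻ x, f x ∂Measure.pi fun _ : ι => gaussianReal 0 1) *
      (∫⁻ x, g x ∂Measure.pi fun _ : ι => gaussianReal 0 1) ≤ 1 := by
  have key : ∀ s : Finset ι, ∀ x y,
      (∫⋯∫⁻_s, f ∂fun _ : ι => gaussianReal 0 1) x *
        (∫⋯∫⁻_s, g ∂fun _ : ι => gaussianReal 0 1) y ≤
      ENNReal.ofReal (rexp (∑ i ∈ sᶜ, (x i - y i) ^ 2 / 4)) := by
    intro s
    induction s using Finset.induction_on with
    | empty => intro x y; simpa using hfg x y
    | insert i s hi ih =>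
      intro x y
      rw [lmarginal_insert f hf hi, lmarginal_insert g hg hi]
      refine gaussianReal_lintegral_mul_le ((hf.lmarginal _).comp (measurable_update x))
        ((hg.lmarginal _).comp (measurable_update y)) (Real.exp_nonneg _) fun a b => ?_
      refine (ih _ _).trans (le_of_eq ?_)
      rw [← Real.exp_add]
      congr 2
      have hins : sᶜ = insert i (insert i s)ᶜ := by
        ext j; by_cases hj : j = i <;> simp [hj, hi]
      rw [hins, Finset.sum_insert (by simp), add_comm]
      congr 1
      · refine Finset.sum_congr rfl fun j hj => ?_
        have : j ≠ i := by rintro rfl; simp at hj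
        simp [this]
      · simp
  have := key Finset.univ 0 0
  rw [← lintegral_eq_lmarginal_univ, ← lintegral_eq_lmarginal_univ] at this
  simpa using this

/-! ### Exponentially bounded functions of a Gaussian vector -/

/-- The standard Gaussian measure on `K → ℝ`. -/
def stdGauss (K : Type*) [Fintype K] : Measure (K → ℝ) := Measure.pi fun _ => gaussianReal 0 1

instance (K : Type*) [Fintype K] : IsProbabilityMeasure (stdGauss K) := by
  unfold stdGauss; infer_instance

/-- Continuous functions with at most exponential growth. -/
def ExpBdd {K : Type*} [Fintype K] (f : (K → ℝ) → ℝ) : Prop :=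
  Continuous f ∧ ∃ C D : ℝ, 0 ≤ C ∧ 0 ≤ D ∧ ∀ ω, |f ω| ≤ C * rexp (D * ∑ k, |ω k|)

section ExpBdd

variable {K : Type*} [Fintype K] {f g : (K → ℝ) → ℝ}

lemma ExpBdd.const (c : ℝ) : ExpBdd (fun _ : K → ℝ => c) :=
  ⟨continuous_const, |c|, 0, abs_nonneg _, le_rfl, fun ω => by simp⟩

lemma ExpBdd.mul (hf : ExpBdd f) (hg : ExpBdd g) : ExpBdd fun ω => f ω * g ω := by
  obtain ⟨hfc, C, D, hC, hD, hf⟩ := hf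
  obtain ⟨hgc, C', D', hC', hD', hg⟩ := hg
  refine ⟨hfc.mul hgc, C * C', D + D', by positivity, by positivity, fun ω => ?_⟩
  rw [abs_mul, add_mul, Real.exp_add, mul_mul_mul_comm]
  exact mul_le_mul (hf ω) (hg ω) (abs_nonneg _) (by positivity)

lemma ExpBdd.add (hf : ExpBdd f) (hg : ExpBdd g) : ExpBdd fun ω => f ω + g ω := by
  obtain ⟨hfc, C, D, hC, hD, hf⟩ := hf
  obtain ⟨hgc, C', D', hC', hD', hg⟩ := hg
  refine ⟨hfc.add hgc, C + C', D + D', by positivity, by positivity, fun ω => ?_⟩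
  have hS : 0 ≤ ∑ k, |ω k| := Finset.sum_nonneg fun _ _ => abs_nonneg _
  have h1 : rexp (D * ∑ k, |ω k|) ≤ rexp ((D + D') * ∑ k, |ω k|) := by gcongr; linarith
  have h2 : rexp (D' * ∑ k, |ω k|) ≤ rexp ((D + D') * ∑ k, |ω k|) := by gcongr; linarith
  calc |f ω + g ω| ≤ |f ω| + |g ω| := abs_add_le _ _
    _ ≤ C * rexp ((D + D') * ∑ k, |ω k|) + C' * rexp ((D + D') * ∑ k, |ω k|) :=
      add_le_add ((hf ω).trans (mul_le_mul_of_nonneg_left h1 hC))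
        ((hg ω).trans (mul_le_mul_of_nonneg_left h2 hC'))
    _ = _ := by ring

lemma ExpBdd.neg (hf : ExpBdd f) : ExpBdd fun ω => -f ω := by
  simpa using (ExpBdd.const (K := K) (-1)).mul hf

lemma ExpBdd.sub (hf : ExpBdd f) (hg : ExpBdd g) : ExpBdd fun ω => f ω - g ω := by
  simpa [sub_eq_add_neg] using hf.add hg.neg

lemma ExpBdd.sum {ι : Type*} {F : ι → (K → ℝ) → ℝ} (s : Finset ι)
    (h : ∀ i, ExpBdd (F i)) : ExpBdd fun ω => ∑ i ∈ s, F i ω := by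
  classical
  induction s using Finset.induction_on with
  | empty => simpa using ExpBdd.const (K := K) 0
  | insert i s hi ih => simpa [Finset.sum_insert hi] using (h i).add ih

lemma ExpBdd.pow (hf : ExpBdd f) (n : ℕ) : ExpBdd fun ω => f ω ^ n := by
  induction n with
  | zero => simpa using ExpBdd.const (K := K) 1
  | succ n ih => simpa [pow_succ] using ih.mul hf

lemma ExpBdd.of_le (hfc : Continuous f) (hg : ExpBdd g) (h : ∀ ω, |f ω| ≤ |g ω|) : ExpBdd f := by
  obtain ⟨-, C, D, hC, hD, hg⟩ := hg
  exact ⟨hfc, C, D, hC, hD, fun ω => (h ω).trans (hg ω)⟩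

lemma abs_dotProduct_le (w ω : K → ℝ) : |w ⬝ᵥ ω| ≤ (∑ k, |w k|) * ∑ k, |ω k| := by
  refine (Finset.abs_sum_le_sum_abs _ _).trans ?_
  rw [Finset.sum_mul]
  refine Finset.sum_le_sum fun k _ => ?_
  rw [abs_mul]
  exact mul_le_mul_of_nonneg_left
    (Finset.single_le_sum (f := fun k => |ω k|) (fun _ _ => abs_nonneg _) (Finset.mem_univ k))
    (abs_nonneg _)

lemma continuous_dotProduct_left (w : K → ℝ) : Continuous fun ω : K → ℝ => w ⬝ᵥ ω := by
  unfold dotProduct; fun_prop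

lemma ExpBdd.exp_dot (w : K → ℝ) : ExpBdd fun ω => rexp (w ⬝ᵥ ω) := by
  refine ⟨Real.continuous_exp.comp (continuous_dotProduct_left w), 1, ∑ k, |w k|, zero_le_one,
    Finset.sum_nonneg fun _ _ => abs_nonneg _, fun ω => ?_⟩
  rw [abs_of_pos (Real.exp_pos _), one_mul]
  exact Real.exp_le_exp.2 ((le_abs_self _).trans (abs_dotProduct_le w ω))

lemma ExpBdd.cosh_dot (w : K → ℝ) : ExpBdd fun ω => cosh (w ⬝ᵥ ω) := by
  have := ((ExpBdd.exp_dot w).add (ExpBdd.exp_dot (-w))).mul (ExpBdd.const (1 / 2))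
  refine (congrArg ExpBdd (funext fun ω => ?_)).mp this
  rw [Real.cosh_eq, neg_dotProduct]; ring

lemma ExpBdd.sinh_dot (w : K → ℝ) : ExpBdd fun ω => sinh (w ⬝ᵥ ω) := by
  have := ((ExpBdd.exp_dot w).sub (ExpBdd.exp_dot (-w))).mul (ExpBdd.const (1 / 2))
  refine (congrArg ExpBdd (funext fun ω => ?_)).mp this
  rw [Real.sinh_eq, neg_dotProduct]; ring

lemma ExpBdd.inv_of_le (hf : Continuous f) {c D : ℝ} (hc : 0 < c) (hD : 0 ≤ D)
    (h : ∀ ω, c * rexp (-(D * ∑ k, |ω k|)) ≤ f ω) : ExpBdd fun ω => (f ω)⁻¹ := by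
  have hpos : ∀ ω, 0 < f ω := fun ω => lt_of_lt_of_le (by positivity) (h ω)
  refine ⟨hf.inv₀ fun ω => (hpos ω).ne', c⁻¹, D, by positivity, hD, fun ω => ?_⟩
  rw [abs_of_pos (inv_pos.2 (hpos ω))]
  refine (inv_anti₀ (by positivity) (h ω)).trans (le_of_eq ?_)
  rw [mul_inv, Real.exp_neg, inv_inv]

lemma ExpBdd.integrable (hf : ExpBdd f) : Integrable f (stdGauss K) := by
  obtain ⟨hfc, C, D, hC, hD, hf⟩ := hf
  have h1 : Integrable (fun x : ℝ => rexp (D * |x|)) (gaussianReal 0 1) := by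
    have := integrable_exp_mul_abs (μ := gaussianReal 0 1) (X := id) (t := D)
      (integrable_exp_mul_gaussianReal D) (by simpa using integrable_exp_mul_gaussianReal (-D))
    simpa using this
  have h2 : Integrable (fun ω : K → ℝ => rexp (D * ∑ k, |ω k|)) (stdGauss K) := by
    have := Integrable.fintype_prod (ι := K) (μ := fun _ => gaussianReal 0 1)
      (f := fun _ x => rexp (D * |x|)) fun _ => h1
    refine (congrArg (fun F => Integrable F (stdGauss K)) (funext fun ω => ?_)).mp this
    rw [Finset.mul_sum, Real.exp_sum]
  refine (h2.const_mul C).mono' hfc.aestronglyMeasurable (ae_of_all _ fun ω => ?_)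
  simpa using hf ω

end ExpBdd

/-! ### Gaussian moments of hyperbolic functions -/

section Moments

variable {K : Type*} [Fintype K]

lemma integral_exp_dot (w : K → ℝ) :
    ∫ ω, rexp (w ⬝ᵥ ω) ∂stdGauss K = rexp ((w ⬝ᵥ w) / 2) := by
  have h : ∀ ω : K → ℝ, rexp (w ⬝ᵥ ω) = ∏ k, rexp (w k * ω k) := fun ω => by
    rw [dotProduct, Real.exp_sum]
  simp_rw [h]
  unfold stdGauss
  rw [integral_fintype_prod_eq_prod (fun k x => rexp (w k * x))]
  have h1 : ∀ t : ℝ, ∫ x, rexp (t * x) ∂gaussianReal 0 1 = rexp (t ^ 2 / 2) := fun t => by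
    have := congrFun (mgf_id_gaussianReal (μ := 0) (v := 1)) t
    simpa [mgf] using this
  simp_rw [h1, ← Real.exp_sum, dotProduct, Finset.sum_div, sq]

lemma integral_cosh_dot (w : K → ℝ) :
    ∫ ω, cosh (w ⬝ᵥ ω) ∂stdGauss K = rexp ((w ⬝ᵥ w) / 2) := by
  have h : ∀ ω : K → ℝ, cosh (w ⬝ᵥ ω) = (1 / 2) * (rexp (w ⬝ᵥ ω) + rexp ((-w) ⬝ᵥ ω)) :=
    fun ω => by rw [Real.cosh_eq, neg_dotProduct]; ring
  simp_rw [h]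
  rw [integral_const_mul, integral_add (ExpBdd.exp_dot w).integrable
    (ExpBdd.exp_dot (-w)).integrable, integral_exp_dot, integral_exp_dot]
  simp; ring

/-- Normalised Gaussian average of a product of four hyperbolic cosines. -/
def coshAvg (a b c d e f : ℝ) : ℝ :=
  (rexp (a + b + c + d + e + f) + rexp (a + b - c + d - e - f) + rexp (a - b + c - d + e - f) +
    rexp (a - b - c - d - e + f) + rexp (-a + b + c - d - e + f) + rexp (-a + b - c - d + e - f) +
    rexp (-a - b + c + d - e - f) + rexp (-a - b - c + d + e + f)) / 8

/-- Normalised Gaussian average of a product of two hyperbolic sines and two hyperbolic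
cosines. -/
def sinhAvg (a b c d e f : ℝ) : ℝ :=
  (rexp (a + b + c + d + e + f) + rexp (a + b - c + d - e - f) + rexp (a - b + c - d + e - f) +
    rexp (a - b - c - d - e + f) - rexp (-a + b + c - d - e + f) - rexp (-a + b - c - d + e - f) -
    rexp (-a - b + c + d - e - f) - rexp (-a - b - c + d + e + f)) / 8

lemma dot_self_four (w₁ w₂ w₃ w₄ : K → ℝ) (p q r : ℝ) :
    (w₁ + p • w₂ + q • w₃ + r • w₄) ⬝ᵥ (w₁ + p • w₂ + q • w₃ + r • w₄) =
      w₁ ⬝ᵥ w₁ + p ^ 2 * (w₂ ⬝ᵥ w₂) + q ^ 2 * (w₃ ⬝ᵥ w₃) + r ^ 2 * (w₄ ⬝ᵥ w₄) +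
      2 * (p * (w₁ ⬝ᵥ w₂) + q * (w₁ ⬝ᵥ w₃) + r * (w₁ ⬝ᵥ w₄) + p * q * (w₂ ⬝ᵥ w₃) +
        p * r * (w₂ ⬝ᵥ w₄) + q * r * (w₃ ⬝ᵥ w₄)) := by
  simp only [add_dotProduct, dotProduct_add, smul_dotProduct, dotProduct_smul, smul_eq_mul]
  rw [dotProduct_comm w₂ w₁, dotProduct_comm w₃ w₁, dotProduct_comm w₄ w₁, dotProduct_comm w₃ w₂,
    dotProduct_comm w₄ w₂, dotProduct_comm w₄ w₃]
  ring

lemma cosh_mul_four (a b c d : ℝ) : cosh a * cosh b * cosh c * cosh d =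
    (cosh (a + 1 * b + 1 * c + 1 * d) + cosh (a + 1 * b + 1 * c + -1 * d) +
      cosh (a + 1 * b + -1 * c + 1 * d) + cosh (a + 1 * b + -1 * c + -1 * d) +
      cosh (a + -1 * b + 1 * c + 1 * d) + cosh (a + -1 * b + 1 * c + -1 * d) +
      cosh (a + -1 * b + -1 * c + 1 * d) + cosh (a + -1 * b + -1 * c + -1 * d)) / 8 := by
  simp only [one_mul, neg_mul, Real.cosh_add, Real.sinh_add, Real.cosh_neg, Real.sinh_neg]
  ring

lemma sinh_mul_cosh_four (a b c d : ℝ) : sinh a * sinh b * cosh c * cosh d =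
    (cosh (a + 1 * b + 1 * c + 1 * d) + cosh (a + 1 * b + 1 * c + -1 * d) +
      cosh (a + 1 * b + -1 * c + 1 * d) + cosh (a + 1 * b + -1 * c + -1 * d) -
      cosh (a + -1 * b + 1 * c + 1 * d) - cosh (a + -1 * b + 1 * c + -1 * d) -
      cosh (a + -1 * b + -1 * c + 1 * d) - cosh (a + -1 * b + -1 * c + -1 * d)) / 8 := by
  simp only [one_mul, neg_mul, Real.cosh_add, Real.sinh_add, Real.cosh_neg, Real.sinh_neg]
  ring

lemma integral_cosh_four_lin (w₁ w₂ w₃ w₄ : K → ℝ) (p q r : ℝ) :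
    ∫ ω, cosh (w₁ ⬝ᵥ ω + p * (w₂ ⬝ᵥ ω) + q * (w₃ ⬝ᵥ ω) + r * (w₄ ⬝ᵥ ω)) ∂stdGauss K =
      rexp ((w₁ ⬝ᵥ w₁ + p ^ 2 * (w₂ ⬝ᵥ w₂) + q ^ 2 * (w₃ ⬝ᵥ w₃) + r ^ 2 * (w₄ ⬝ᵥ w₄)) / 2) *
      rexp (p * (w₁ ⬝ᵥ w₂) + q * (w₁ ⬝ᵥ w₃) + r * (w₁ ⬝ᵥ w₄) + p * q * (w₂ ⬝ᵥ w₃) +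
        p * r * (w₂ ⬝ᵥ w₄) + q * r * (w₃ ⬝ᵥ w₄)) := by
  have h : ∀ ω : K → ℝ, w₁ ⬝ᵥ ω + p * (w₂ ⬝ᵥ ω) + q * (w₃ ⬝ᵥ ω) + r * (w₄ ⬝ᵥ ω) =
      (w₁ + p • w₂ + q • w₃ + r • w₄) ⬝ᵥ ω := fun ω => by
    simp only [add_dotProduct, smul_dotProduct, smul_eq_mul]
  simp_rw [h]
  rw [integral_cosh_dot, dot_self_four, ← Real.exp_add]
  congr 1; ring

lemma integrable_cosh_four_lin (w₁ w₂ w₃ w₄ : K → ℝ) (p q r : ℝ) :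
    Integrable (fun ω => cosh (w₁ ⬝ᵥ ω + p * (w₂ ⬝ᵥ ω) + q * (w₃ ⬝ᵥ ω) + r * (w₄ ⬝ᵥ ω)))
      (stdGauss K) := by
  have h : ∀ ω : K → ℝ, w₁ ⬝ᵥ ω + p * (w₂ ⬝ᵥ ω) + q * (w₃ ⬝ᵥ ω) + r * (w₄ ⬝ᵥ ω) =
      (w₁ + p • w₂ + q • w₃ + r • w₄) ⬝ᵥ ω := fun ω => by
    simp only [add_dotProduct, smul_dotProduct, smul_eq_mul]
  simp_rw [h]
  exact (ExpBdd.cosh_dot _).integrable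

lemma integral_cosh_four (w₁ w₂ w₃ w₄ : K → ℝ) :
    ∫ ω, cosh (w₁ ⬝ᵥ ω) * cosh (w₂ ⬝ᵥ ω) * cosh (w₃ ⬝ᵥ ω) * cosh (w₄ ⬝ᵥ ω) ∂stdGauss K =
      rexp ((w₁ ⬝ᵥ w₁ + w₂ ⬝ᵥ w₂ + w₃ ⬝ᵥ w₃ + w₄ ⬝ᵥ w₄) / 2) *
        coshAvg (w₁ ⬝ᵥ w₂) (w₁ ⬝ᵥ w₃) (w₁ ⬝ᵥ w₄) (w₂ ⬝ᵥ w₃) (w₂ ⬝ᵥ w₄) (w₃ ⬝ᵥ w₄) := by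
  have hi := integrable_cosh_four_lin w₁ w₂ w₃ w₄
  simp_rw [cosh_mul_four]
  rw [integral_div, integral_add (by fun_prop) (hi _ _ _), integral_add (by fun_prop) (hi _ _ _),
    integral_add (by fun_prop) (hi _ _ _), integral_add (by fun_prop) (hi _ _ _),
    integral_add (by fun_prop) (hi _ _ _), integral_add (by fun_prop) (hi _ _ _),
    integral_add (hi _ _ _) (hi _ _ _)]
  simp only [integral_cosh_four_lin, coshAvg]
  ring_nf

lemma integral_sinh_cosh_four (w₁ w₂ w₃ w₄ : K → ℝ) :
    ∫ ω, sinh (w₁ ⬝ᵥ ω) * sinh (w₂ ⬝ᵥ ω) * cosh (w₃ ⬝ᵥ ω) * cosh (w₄ ⬝ᵥ ω) ∂stdGauss K =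
      rexp ((w₁ ⬝ᵥ w₁ + w₂ ⬝ᵥ w₂ + w₃ ⬝ᵥ w₃ + w₄ ⬝ᵥ w₄) / 2) *
        sinhAvg (w₁ ⬝ᵥ w₂) (w₁ ⬝ᵥ w₃) (w₁ ⬝ᵥ w₄) (w₂ ⬝ᵥ w₃) (w₂ ⬝ᵥ w₄) (w₃ ⬝ᵥ w₄) := by
  have hi := integrable_cosh_four_lin w₁ w₂ w₃ w₄
  simp_rw [sinh_mul_cosh_four]
  rw [integral_div, integral_sub (by fun_prop) (hi _ _ _), integral_sub (by fun_prop) (hi _ _ _),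
    integral_sub (by fun_prop) (hi _ _ _), integral_sub (by fun_prop) (hi _ _ _),
    integral_add (by fun_prop) (hi _ _ _), integral_add (by fun_prop) (hi _ _ _),
    integral_add (hi _ _ _) (hi _ _ _)]
  simp only [integral_cosh_four_lin, sinhAvg]
  ring_nf

end Moments

/-! ### Taylor estimates -/

/-- A numerical constant bounding the Taylor remainders. -/
def KT : ℝ := 216 * rexp 6

lemma KT_pos : 0 < KT := by unfold KT; positivity

lemma abs_exp_sub_cubic_le {x : ℝ} (hx : |x| ≤ 6) :
    |rexp x - (1 + x + x ^ 2 / 2 + x ^ 3 / 6)| ≤ rexp 6 * x ^ 4 := by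
  have h := Complex.norm_exp_sub_sum_le_norm_mul_exp (x : ℂ) 4
  have e : ((rexp x - (1 + x + x ^ 2 / 2 + x ^ 3 / 6) : ℝ) : ℂ) =
      Complex.exp x - ∑ m ∈ Finset.range 4, (x : ℂ) ^ m / (m.factorial : ℂ) := by
    simp [Finset.sum_range_succ, Nat.factorial]
  rw [← e, Complex.norm_real, Complex.norm_real, Real.norm_eq_abs, Real.norm_eq_abs] at h
  have h2 : |x| ^ 4 = x ^ 4 := by rw [← abs_pow, abs_of_nonneg (by positivity)]
  rw [h2] at h
  exact h.trans (by rw [mul_comm]; gcongr)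

lemma abs_exp_sub_quadratic_le {x : ℝ} (hx : |x| ≤ 6) :
    |rexp x - (1 + x + x ^ 2 / 2)| ≤ rexp 6 * |x| ^ 3 := by
  have h := Complex.norm_exp_sub_sum_le_norm_mul_exp (x : ℂ) 3
  have e : ((rexp x - (1 + x + x ^ 2 / 2) : ℝ) : ℂ) =
      Complex.exp x - ∑ m ∈ Finset.range 3, (x : ℂ) ^ m / (m.factorial : ℂ) := by
    simp [Finset.sum_range_succ, Nat.factorial]
  rw [← e, Complex.norm_real, Complex.norm_real, Real.norm_eq_abs, Real.norm_eq_abs] at h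
  exact h.trans (by rw [mul_comm]; gcongr)

section Six

variable {a b c d e f : ℝ}

lemma sum_six_le (ha : |a| ≤ 1) (hb : |b| ≤ 1) (hc : |c| ≤ 1) (hd : |d| ≤ 1) (he : |e| ≤ 1)
    (hf : |f| ≤ 1) {x : ℝ} (hx : |x| ≤ |a| + |b| + |c| + |d| + |e| + |f|) :
    |x| ≤ 6 ∧ x ^ 4 ≤ 216 * (a ^ 4 + b ^ 4 + c ^ 4 + d ^ 4 + e ^ 4 + f ^ 4) ∧
      |x| ^ 3 ≤ 216 * (|a| ^ 3 + |b| ^ 3 + |c| ^ 3 + |d| ^ 3 + |e| ^ 3 + |f| ^ 3) := by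
  have hy : ∀ i ∈ (Finset.univ : Finset (Fin 6)), 0 ≤ ![|a|, |b|, |c|, |d|, |e|, |f|] i := by
    intro i _; fin_cases i <;> simp
  have h4 := pow_sum_div_card_le_sum_pow hy 3
  have h3 := pow_sum_div_card_le_sum_pow hy 2
  simp only [Fin.sum_univ_six, Finset.card_univ, Fintype.card_fin, Matrix.cons_val] at h3 h4
  have e4 : ∀ y : ℝ, |y| ^ 4 = y ^ 4 := fun y => by
    rw [← abs_pow, abs_of_nonneg (by positivity)]
  norm_num [e4] at h3 h4
  rw [div_le_iff₀ (by norm_num)] at h3 h4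
  have i4 := pow_le_pow_left₀ (abs_nonneg x) hx 4
  have i3 := pow_le_pow_left₀ (abs_nonneg x) hx 3
  rw [e4] at i4
  refine ⟨by linarith, by linarith, ?_⟩
  have : 0 ≤ |a| ^ 3 + |b| ^ 3 + |c| ^ 3 + |d| ^ 3 + |e| ^ 3 + |f| ^ 3 := by positivity
  linarith

lemma coshAvg_taylor (ha : |a| ≤ 1) (hb : |b| ≤ 1) (hc : |c| ≤ 1) (hd : |d| ≤ 1) (he : |e| ≤ 1)
    (hf : |f| ≤ 1) :
    |coshAvg a b c d e f - (1 + (a ^ 2 + b ^ 2 + c ^ 2 + d ^ 2 + e ^ 2 + f ^ 2) / 2 +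
      a * b * d + a * c * e + b * c * f + d * e * f)| ≤
      KT * (a ^ 4 + b ^ 4 + c ^ 4 + d ^ 4 + e ^ 4 + f ^ 4) := by
  have key : ∀ x : ℝ, |x| ≤ |a| + |b| + |c| + |d| + |e| + |f| →
      |rexp x - (1 + x + x ^ 2 / 2 + x ^ 3 / 6)| ≤
        KT * (a ^ 4 + b ^ 4 + c ^ 4 + d ^ 4 + e ^ 4 + f ^ 4) := fun x hx => by
    obtain ⟨h1, h2, -⟩ := sum_six_le ha hb hc hd he hf hx
    refine (abs_exp_sub_cubic_le h1).trans ?_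
    have := mul_le_mul_of_nonneg_left h2 (Real.exp_nonneg 6)
    unfold KT; linarith
  have A := abs_le.1 (le_refl |a|)
  have B := abs_le.1 (le_refl |b|)
  have C := abs_le.1 (le_refl |c|)
  have D := abs_le.1 (le_refl |d|)
  have E := abs_le.1 (le_refl |e|)
  have F := abs_le.1 (le_refl |f|)
  have k1 := abs_le.1 (key (a + b + c + d + e + f) (abs_le.2 ⟨by linarith, by linarith⟩))
  have k2 := abs_le.1 (key (a + b - c + d - e - f) (abs_le.2 ⟨by linarith, by linarith⟩))
  have k3 := abs_le.1 (key (a - b + c - d + e - f) (abs_le.2 ⟨by linarith, by linarith⟩))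
  have k4 := abs_le.1 (key (a - b - c - d - e + f) (abs_le.2 ⟨by linarith, by linarith⟩))
  have k5 := abs_le.1 (key (-a + b + c - d - e + f) (abs_le.2 ⟨by linarith, by linarith⟩))
  have k6 := abs_le.1 (key (-a + b - c - d + e - f) (abs_le.2 ⟨by linarith, by linarith⟩))
  have k7 := abs_le.1 (key (-a - b + c + d - e - f) (abs_le.2 ⟨by linarith, by linarith⟩))
  have k8 := abs_le.1 (key (-a - b - c + d + e + f) (abs_le.2 ⟨by linarith, by linarith⟩))
  unfold coshAvg
  rw [abs_le]
  constructor <;> linarith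

lemma sinhAvg_taylor (ha : |a| ≤ 1) (hb : |b| ≤ 1) (hc : |c| ≤ 1) (hd : |d| ≤ 1) (he : |e| ≤ 1)
    (hf : |f| ≤ 1) :
    |sinhAvg a b c d e f - (a + b * d + c * e)| ≤
      KT * (|a| ^ 3 + |b| ^ 3 + |c| ^ 3 + |d| ^ 3 + |e| ^ 3 + |f| ^ 3) := by
  have key : ∀ x : ℝ, |x| ≤ |a| + |b| + |c| + |d| + |e| + |f| →
      |rexp x - (1 + x + x ^ 2 / 2)| ≤
        KT * (|a| ^ 3 + |b| ^ 3 + |c| ^ 3 + |d| ^ 3 + |e| ^ 3 + |f| ^ 3) := fun x hx => by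
    obtain ⟨h1, -, h2⟩ := sum_six_le ha hb hc hd he hf hx
    refine (abs_exp_sub_quadratic_le h1).trans ?_
    have := mul_le_mul_of_nonneg_left h2 (Real.exp_nonneg 6)
    unfold KT; linarith
  have A := abs_le.1 (le_refl |a|)
  have B := abs_le.1 (le_refl |b|)
  have C := abs_le.1 (le_refl |c|)
  have D := abs_le.1 (le_refl |d|)
  have E := abs_le.1 (le_refl |e|)
  have F := abs_le.1 (le_refl |f|)
  have k1 := abs_le.1 (key (a + b + c + d + e + f) (abs_le.2 ⟨by linarith, by linarith⟩))
  have k2 := abs_le.1 (key (a + b - c + d - e - f) (abs_le.2 ⟨by linarith, by linarith⟩))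
  have k3 := abs_le.1 (key (a - b + c - d + e - f) (abs_le.2 ⟨by linarith, by linarith⟩))
  have k4 := abs_le.1 (key (a - b - c - d - e + f) (abs_le.2 ⟨by linarith, by linarith⟩))
  have k5 := abs_le.1 (key (-a + b + c - d - e + f) (abs_le.2 ⟨by linarith, by linarith⟩))
  have k6 := abs_le.1 (key (-a + b - c - d + e - f) (abs_le.2 ⟨by linarith, by linarith⟩))
  have k7 := abs_le.1 (key (-a - b + c + d - e - f) (abs_le.2 ⟨by linarith, by linarith⟩))
  have k8 := abs_le.1 (key (-a - b - c + d + e + f) (abs_le.2 ⟨by linarith, by linarith⟩))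
  unfold sinhAvg
  rw [abs_le]
  constructor <;> linarith

lemma coshAvg_le (ha : |a| ≤ 1) (hb : |b| ≤ 1) (hc : |c| ≤ 1) (hd : |d| ≤ 1) (he : |e| ≤ 1)
    (hf : |f| ≤ 1) : coshAvg a b c d e f ≤ rexp 6 := by
  rw [abs_le] at ha hb hc hd he hf
  have key : ∀ x : ℝ, x ≤ 6 → rexp x ≤ rexp 6 := fun x hx => Real.exp_le_exp.2 hx
  unfold coshAvg
  rw [div_le_iff₀ (by norm_num)]
  have k1 := key (a + b + c + d + e + f) (by linarith)
  have k2 := key (a + b - c + d - e - f) (by linarith)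
  have k3 := key (a - b + c - d + e - f) (by linarith)
  have k4 := key (a - b - c - d - e + f) (by linarith)
  have k5 := key (-a + b + c - d - e + f) (by linarith)
  have k6 := key (-a + b - c - d + e - f) (by linarith)
  have k7 := key (-a - b + c + d - e - f) (by linarith)
  have k8 := key (-a - b - c + d + e + f) (by linarith)
  linarith

end Six

/-! ### Normalised hyperbolic functions of a Gaussian vector -/

section Normalised

variable {K : Type*} [Fintype K]

/-- Normalised hyperbolic cosine. -/
def nch (a : ℝ) (w ω : K → ℝ) : ℝ := cosh (w ⬝ᵥ ω) / rexp (a / 2)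

/-- Normalised hyperbolic sine. -/
def nsh (a : ℝ) (w ω : K → ℝ) : ℝ := sinh (w ⬝ᵥ ω) / rexp (a / 2)

lemma ExpBdd.nch (a : ℝ) (w : K → ℝ) : ExpBdd fun ω => nch a w ω := by
  simpa [_root_.nch, div_eq_mul_inv] using (ExpBdd.cosh_dot w).mul (ExpBdd.const (rexp (a / 2))⁻¹)

lemma ExpBdd.nsh (a : ℝ) (w : K → ℝ) : ExpBdd fun ω => nsh a w ω := by
  simpa [_root_.nsh, div_eq_mul_inv] using (ExpBdd.sinh_dot w).mul (ExpBdd.const (rexp (a / 2))⁻¹)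

lemma nch_pos (a : ℝ) (w ω : K → ℝ) : 0 < nch a w ω := div_pos (Real.cosh_pos _) (Real.exp_pos _)

lemma le_nch {a : ℝ} (ha : a ≤ 1) (w ω : K → ℝ) : 3 / 5 ≤ nch a w ω := by
  unfold nch
  rw [le_div_iff₀ (Real.exp_pos _)]
  have h1 : rexp (a / 2) ≤ 5 / 3 := by
    have h2 : rexp (a / 2) ≤ rexp (1 / 2) := Real.exp_le_exp.2 (by linarith)
    have h3 : rexp (1 / 2) ^ 2 = rexp 1 := by rw [← Real.exp_nat_mul]; norm_num
    have := Real.exp_one_lt_d9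
    nlinarith [Real.exp_pos (1 / 2)]
  have := Real.one_le_cosh (w ⬝ᵥ ω)
  linarith

lemma abs_nsh_le_nch (a : ℝ) (w ω : K → ℝ) : |nsh a w ω| ≤ nch a w ω := by
  unfold nsh nch
  rw [abs_div, abs_of_pos (Real.exp_pos (a / 2))]
  refine div_le_div_of_nonneg_right ?_ (Real.exp_nonneg _)
  rw [abs_le, Real.sinh_eq, Real.cosh_eq]
  constructor <;> linarith [Real.exp_pos (w ⬝ᵥ ω), Real.exp_pos (-(w ⬝ᵥ ω))]

variable {a : ℝ} {w₁ w₂ w₃ w₄ : K → ℝ}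

lemma integral_nch_four (h₁ : w₁ ⬝ᵥ w₁ = a) (h₂ : w₂ ⬝ᵥ w₂ = a) (h₃ : w₃ ⬝ᵥ w₃ = a)
    (h₄ : w₄ ⬝ᵥ w₄ = a) :
    ∫ ω, nch a w₁ ω * nch a w₂ ω * nch a w₃ ω * nch a w₄ ω ∂stdGauss K =
      coshAvg (w₁ ⬝ᵥ w₂) (w₁ ⬝ᵥ w₃) (w₁ ⬝ᵥ w₄) (w₂ ⬝ᵥ w₃) (w₂ ⬝ᵥ w₄) (w₃ ⬝ᵥ w₄) := by
  simp_rw [nch, div_mul_div_comm, ← Real.exp_add]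
  rw [integral_div, integral_cosh_four, h₁, h₂, h₃, h₄, mul_div_assoc, mul_div_left_comm,
    ← Real.exp_sub]
  ring_nf; simp

lemma integral_nch_three (h₁ : w₁ ⬝ᵥ w₁ = a) (h₂ : w₂ ⬝ᵥ w₂ = a) (h₃ : w₃ ⬝ᵥ w₃ = a) :
    ∫ ω, nch a w₁ ω * nch a w₂ ω * nch a w₃ ω ∂stdGauss K =
      coshAvg (w₁ ⬝ᵥ w₂) (w₁ ⬝ᵥ w₃) 0 (w₂ ⬝ᵥ w₃) 0 0 := by
  simp_rw [nch, div_mul_div_comm, ← Real.exp_add]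
  have h := integral_cosh_four w₁ w₂ w₃ 0
  simp only [zero_dotProduct, dotProduct_zero, Real.cosh_zero, mul_one] at h
  rw [integral_div, h, h₁, h₂, h₃, mul_div_assoc, mul_div_left_comm, ← Real.exp_sub]
  ring_nf; simp

lemma integral_nch_two (h₁ : w₁ ⬝ᵥ w₁ = a) (h₂ : w₂ ⬝ᵥ w₂ = a) :
    ∫ ω, nch a w₁ ω * nch a w₂ ω ∂stdGauss K = coshAvg (w₁ ⬝ᵥ w₂) 0 0 0 0 0 := by
  simp_rw [nch, div_mul_div_comm, ← Real.exp_add]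
  have h := integral_cosh_four w₁ w₂ 0 0
  simp only [zero_dotProduct, dotProduct_zero, Real.cosh_zero, mul_one] at h
  rw [integral_div, h, h₁, h₂, mul_div_assoc, mul_div_left_comm, ← Real.exp_sub]
  ring_nf; simp

lemma integral_nch_one (h₁ : w₁ ⬝ᵥ w₁ = a) : ∫ ω, nch a w₁ ω ∂stdGauss K = 1 := by
  simp_rw [nch]
  rw [integral_div, integral_cosh_dot, h₁, div_self (Real.exp_pos _).ne']

lemma integral_nsh_nch_four (h₁ : w₁ ⬝ᵥ w₁ = a) (h₂ : w₂ ⬝ᵥ w₂ = a) (h₃ : w₃ ⬝ᵥ w₃ = a)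
    (h₄ : w₄ ⬝ᵥ w₄ = a) :
    ∫ ω, nsh a w₁ ω * nsh a w₂ ω * nch a w₃ ω * nch a w₄ ω ∂stdGauss K =
      sinhAvg (w₁ ⬝ᵥ w₂) (w₁ ⬝ᵥ w₃) (w₁ ⬝ᵥ w₄) (w₂ ⬝ᵥ w₃) (w₂ ⬝ᵥ w₄) (w₃ ⬝ᵥ w₄) := by
  simp_rw [nch, nsh, div_mul_div_comm, ← Real.exp_add]
  rw [integral_div, integral_sinh_cosh_four, h₁, h₂, h₃, h₄, mul_div_assoc, mul_div_left_comm,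
    ← Real.exp_sub]
  ring_nf; simp

lemma integral_nsh_nch_three (h₁ : w₁ ⬝ᵥ w₁ = a) (h₂ : w₂ ⬝ᵥ w₂ = a) (h₃ : w₃ ⬝ᵥ w₃ = a) :
    ∫ ω, nsh a w₁ ω * nsh a w₂ ω * nch a w₃ ω ∂stdGauss K =
      sinhAvg (w₁ ⬝ᵥ w₂) (w₁ ⬝ᵥ w₃) 0 (w₂ ⬝ᵥ w₃) 0 0 := by
  simp_rw [nch, nsh, div_mul_div_comm, ← Real.exp_add]
  have h := integral_sinh_cosh_four w₁ w₂ w₃ 0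
  simp only [zero_dotProduct, dotProduct_zero, Real.cosh_zero, mul_one] at h
  rw [integral_div, h, h₁, h₂, h₃, mul_div_assoc, mul_div_left_comm, ← Real.exp_sub]
  ring_nf; simp

lemma integral_nsh_two (h₁ : w₁ ⬝ᵥ w₁ = a) (h₂ : w₂ ⬝ᵥ w₂ = a) :
    ∫ ω, nsh a w₁ ω * nsh a w₂ ω ∂stdGauss K = sinhAvg (w₁ ⬝ᵥ w₂) 0 0 0 0 0 := by
  simp_rw [nsh, div_mul_div_comm, ← Real.exp_add]
  have h := integral_sinh_cosh_four w₁ w₂ 0 0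
  simp only [zero_dotProduct, dotProduct_zero, Real.cosh_zero, mul_one] at h
  rw [integral_div, h, h₁, h₂, mul_div_assoc, mul_div_left_comm, ← Real.exp_sub]
  ring_nf; simp

lemma nsh_two_estimate (h₁ : w₁ ⬝ᵥ w₁ = a) (h₂ : w₂ ⬝ᵥ w₂ = a) (h₁₂ : |w₁ ⬝ᵥ w₂| ≤ 1) :
    |∫ ω, nsh a w₁ ω * nsh a w₂ ω ∂stdGauss K - w₁ ⬝ᵥ w₂| ≤ KT * |w₁ ⬝ᵥ w₂| ^ 3 := by
  rw [integral_nsh_two h₁ h₂]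
  have z : |(0 : ℝ)| ≤ 1 := by simp
  simpa using sinhAvg_taylor h₁₂ z z z z z

lemma nsh_dev_estimate (h₁ : w₁ ⬝ᵥ w₁ = a) (h₂ : w₂ ⬝ᵥ w₂ = a) (h₃ : w₃ ⬝ᵥ w₃ = a)
    (h₁₂ : |w₁ ⬝ᵥ w₂| ≤ 1) (h₁₃ : |w₁ ⬝ᵥ w₃| ≤ 1) (h₂₃ : |w₂ ⬝ᵥ w₃| ≤ 1) :
    |∫ ω, nsh a w₁ ω * nsh a w₂ ω * (nch a w₃ ω - 1) ∂stdGauss K -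
        (w₁ ⬝ᵥ w₃) * (w₂ ⬝ᵥ w₃)| ≤
      2 * KT * (|w₁ ⬝ᵥ w₂| ^ 3 + |w₁ ⬝ᵥ w₃| ^ 3 + |w₂ ⬝ᵥ w₃| ^ 3) := by
  have z : |(0 : ℝ)| ≤ 1 := by simp
  have i2 : Integrable (fun ω => nsh a w₁ ω * nsh a w₂ ω) (stdGauss K) :=
    ((ExpBdd.nsh a w₁).mul (ExpBdd.nsh a w₂)).integrable
  have i3 : Integrable (fun ω => nsh a w₁ ω * nsh a w₂ ω * nch a w₃ ω) (stdGauss K) :=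
    (((ExpBdd.nsh a w₁).mul (ExpBdd.nsh a w₂)).mul (ExpBdd.nch a w₃)).integrable
  simp_rw [mul_sub, mul_one]
  rw [integral_sub i3 i2, integral_nsh_nch_three h₁ h₂ h₃, integral_nsh_two h₁ h₂]
  have k1 := sinhAvg_taylor h₁₂ z z z z z
  have k2 := sinhAvg_taylor h₁₂ h₁₃ z h₂₃ z z
  simp only [abs_zero, mul_zero, add_zero, ne_eq, OfNat.ofNat_ne_zero,
    not_false_eq_true, zero_pow] at k1 k2
  have := KT_pos
  have p1 : 0 ≤ KT * |w₁ ⬝ᵥ w₃| ^ 3 := by positivity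
  have p2 : 0 ≤ KT * |w₂ ⬝ᵥ w₃| ^ 3 := by positivity
  rw [abs_le] at k1 k2 ⊢
  constructor <;> linarith

lemma nsh_dev_dev_estimate (h₁ : w₁ ⬝ᵥ w₁ = a) (h₂ : w₂ ⬝ᵥ w₂ = a) (h₃ : w₃ ⬝ᵥ w₃ = a)
    (h₄ : w₄ ⬝ᵥ w₄ = a)
    (h₁₂ : |w₁ ⬝ᵥ w₂| ≤ 1) (h₁₃ : |w₁ ⬝ᵥ w₃| ≤ 1) (h₁₄ : |w₁ ⬝ᵥ w₄| ≤ 1)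
    (h₂₃ : |w₂ ⬝ᵥ w₃| ≤ 1) (h₂₄ : |w₂ ⬝ᵥ w₄| ≤ 1) (h₃₄ : |w₃ ⬝ᵥ w₄| ≤ 1) :
    |∫ ω, nsh a w₁ ω * nsh a w₂ ω * (nch a w₃ ω - 1) * (nch a w₄ ω - 1) ∂stdGauss K| ≤
      4 * KT * (|w₁ ⬝ᵥ w₂| ^ 3 + |w₁ ⬝ᵥ w₃| ^ 3 + |w₁ ⬝ᵥ w₄| ^ 3 + |w₂ ⬝ᵥ w₃| ^ 3 +
        |w₂ ⬝ᵥ w₄| ^ 3 + |w₃ ⬝ᵥ w₄| ^ 3) := by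
  have z : |(0 : ℝ)| ≤ 1 := by simp
  have b2 := (ExpBdd.nsh a w₁).mul (ExpBdd.nsh a w₂)
  have i2 : Integrable (fun ω => nsh a w₁ ω * nsh a w₂ ω) (stdGauss K) := b2.integrable
  have i3 : Integrable (fun ω => nsh a w₁ ω * nsh a w₂ ω * nch a w₃ ω) (stdGauss K) :=
    (b2.mul (ExpBdd.nch a w₃)).integrable
  have i3' : Integrable (fun ω => nsh a w₁ ω * nsh a w₂ ω * nch a w₄ ω) (stdGauss K) :=
    (b2.mul (ExpBdd.nch a w₄)).integrable
  have i4 : Integrable (fun ω => nsh a w₁ ω * nsh a w₂ ω * nch a w₃ ω * nch a w₄ ω)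
    (stdGauss K) := ((b2.mul (ExpBdd.nch a w₃)).mul (ExpBdd.nch a w₄)).integrable
  have e : ∀ ω, nsh a w₁ ω * nsh a w₂ ω * (nch a w₃ ω - 1) * (nch a w₄ ω - 1) =
      nsh a w₁ ω * nsh a w₂ ω * nch a w₃ ω * nch a w₄ ω - nsh a w₁ ω * nsh a w₂ ω * nch a w₃ ω -
        nsh a w₁ ω * nsh a w₂ ω * nch a w₄ ω + nsh a w₁ ω * nsh a w₂ ω := fun ω => by ring
  simp_rw [e]
  rw [integral_add (by fun_prop) i2, integral_sub (by fun_prop) i3', integral_sub i4 i3,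
    integral_nsh_nch_three h₁ h₂ h₃, integral_nsh_two h₁ h₂, integral_nsh_nch_three h₁ h₂ h₄,
    integral_nsh_nch_four h₁ h₂ h₃ h₄]
  have k1 := sinhAvg_taylor h₁₂ z z z z z
  have k2 := sinhAvg_taylor h₁₂ h₁₃ z h₂₃ z z
  have k3 := sinhAvg_taylor h₁₂ h₁₄ z h₂₄ z z
  have k4 := sinhAvg_taylor h₁₂ h₁₃ h₁₄ h₂₃ h₂₄ h₃₄
  simp only [abs_zero, mul_zero, add_zero, ne_eq, OfNat.ofNat_ne_zero,
    not_false_eq_true, zero_pow] at k1 k2 k3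
  have := KT_pos
  have p1 : 0 ≤ KT * |w₁ ⬝ᵥ w₃| ^ 3 := by positivity
  have p2 : 0 ≤ KT * |w₂ ⬝ᵥ w₃| ^ 3 := by positivity
  have p3 : 0 ≤ KT * |w₁ ⬝ᵥ w₄| ^ 3 := by positivity
  have p4 : 0 ≤ KT * |w₂ ⬝ᵥ w₄| ^ 3 := by positivity
  have p5 : 0 ≤ KT * |w₃ ⬝ᵥ w₄| ^ 3 := by positivity
  rw [abs_le] at k1 k2 k3 k4 ⊢
  constructor <;> linarith

lemma pow_four_le_sq {x : ℝ} (hx : |x| ≤ 1) : x ^ 4 ≤ x ^ 2 := by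
  have : x ^ 2 ≤ 1 := (sq_le_one_iff_abs_le_one x).2 hx
  nlinarith [sq_nonneg x]

lemma nch_two_ge_one (h₁ : w₁ ⬝ᵥ w₁ = a) (h₂ : w₂ ⬝ᵥ w₂ = a) :
    1 ≤ ∫ ω, nch a w₁ ω * nch a w₂ ω ∂stdGauss K := by
  rw [integral_nch_two h₁ h₂]
  have h := Real.one_le_cosh (w₁ ⬝ᵥ w₂)
  rw [Real.cosh_eq] at h
  unfold coshAvg
  simp only [add_zero, sub_zero]
  linarith

lemma nch_two_estimate (h₁ : w₁ ⬝ᵥ w₁ = a) (h₂ : w₂ ⬝ᵥ w₂ = a) (h₁₂ : |w₁ ⬝ᵥ w₂| ≤ 1) :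
    |∫ ω, nch a w₁ ω * nch a w₂ ω ∂stdGauss K - 1| ≤ (KT + 1) * (w₁ ⬝ᵥ w₂) ^ 2 := by
  rw [integral_nch_two h₁ h₂]
  have z : |(0 : ℝ)| ≤ 1 := by simp
  have k := coshAvg_taylor h₁₂ z z z z z
  simp only [mul_zero, add_zero, ne_eq, OfNat.ofNat_ne_zero,
    not_false_eq_true, zero_pow] at k
  have := mul_le_mul_of_nonneg_left (pow_four_le_sq h₁₂) KT_pos.le
  rw [abs_le] at k ⊢
  constructor <;> linarith [sq_nonneg (w₁ ⬝ᵥ w₂)]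

lemma abs_mul_three_le {x y z : ℝ} (hz : |z| ≤ 1) : |x * y * z| ≤ (x ^ 2 + y ^ 2) / 2 := by
  rw [abs_mul, abs_mul]
  have h1 : |x| * |y| * |z| ≤ |x| * |y| := mul_le_of_le_one_right (by positivity) hz
  have h2 : 0 ≤ (|x| - |y|) ^ 2 := sq_nonneg _
  nlinarith [sq_abs x, sq_abs y]

lemma nch_dev_estimate (h₁ : w₁ ⬝ᵥ w₁ = a) (h₂ : w₂ ⬝ᵥ w₂ = a) (h₃ : w₃ ⬝ᵥ w₃ = a)
    (h₁₂ : |w₁ ⬝ᵥ w₂| ≤ 1) (h₁₃ : |w₁ ⬝ᵥ w₃| ≤ 1) (h₂₃ : |w₂ ⬝ᵥ w₃| ≤ 1) :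
    |∫ ω, nch a w₁ ω * nch a w₂ ω * (nch a w₃ ω - 1) ∂stdGauss K| ≤
      2 * (KT + 1) * ((w₁ ⬝ᵥ w₂) ^ 2 + (w₁ ⬝ᵥ w₃) ^ 2 + (w₂ ⬝ᵥ w₃) ^ 2) := by
  have z : |(0 : ℝ)| ≤ 1 := by simp
  have i2 : Integrable (fun ω => nch a w₁ ω * nch a w₂ ω) (stdGauss K) :=
    ((ExpBdd.nch a w₁).mul (ExpBdd.nch a w₂)).integrable
  have i3 : Integrable (fun ω => nch a w₁ ω * nch a w₂ ω * nch a w₃ ω) (stdGauss K) :=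
    (((ExpBdd.nch a w₁).mul (ExpBdd.nch a w₂)).mul (ExpBdd.nch a w₃)).integrable
  simp_rw [mul_sub, mul_one]
  rw [integral_sub i3 i2, integral_nch_three h₁ h₂ h₃, integral_nch_two h₁ h₂]
  have k1 := coshAvg_taylor h₁₂ z z z z z
  have k2 := coshAvg_taylor h₁₂ h₁₃ z h₂₃ z z
  simp only [mul_zero, add_zero, ne_eq, OfNat.ofNat_ne_zero,
    not_false_eq_true, zero_pow] at k1 k2
  have q1 := mul_le_mul_of_nonneg_left (pow_four_le_sq h₁₂) KT_pos.le
  have q2 := mul_le_mul_of_nonneg_left (pow_four_le_sq h₁₃) KT_pos.le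
  have q3 := mul_le_mul_of_nonneg_left (pow_four_le_sq h₂₃) KT_pos.le
  have q4 := abs_le.1 (abs_mul_three_le (x := w₁ ⬝ᵥ w₂) (y := w₁ ⬝ᵥ w₃) h₂₃)
  have := KT_pos
  have p1 : 0 ≤ KT * (w₁ ⬝ᵥ w₃) ^ 2 := by positivity
  have p2 : 0 ≤ KT * (w₂ ⬝ᵥ w₃) ^ 2 := by positivity
  rw [abs_le] at k1 k2 ⊢
  constructor <;> linarith [sq_nonneg (w₁ ⬝ᵥ w₂), sq_nonneg (w₁ ⬝ᵥ w₃), sq_nonneg (w₂ ⬝ᵥ w₃)]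

lemma nch_dev_four_le (h₁ : w₁ ⬝ᵥ w₁ = a) (h₂ : w₂ ⬝ᵥ w₂ = a) (h₃ : w₃ ⬝ᵥ w₃ = a)
    (h₄ : w₄ ⬝ᵥ w₄ = a)
    (h₁₂ : |w₁ ⬝ᵥ w₂| ≤ 1) (h₁₃ : |w₁ ⬝ᵥ w₃| ≤ 1) (h₁₄ : |w₁ ⬝ᵥ w₄| ≤ 1)
    (h₂₃ : |w₂ ⬝ᵥ w₃| ≤ 1) (h₂₄ : |w₂ ⬝ᵥ w₄| ≤ 1) (h₃₄ : |w₃ ⬝ᵥ w₄| ≤ 1) :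
    ∫ ω, (nch a w₁ ω - 1) * (nch a w₂ ω - 1) * (nch a w₃ ω - 1) * (nch a w₄ ω - 1) ∂stdGauss K ≤
      4 * KT * ((w₁ ⬝ᵥ w₂) ^ 4 + (w₁ ⬝ᵥ w₃) ^ 4 + (w₁ ⬝ᵥ w₄) ^ 4 + (w₂ ⬝ᵥ w₃) ^ 4 +
        (w₂ ⬝ᵥ w₄) ^ 4 + (w₃ ⬝ᵥ w₄) ^ 4) := by
  have z : |(0 : ℝ)| ≤ 1 := by simp
  have c1 := ExpBdd.nch a w₁
  have c2 := ExpBdd.nch a w₂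
  have c3 := ExpBdd.nch a w₃
  have c4 := ExpBdd.nch a w₄
  have e : ∀ ω, (nch a w₁ ω - 1) * (nch a w₂ ω - 1) * (nch a w₃ ω - 1) * (nch a w₄ ω - 1) =
      nch a w₁ ω * nch a w₂ ω * nch a w₃ ω * nch a w₄ ω -
      nch a w₁ ω * nch a w₂ ω * nch a w₃ ω - nch a w₁ ω * nch a w₂ ω * nch a w₄ ω -
      nch a w₁ ω * nch a w₃ ω * nch a w₄ ω - nch a w₂ ω * nch a w₃ ω * nch a w₄ ω +
      nch a w₁ ω * nch a w₂ ω + nch a w₁ ω * nch a w₃ ω + nch a w₁ ω * nch a w₄ ω +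
      nch a w₂ ω * nch a w₃ ω + nch a w₂ ω * nch a w₄ ω + nch a w₃ ω * nch a w₄ ω -
      nch a w₁ ω - nch a w₂ ω - nch a w₃ ω - nch a w₄ ω + 1 := fun ω => by ring
  simp_rw [e]
  have j1234 := (((c1.mul c2).mul c3).mul c4).integrable
  have j123 := ((c1.mul c2).mul c3).integrable
  have j124 := ((c1.mul c2).mul c4).integrable
  have j134 := ((c1.mul c3).mul c4).integrable
  have j234 := ((c2.mul c3).mul c4).integrable
  have j12 := (c1.mul c2).integrable
  have j13 := (c1.mul c3).integrable
  have j14 := (c1.mul c4).integrable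
  have j23 := (c2.mul c3).integrable
  have j24 := (c2.mul c4).integrable
  have j34 := (c3.mul c4).integrable
  have j1 := c1.integrable
  have j2 := c2.integrable
  have j3 := c3.integrable
  have j4 := c4.integrable
  rw [integral_add (by fun_prop) (by fun_prop), integral_sub (by fun_prop) j4,
    integral_sub (by fun_prop) j3, integral_sub (by fun_prop) j2,
    integral_sub (by fun_prop) j1, integral_add (by fun_prop) j34,
    integral_add (by fun_prop) j24, integral_add (by fun_prop) j23,
    integral_add (by fun_prop) j14, integral_add (by fun_prop) j13,
    integral_add (by fun_prop) j12, integral_sub (by fun_prop) j234,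
    integral_sub (by fun_prop) j134, integral_sub (by fun_prop) j124,
    integral_sub j1234 j123,
    integral_nch_four h₁ h₂ h₃ h₄, integral_nch_three h₁ h₂ h₃, integral_nch_three h₁ h₂ h₄,
    integral_nch_three h₁ h₃ h₄, integral_nch_three h₂ h₃ h₄, integral_nch_two h₁ h₂,
    integral_nch_two h₁ h₃, integral_nch_two h₁ h₄, integral_nch_two h₂ h₃,
    integral_nch_two h₂ h₄, integral_nch_two h₃ h₄, integral_nch_one h₁, integral_nch_one h₂,
    integral_nch_one h₃, integral_nch_one h₄]
  have k1 := coshAvg_taylor h₁₂ h₁₃ h₁₄ h₂₃ h₂₄ h₃₄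
  have k2 := coshAvg_taylor h₁₂ h₁₃ z h₂₃ z z
  have k3 := coshAvg_taylor h₁₂ h₁₄ z h₂₄ z z
  have k4 := coshAvg_taylor h₁₃ h₁₄ z h₃₄ z z
  have k5 := coshAvg_taylor h₂₃ h₂₄ z h₃₄ z z
  have l1 := coshAvg_taylor h₁₂ z z z z z
  have l2 := coshAvg_taylor h₁₃ z z z z z
  have l3 := coshAvg_taylor h₁₄ z z z z z
  have l4 := coshAvg_taylor h₂₃ z z z z z
  have l5 := coshAvg_taylor h₂₄ z z z z z
  have l6 := coshAvg_taylor h₃₄ z z z z z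
  simp only [mul_zero, add_zero, ne_eq, OfNat.ofNat_ne_zero,
    not_false_eq_true, zero_pow] at k1 k2 k3 k4 k5 l1 l2 l3 l4 l5 l6
  rw [abs_le] at k1 k2 k3 k4 k5 l1 l2 l3 l4 l5 l6
  simp only [integral_const, probReal_univ, smul_eq_mul, mul_one]
  linarith [k1.2, k2.1, k3.1, k4.1, k5.1, l1.2, l2.2, l3.2, l4.2, l5.2, l6.2]

lemma nch_four_le (h₁ : w₁ ⬝ᵥ w₁ = a) (h₂ : w₂ ⬝ᵥ w₂ = a) (h₃ : w₃ ⬝ᵥ w₃ = a)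
    (h₄ : w₄ ⬝ᵥ w₄ = a)
    (h₁₂ : |w₁ ⬝ᵥ w₂| ≤ 1) (h₁₃ : |w₁ ⬝ᵥ w₃| ≤ 1) (h₁₄ : |w₁ ⬝ᵥ w₄| ≤ 1)
    (h₂₃ : |w₂ ⬝ᵥ w₃| ≤ 1) (h₂₄ : |w₂ ⬝ᵥ w₄| ≤ 1) (h₃₄ : |w₃ ⬝ᵥ w₄| ≤ 1) :
    ∫ ω, nch a w₁ ω * nch a w₂ ω * nch a w₃ ω * nch a w₄ ω ∂stdGauss K ≤ rexp 6 := by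
  rw [integral_nch_four h₁ h₂ h₃ h₄]
  exact coshAvg_le h₁₂ h₁₃ h₁₄ h₂₃ h₂₄ h₃₄

end Normalised

/-! ### Finite averages -/

/-- Average of `f` with respect to the weights `p`. -/
def ev {S : Type*} [Fintype S] (p : S → ℝ) (f : S → ℝ) : ℝ := ∑ s, p s * f s

section Averages

variable {S K : Type*} [Fintype S] [Fintype K] {p q : S → ℝ}

lemma ev_add (f g : S → ℝ) : ev p (fun s => f s + g s) = ev p f + ev p g := by
  simp [ev, mul_add, Finset.sum_add_distrib]

lemma ev_sub (f g : S → ℝ) : ev p (fun s => f s - g s) = ev p f - ev p g := by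
  simp [ev, mul_sub, Finset.sum_sub_distrib]

lemma ev_mul_left (c : ℝ) (f : S → ℝ) : ev p (fun s => c * f s) = c * ev p f := by
  simp only [ev, Finset.mul_sum]
  exact Finset.sum_congr rfl fun _ _ => by ring

lemma ev_mul_right (f : S → ℝ) (c : ℝ) : ev p (fun s => f s * c) = ev p f * c := by
  simp only [ev, Finset.sum_mul]
  exact Finset.sum_congr rfl fun _ _ => by ring

lemma ev_div (f : S → ℝ) (c : ℝ) : ev p (fun s => f s / c) = ev p f / c := by
  simp only [div_eq_mul_inv, ev_mul_right]

lemma ev_const (hp : ∑ s, p s = 1) (c : ℝ) : ev p (fun _ => c) = c := by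
  simp [ev, ← Finset.sum_mul, hp]

lemma ev_mono (hp : ∀ s, 0 ≤ p s) {f g : S → ℝ} (h : ∀ s, f s ≤ g s) : ev p f ≤ ev p g :=
  Finset.sum_le_sum fun s _ => mul_le_mul_of_nonneg_left (h s) (hp s)

lemma ev_nonneg (hp : ∀ s, 0 ≤ p s) {f : S → ℝ} (h : ∀ s, 0 ≤ f s) : 0 ≤ ev p f :=
  Finset.sum_nonneg fun s _ => mul_nonneg (hp s) (h s)

lemma ev_comm (F : S → S → ℝ) :
    ev p (fun s => ev q fun t => F s t) = ev q fun t => ev p fun s => F s t := by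
  simp only [ev, Finset.mul_sum]
  rw [Finset.sum_comm]
  exact Finset.sum_congr rfl fun _ _ => Finset.sum_congr rfl fun _ _ => by ring

lemma ExpBdd.ev {F : S → (K → ℝ) → ℝ} (h : ∀ s, ExpBdd (F s)) :
    ExpBdd fun ω => ev p fun s => F s ω :=
  ExpBdd.sum _ fun s => (ExpBdd.const _).mul (h s)

lemma integral_ev {F : S → (K → ℝ) → ℝ} (h : ∀ s, ExpBdd (F s)) :
    ∫ ω, ev p (fun s => F s ω) ∂stdGauss K = ev p fun s => ∫ ω, F s ω ∂stdGauss K := by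
  unfold _root_.ev
  rw [integral_finsetSum _ fun s _ => ((h s).integrable.const_mul _)]
  exact Finset.sum_congr rfl fun s _ => integral_const_mul _ _

end Averages

/-! ### Gaussian cavity estimates -/

/-- Gram structure of the cavity vectors: two families `u`, `v` of vectors indexed by
configurations, with covariances proportional to a bounded symmetric kernel `r`. -/
structure CavGram {S K : Type*} [Fintype S] [Fintype K] (u v : S → K → ℝ) (r : S → S → ℝ)
    (x y a : ℝ) : Prop where
  uu : ∀ s t, u s ⬝ᵥ u t = x * r s t
  vv : ∀ s t, v s ⬝ᵥ v t = x * r s t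
  uv : ∀ s t, u s ⬝ᵥ v t = y * r s t
  diag : ∀ s, x * r s s = a
  symm : ∀ s t, r s t = r t s
  abs_le : ∀ s t, |r s t| ≤ 1
  x_nonneg : 0 ≤ x
  x_le : x ≤ 1
  y_nonneg : 0 ≤ y
  y_le : y ≤ 1

section Cavity

variable {S K : Type*} [Fintype S] [Fintype K] {u v : S → K → ℝ} {r : S → S → ℝ} {x y a : ℝ}
  {p q : S → ℝ}

lemma CavGram.abs_mul_le (h : CavGram u v r x y a) (s t : S) : |x * r s t| ≤ 1 := by
  rw [abs_mul, abs_of_nonneg h.x_nonneg]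
  exact mul_le_one₀ h.x_le (abs_nonneg _) (h.abs_le s t)

lemma CavGram.abs_mul_le' (h : CavGram u v r x y a) (s t : S) : |y * r s t| ≤ 1 := by
  rw [abs_mul, abs_of_nonneg h.y_nonneg]
  exact mul_le_one₀ h.y_le (abs_nonneg _) (h.abs_le s t)

lemma CavGram.a_le [Nonempty S] (h : CavGram u v r x y a) : a ≤ 1 := by
  obtain ⟨s⟩ := ‹Nonempty S›
  rw [← h.diag s]
  exact (le_abs_self _).trans (h.abs_mul_le s s)

lemma CavGram.swap (h : CavGram u v r x y a) : CavGram v u r x y a where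
  uu := h.vv
  vv := h.uu
  uv s t := by rw [dotProduct_comm, h.uv, h.symm]
  diag := h.diag
  symm := h.symm
  abs_le := h.abs_le
  x_nonneg := h.x_nonneg
  x_le := h.x_le
  y_nonneg := h.y_nonneg
  y_le := h.y_le

/-- Replacing `sinh`, `cosh` by their normalised versions does not change Gibbs averages. -/
lemma ev_ratio_sinh (Φ : S → S → ℝ) (ω : K → ℝ) (a : ℝ) :
    (ev p fun s => ev q fun t => Φ s t * (sinh (u s ⬝ᵥ ω) * sinh (v t ⬝ᵥ ω))) /
      ((ev p fun s => cosh (u s ⬝ᵥ ω)) * ev q fun t => cosh (v t ⬝ᵥ ω)) =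
    (ev p fun s => ev q fun t => Φ s t * (nsh a (u s) ω * nsh a (v t) ω)) /
      ((ev p fun s => nch a (u s) ω) * ev q fun t => nch a (v t) ω) := by
  have e : (ev p fun s => ev q fun t => Φ s t * (nsh a (u s) ω * nsh a (v t) ω)) =
      (ev p fun s => ev q fun t => Φ s t * (sinh (u s ⬝ᵥ ω) * sinh (v t ⬝ᵥ ω))) /
        (rexp (a / 2) * rexp (a / 2)) := by
    have : ∀ s t, Φ s t * (nsh a (u s) ω * nsh a (v t) ω) =
        Φ s t * (sinh (u s ⬝ᵥ ω) * sinh (v t ⬝ᵥ ω)) / (rexp (a / 2) * rexp (a / 2)) := fun s t => by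
      unfold nsh
      rw [div_mul_div_comm, ← mul_div_assoc]
    simp only [this, ev_div]
  rw [e]
  simp only [nch, ev_div]
  rw [div_mul_div_comm, div_div_div_cancel_right₀ (by positivity)]

lemma ev_ratio_cosh (Φ : S → S → ℝ) (ω : K → ℝ) (a : ℝ) :
    (ev p fun s => ev q fun t => Φ s t * (cosh (u s ⬝ᵥ ω) * cosh (v t ⬝ᵥ ω))) /
      ((ev p fun s => cosh (u s ⬝ᵥ ω)) * ev q fun t => cosh (v t ⬝ᵥ ω)) =
    (ev p fun s => ev q fun t => Φ s t * (nch a (u s) ω * nch a (v t) ω)) /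
      ((ev p fun s => nch a (u s) ω) * ev q fun t => nch a (v t) ω) := by
  have e : (ev p fun s => ev q fun t => Φ s t * (nch a (u s) ω * nch a (v t) ω)) =
      (ev p fun s => ev q fun t => Φ s t * (cosh (u s ⬝ᵥ ω) * cosh (v t ⬝ᵥ ω))) /
        (rexp (a / 2) * rexp (a / 2)) := by
    have : ∀ s t, Φ s t * (nch a (u s) ω * nch a (v t) ω) =
        Φ s t * (cosh (u s ⬝ᵥ ω) * cosh (v t ⬝ᵥ ω)) / (rexp (a / 2) * rexp (a / 2)) := fun s t => by
      unfold nch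
      rw [div_mul_div_comm, ← mul_div_assoc]
    simp only [this, ev_div]
  rw [e]
  simp only [nch, ev_div]
  rw [div_mul_div_comm, div_div_div_cancel_right₀ (by positivity)]

lemma le_ev_nch (hp : ∀ s, 0 ≤ p s) (hp1 : ∑ s, p s = 1) (ha : a ≤ 1) (ω : K → ℝ) :
    3 / 5 ≤ ev p fun s => nch a (u s) ω := by
  rw [← ev_const hp1 (3 / 5 : ℝ)]
  exact ev_mono hp fun s => le_nch ha (u s) ω

lemma ExpBdd.div_ev_nch {f : (K → ℝ) → ℝ} (hf : ExpBdd f) (hp : ∀ s, 0 ≤ p s)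
    (hp1 : ∑ s, p s = 1) (hq : ∀ s, 0 ≤ q s) (hq1 : ∑ s, q s = 1) (ha : a ≤ 1) :
    ExpBdd fun ω => f ω / ((_root_.ev p fun s => _root_.nch a (u s) ω) *
      _root_.ev q fun t => _root_.nch a (v t) ω) := by
  simp only [div_eq_mul_inv]
  refine hf.mul (ExpBdd.inv_of_le (c := 9 / 25) (D := 0) ?_ (by norm_num) le_rfl fun ω => ?_)
  · exact ((ExpBdd.ev fun s => ExpBdd.nch a (u s)).mul
      (ExpBdd.ev fun s => ExpBdd.nch a (v s))).1
  · have h1 := le_ev_nch (u := u) hp hp1 ha ω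
    have h2 := le_ev_nch (u := v) hq hq1 ha ω
    simp only [zero_mul, neg_zero, Real.exp_zero, mul_one]
    nlinarith

/-- Positive semidefiniteness of a kernel. -/
def PSDKernel (k : S → S → ℝ) : Prop := ∀ ψ : S → ℝ, 0 ≤ ∑ s, ∑ t, ψ s * ψ t * k s t

lemma PSDKernel.ev_nonneg {k : S → S → ℝ} (h : PSDKernel k) (p ψ : S → ℝ) :
    0 ≤ ev p fun s => ev p fun t => k s t * (ψ s * ψ t) := by
  have := h fun s => p s * ψ s
  simp only [ev, Finset.mul_sum]
  refine this.trans (le_of_eq (Finset.sum_congr rfl fun _ _ => Finset.sum_congr rfl fun _ _ => ?_))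
  ring

lemma inv_sq_le {z : ℝ} (hz : 3 / 5 ≤ z) : 1 / (z * z) ≤ 1 - 2 * (z - 1) + 7 * (z - 1) ^ 2 := by
  have hz0 : 0 < z := by linarith
  rw [div_le_iff₀ (by positivity)]
  nlinarith [mul_nonneg (sq_nonneg (z - 1)) (by nlinarith : (0 : ℝ) ≤ 7 * (z * z) - (2 * z + 1))]

lemma one_sub_le_inv_sq {z : ℝ} (hz : 0 < z) : 1 - 2 * (z - 1) ≤ 1 / (z * z) := by
  rw [le_div_iff₀ (by positivity)]
  nlinarith [mul_nonneg (sq_nonneg (z - 1)) (by linarith : (0 : ℝ) ≤ 2 * z + 1)]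

lemma pow_mul_pow_three_le {m : ℕ} (hm : Even (m + 3)) (ρ κ : ℝ) :
    |ρ ^ m| * |κ| ^ 3 ≤ ρ ^ (m + 3) + κ ^ (m + 3) := by
  rw [abs_pow, ← hm.pow_abs ρ, ← hm.pow_abs κ]
  rcases le_total |ρ| |κ| with h | h
  · have h1 := pow_le_pow_left₀ (abs_nonneg ρ) h m
    have h2 : 0 ≤ |ρ| ^ (m + 3) := by positivity
    have h3 := mul_le_mul_of_nonneg_right h1 (by positivity : 0 ≤ |κ| ^ 3)
    rw [← pow_add] at h3
    linarith
  · have h1 := pow_le_pow_left₀ (abs_nonneg κ) h 3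
    have h2 : 0 ≤ |κ| ^ (m + 3) := by positivity
    have h3 := mul_le_mul_of_nonneg_left h1 (by positivity : 0 ≤ |ρ| ^ m)
    rw [← pow_add] at h3
    linarith

/-- Upper cavity estimate for a single system. -/
lemma cavity_sinh_le [Nonempty S] (h : CavGram u v r x y a) (hp : ∀ s, 0 ≤ p s)
    (hp1 : ∑ s, p s = 1) {m : ℕ} (hm : Even (m + 3)) (hpsd : PSDKernel fun s t => r s t ^ m) :
    ∫ ω, (ev p fun s => ev p fun t => r s t ^ m * (sinh (u s ⬝ᵥ ω) * sinh (u t ⬝ᵥ ω))) /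
      ((ev p fun s => cosh (u s ⬝ᵥ ω)) * ev p fun t => cosh (u t ⬝ᵥ ω)) ∂stdGauss K ≤
    x * (ev p fun s => ev p fun t => r s t ^ (m + 1)) +
      396 * KT * ev p fun s => ev p fun t => r s t ^ (m + 3) := by
  have ha := h.a_le
  have hd : ∀ s, u s ⬝ᵥ u s = a := fun s => by rw [h.uu, h.diag]
  have hC : ∀ s t, |u s ⬝ᵥ u t| ≤ 1 := fun s t => by rw [h.uu]; exact h.abs_mul_le s t
  simp_rw [ev_ratio_sinh (u := u) (v := u) _ _ a]
  set F : S → S → S → S → (K → ℝ) → ℝ := fun s t k l ω =>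
    r s t ^ m * (nsh a (u s) ω * nsh a (u t) ω -
      2 * (nsh a (u s) ω * nsh a (u t) ω * (nch a (u k) ω - 1)) +
      7 * (nsh a (u s) ω * nsh a (u t) ω * (nch a (u k) ω - 1) * (nch a (u l) ω - 1))) with hF
  have bss : ∀ s t, ExpBdd fun ω => nsh a (u s) ω * nsh a (u t) ω := fun s t =>
    (ExpBdd.nsh a (u s)).mul (ExpBdd.nsh a (u t))
  have bd : ∀ k, ExpBdd fun ω => nch a (u k) ω - 1 := fun k =>
    (ExpBdd.nch a (u k)).sub (ExpBdd.const 1)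
  have bssd : ∀ s t k, ExpBdd fun ω => nsh a (u s) ω * nsh a (u t) ω * (nch a (u k) ω - 1) :=
    fun s t k => (bss s t).mul (bd k)
  have bssdd : ∀ s t k l, ExpBdd fun ω =>
      nsh a (u s) ω * nsh a (u t) ω * (nch a (u k) ω - 1) * (nch a (u l) ω - 1) :=
    fun s t k l => (bssd s t k).mul (bd l)
  have bF : ∀ s t k l, ExpBdd (F s t k l) := fun s t k l =>
    (ExpBdd.const _).mul (((bss s t).sub ((ExpBdd.const 2).mul (bssd s t k))).add
      ((ExpBdd.const 7).mul (bssdd s t k l)))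
  have hpt : ∀ ω, (ev p fun s => ev p fun t => r s t ^ m * (nsh a (u s) ω * nsh a (u t) ω)) /
      ((ev p fun s => nch a (u s) ω) * ev p fun t => nch a (u t) ω) ≤
      ev p fun s => ev p fun t => ev p fun k => ev p fun l => F s t k l ω := by
    intro ω
    set A := ev p fun s => ev p fun t => r s t ^ m * (nsh a (u s) ω * nsh a (u t) ω) with hA
    set z := ev p fun s => nch a (u s) ω with hz
    have hA0 : 0 ≤ A := hpsd.ev_nonneg p fun s => nsh a (u s) ω
    have hz1 := inv_sq_le (le_ev_nch (u := u) hp hp1 ha ω)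
    have e1 : (ev p fun s => nch a (u s) ω - 1) = z - 1 := by rw [ev_sub, ev_const hp1]
    have e2 : (ev p fun s => ev p fun t => ev p fun k => ev p fun l => F s t k l ω) =
        A * (1 - 2 * (z - 1) + 7 * (z - 1) ^ 2) := by
      simp only [hF, ev_add, ev_sub (p := p) (fun s => nsh a _ ω * nsh a _ ω), ev_mul_left, ev_mul_right, ev_const hp1, e1]
      rw [hA]
      simp only [← ev_mul_right]
      congr 1; ext s; congr 1; ext t; ring
    rw [e2, div_eq_mul_one_div]
    exact mul_le_mul_of_nonneg_left hz1 hA0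
  have bL : ExpBdd fun ω =>
      (ev p fun s => ev p fun t => r s t ^ m * (nsh a (u s) ω * nsh a (u t) ω)) /
      ((ev p fun s => nch a (u s) ω) * ev p fun t => nch a (u t) ω) :=
    ExpBdd.div_ev_nch (ExpBdd.ev fun s => ExpBdd.ev fun t => (ExpBdd.const _).mul (bss s t))
      hp hp1 hp hp1 ha
  refine (integral_mono bL.integrable (ExpBdd.ev fun s => ExpBdd.ev fun t => ExpBdd.ev fun k =>
    ExpBdd.ev fun l => bF s t k l).integrable hpt).trans ?_
  rw [integral_ev fun s => ExpBdd.ev fun t => ExpBdd.ev fun k => ExpBdd.ev fun l => bF s t k l]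
  simp_rw [integral_ev fun t => ExpBdd.ev fun k => ExpBdd.ev fun l => bF _ t k l,
    integral_ev fun k => ExpBdd.ev fun l => bF _ _ k l, integral_ev fun l => bF _ _ _ l]
  have hbound : ∀ s t k l, ∫ ω, F s t k l ω ∂stdGauss K ≤
      x * r s t ^ (m + 1) - 2 * x ^ 2 * (r s t ^ m * (r s k * r t k)) +
      33 * KT * (7 * r s t ^ (m + 3) + r s k ^ (m + 3) + r s l ^ (m + 3) + r t k ^ (m + 3) +
        r t l ^ (m + 3) + r k l ^ (m + 3)) := by
    intro s t k l
    have e : ∫ ω, F s t k l ω ∂stdGauss K = r s t ^ m *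
        (∫ ω, nsh a (u s) ω * nsh a (u t) ω ∂stdGauss K -
        2 * ∫ ω, nsh a (u s) ω * nsh a (u t) ω * (nch a (u k) ω - 1) ∂stdGauss K +
        7 * ∫ ω, nsh a (u s) ω * nsh a (u t) ω * (nch a (u k) ω - 1) *
          (nch a (u l) ω - 1) ∂stdGauss K) := by
      have i1 := (bss s t).integrable
      have i2 := (bssd s t k).integrable
      have i3 := (bssdd s t k l).integrable
      simp only [hF]
      rw [integral_const_mul, integral_add (by fun_prop) (by fun_prop),
        integral_sub (by fun_prop) (by fun_prop), integral_const_mul, integral_const_mul]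
    have k1 := nsh_two_estimate (hd s) (hd t) (hC s t)
    have k2 := nsh_dev_estimate (hd s) (hd t) (hd k) (hC s t) (hC s k) (hC t k)
    have k3 := nsh_dev_dev_estimate (hd s) (hd t) (hd k) (hd l) (hC s t) (hC s k) (hC s l)
      (hC t k) (hC t l) (hC k l)
    rw [e]
    set I1 := ∫ ω, nsh a (u s) ω * nsh a (u t) ω ∂stdGauss K
    set I2 := ∫ ω, nsh a (u s) ω * nsh a (u t) ω * (nch a (u k) ω - 1) ∂stdGauss K
    set I3 := ∫ ω, nsh a (u s) ω * nsh a (u t) ω * (nch a (u k) ω - 1) *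
          (nch a (u l) ω - 1) ∂stdGauss K
    simp only [h.uu, abs_mul, mul_pow, abs_of_nonneg h.x_nonneg] at k1 k2 k3
    have hK := KT_pos
    have hx3 : x ^ 3 ≤ 1 := pow_le_one₀ h.x_nonneg h.x_le
    have hcube : ∀ i j, x ^ 3 * |r i j| ^ 3 ≤ |r i j| ^ 3 := fun i j =>
      mul_le_of_le_one_left (by positivity) hx3
    set Q := |r s t| ^ 3 + |r s k| ^ 3 + |r s l| ^ 3 + |r t k| ^ 3 + |r t l| ^ 3 + |r k l| ^ 3
      with hQ
    have hdiff : |I1 - 2 * I2 + 7 * I3 - (x * r s t - 2 * x ^ 2 * (r s k * r t k))| ≤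
        33 * KT * Q := by
      have n1 := mul_le_mul_of_nonneg_left (hcube s t) hK.le
      have n2 := mul_le_mul_of_nonneg_left (hcube s k) hK.le
      have n3 := mul_le_mul_of_nonneg_left (hcube s l) hK.le
      have n4 := mul_le_mul_of_nonneg_left (hcube t k) hK.le
      have n5 := mul_le_mul_of_nonneg_left (hcube t l) hK.le
      have n6 := mul_le_mul_of_nonneg_left (hcube k l) hK.le
      have p2 : 0 ≤ KT * |r s k| ^ 3 := by positivity
      have p3 : 0 ≤ KT * |r s l| ^ 3 := by positivity
      have p4 : 0 ≤ KT * |r t k| ^ 3 := by positivity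
      have p5 : 0 ≤ KT * |r t l| ^ 3 := by positivity
      have p6 : 0 ≤ KT * |r k l| ^ 3 := by positivity
      rw [hQ]
      rw [abs_le] at k1 k2 k3 ⊢
      constructor <;> nlinarith
    have hm1 : r s t ^ m * (I1 - 2 * I2 + 7 * I3) - r s t ^ m *
        (x * r s t - 2 * x ^ 2 * (r s k * r t k)) ≤ |r s t ^ m| * (33 * KT * Q) := by
      rw [← mul_sub]
      refine (le_abs_self _).trans ?_
      rw [abs_mul]
      exact mul_le_mul_of_nonneg_left hdiff (abs_nonneg _)
    have hprod : |r s t ^ m| * Q ≤ 7 * r s t ^ (m + 3) + r s k ^ (m + 3) + r s l ^ (m + 3) +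
        r t k ^ (m + 3) + r t l ^ (m + 3) + r k l ^ (m + 3) := by
      have q1 : |r s t ^ m| * |r s t| ^ 3 = r s t ^ (m + 3) := by
        rw [abs_pow, ← pow_add, hm.pow_abs]
      have q2 := pow_mul_pow_three_le hm (r s t) (r s k)
      have q3 := pow_mul_pow_three_le hm (r s t) (r s l)
      have q4 := pow_mul_pow_three_le hm (r s t) (r t k)
      have q5 := pow_mul_pow_three_le hm (r s t) (r t l)
      have q6 := pow_mul_pow_three_le hm (r s t) (r k l)
      have q0 : 0 ≤ r s t ^ (m + 3) := hm.pow_nonneg _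
      rw [hQ]
      linarith
    have hfin := mul_le_mul_of_nonneg_left hprod (by positivity : 0 ≤ 33 * KT)
    have ex : r s t ^ m * (x * r s t - 2 * x ^ 2 * (r s k * r t k)) =
        x * r s t ^ (m + 1) - 2 * x ^ 2 * (r s t ^ m * (r s k * r t k)) := by ring
    rw [ex] at hm1
    linarith
  refine (ev_mono hp fun s => ev_mono hp fun t => ev_mono hp fun k => ev_mono hp fun l =>
    hbound s t k l).trans ?_
  have htri : 0 ≤ ev p fun s => ev p fun t => ev p fun k => r s t ^ m * (r s k * r t k) := by
    have : (ev p fun s => ev p fun t => ev p fun k => r s t ^ m * (r s k * r t k)) =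
        ev p fun k => ev p fun s => ev p fun t => r s t ^ m * (r s k * r t k) := by
      calc _ = ev p fun s => ev p fun k => ev p fun t => r s t ^ m * (r s k * r t k) := by
            congr 1; ext s
            exact ev_comm fun t k => r s t ^ m * (r s k * r t k)
        _ = _ := ev_comm fun s k => ev p fun t => r s t ^ m * (r s k * r t k)
    rw [this]
    exact ev_nonneg hp fun k => hpsd.ev_nonneg p fun s => r s k
  have hx2 : 0 ≤ 2 * x ^ 2 * ev p fun s => ev p fun t => ev p fun k =>
    r s t ^ m * (r s k * r t k) := by positivity
  simp only [ev_add, ev_sub, ev_mul_left, ev_const hp1]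
  simp only [ev_mul_left] at hx2
  linarith

end Cavity

section CavityTwo

variable {S K : Type*} [Fintype S] [Fintype K] {u v : S → K → ℝ} {r : S → S → ℝ} {x y a : ℝ}
  {p q : S → ℝ}

lemma pow_mul_sq_le {m : ℕ} (hm : Even (m + 3)) (ρ κ : ℝ) :
    ρ ^ (m + 1) * κ ^ 2 ≤ ρ ^ (m + 3) + κ ^ (m + 3) := by
  have hm' : Even (m + 1) := by
    obtain ⟨k, hk⟩ := hm
    exact ⟨k - 1, by omega⟩
  rw [← hm.pow_abs ρ, ← hm.pow_abs κ, ← hm'.pow_abs ρ, ← sq_abs κ]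
  rcases le_total |ρ| |κ| with h | h
  · have h1 := pow_le_pow_left₀ (abs_nonneg ρ) h (m + 1)
    have h2 : 0 ≤ |ρ| ^ (m + 3) := by positivity
    have h3 := mul_le_mul_of_nonneg_right h1 (by positivity : 0 ≤ |κ| ^ 2)
    rw [← pow_add] at h3
    linarith
  · have h1 := pow_le_pow_left₀ (abs_nonneg κ) h 2
    have h2 : 0 ≤ |κ| ^ (m + 3) := by positivity
    have h3 := mul_le_mul_of_nonneg_left h1 (by positivity : 0 ≤ |ρ| ^ (m + 1))
    rw [← pow_add] at h3
    linarith

lemma CavGram.sq_mul_le (h : CavGram u v r x y a) (s t : S) : (x * r s t) ^ 2 ≤ r s t ^ 2 := by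
  rw [mul_pow]
  exact mul_le_of_le_one_left (sq_nonneg _) (pow_le_one₀ h.x_nonneg h.x_le)

lemma CavGram.sq_mul_le' (h : CavGram u v r x y a) (s t : S) : (y * r s t) ^ 2 ≤ r s t ^ 2 := by
  rw [mul_pow]
  exact mul_le_of_le_one_left (sq_nonneg _) (pow_le_one₀ h.y_nonneg h.y_le)

/-- Averages of even powers of the overlap hardly decrease when a site is added. -/
lemma cavity_cosh_ge [Nonempty S] (h : CavGram u v r x y a) (hp : ∀ s, 0 ≤ p s)
    (hp1 : ∑ s, p s = 1) {m : ℕ} (hm : Even (m + 3)) :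
    (ev p fun s => ev p fun t => r s t ^ (m + 1)) -
      20 * (KT + 1) * (ev p fun s => ev p fun t => r s t ^ (m + 3)) ≤
    ∫ ω, (ev p fun s => ev p fun t => r s t ^ (m + 1) * (cosh (u s ⬝ᵥ ω) * cosh (u t ⬝ᵥ ω))) /
      ((ev p fun s => cosh (u s ⬝ᵥ ω)) * ev p fun t => cosh (u t ⬝ᵥ ω)) ∂stdGauss K := by
  have hm' : Even (m + 1) := by
    obtain ⟨k, hk⟩ := hm
    exact ⟨k - 1, by omega⟩
  have ha := h.a_le
  have hd : ∀ s, u s ⬝ᵥ u s = a := fun s => by rw [h.uu, h.diag]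
  have hC : ∀ s t, |u s ⬝ᵥ u t| ≤ 1 := fun s t => by rw [h.uu]; exact h.abs_mul_le s t
  simp_rw [ev_ratio_cosh (u := u) (v := u) _ _ a]
  set F : S → S → S → (K → ℝ) → ℝ := fun s t k ω =>
    r s t ^ (m + 1) * (nch a (u s) ω * nch a (u t) ω -
      2 * (nch a (u s) ω * nch a (u t) ω * (nch a (u k) ω - 1))) with hF
  have bss : ∀ s t, ExpBdd fun ω => nch a (u s) ω * nch a (u t) ω := fun s t =>
    (ExpBdd.nch a (u s)).mul (ExpBdd.nch a (u t))
  have bssd : ∀ s t k, ExpBdd fun ω => nch a (u s) ω * nch a (u t) ω * (nch a (u k) ω - 1) :=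
    fun s t k => (bss s t).mul ((ExpBdd.nch a (u k)).sub (ExpBdd.const 1))
  have bF : ∀ s t k, ExpBdd (F s t k) := fun s t k =>
    (ExpBdd.const _).mul ((bss s t).sub ((ExpBdd.const 2).mul (bssd s t k)))
  have hpt : ∀ ω, (ev p fun s => ev p fun t => ev p fun k => F s t k ω) ≤
      (ev p fun s => ev p fun t => r s t ^ (m + 1) * (nch a (u s) ω * nch a (u t) ω)) /
      ((ev p fun s => nch a (u s) ω) * ev p fun t => nch a (u t) ω) := by
    intro ω
    set A := ev p fun s => ev p fun t => r s t ^ (m + 1) * (nch a (u s) ω * nch a (u t) ω) with hA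
    set z := ev p fun s => nch a (u s) ω with hz
    have hA0 : 0 ≤ A := ev_nonneg hp fun s => ev_nonneg hp fun t =>
      mul_nonneg (hm'.pow_nonneg _) (mul_nonneg (nch_pos _ _ _).le (nch_pos _ _ _).le)
    have hz0 := le_ev_nch (u := u) hp hp1 ha ω
    have hz1 : 1 - 2 * (z - 1) ≤ 1 / (z * z) := one_sub_le_inv_sq (by linarith)
    have e1 : (ev p fun s => nch a (u s) ω - 1) = z - 1 := by rw [ev_sub, ev_const hp1]
    have e2 : (ev p fun s => ev p fun t => ev p fun k => F s t k ω) =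
        A * (1 - 2 * (z - 1)) := by
      simp only [hF, ev_sub (p := p) (fun s => nch a _ ω * nch a _ ω), ev_mul_left,
        ev_const hp1, e1]
      rw [hA]
      simp only [← ev_mul_right]
      congr 1; ext s; congr 1; ext t; ring
    rw [e2, div_eq_mul_one_div A]
    exact mul_le_mul_of_nonneg_left hz1 hA0
  have bL : ExpBdd fun ω =>
      (ev p fun s => ev p fun t => r s t ^ (m + 1) * (nch a (u s) ω * nch a (u t) ω)) /
      ((ev p fun s => nch a (u s) ω) * ev p fun t => nch a (u t) ω) :=
    ExpBdd.div_ev_nch (ExpBdd.ev fun s => ExpBdd.ev fun t => (ExpBdd.const _).mul (bss s t))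
      hp hp1 hp hp1 ha
  refine le_trans ?_ (integral_mono (ExpBdd.ev fun s => ExpBdd.ev fun t => ExpBdd.ev fun k =>
    bF s t k).integrable bL.integrable hpt)
  rw [integral_ev fun s => ExpBdd.ev fun t => ExpBdd.ev fun k => bF s t k]
  simp_rw [integral_ev fun t => ExpBdd.ev fun k => bF _ t k, integral_ev fun k => bF _ _ k]
  have hbound : ∀ s t k, r s t ^ (m + 1) - 4 * (KT + 1) * (3 * r s t ^ (m + 3) +
      r s k ^ (m + 3) + r t k ^ (m + 3)) ≤ ∫ ω, F s t k ω ∂stdGauss K := by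
    intro s t k
    have e : ∫ ω, F s t k ω ∂stdGauss K = r s t ^ (m + 1) *
        (∫ ω, nch a (u s) ω * nch a (u t) ω ∂stdGauss K -
        2 * ∫ ω, nch a (u s) ω * nch a (u t) ω * (nch a (u k) ω - 1) ∂stdGauss K) := by
      have i1 := (bss s t).integrable
      have i2 := (bssd s t k).integrable
      simp only [hF]
      rw [integral_const_mul, integral_sub (by fun_prop) (by fun_prop), integral_const_mul]
    have k1 := nch_two_ge_one (hd s) (hd t)
    have k2 := (abs_le.1 (nch_dev_estimate (hd s) (hd t) (hd k) (hC s t) (hC s k) (hC t k))).2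
    rw [e]
    set I1 := ∫ ω, nch a (u s) ω * nch a (u t) ω ∂stdGauss K
    set I2 := ∫ ω, nch a (u s) ω * nch a (u t) ω * (nch a (u k) ω - 1) ∂stdGauss K
    simp only [h.uu] at k2
    have hK := KT_pos
    have n1 := h.sq_mul_le s t
    have n2 := h.sq_mul_le s k
    have n3 := h.sq_mul_le t k
    have hlow : 1 - 4 * (KT + 1) * (r s t ^ 2 + r s k ^ 2 + r t k ^ 2) ≤ I1 - 2 * I2 := by
      nlinarith
    have h1 := mul_le_mul_of_nonneg_left hlow (hm'.pow_nonneg (r s t))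
    refine le_trans ?_ h1
    have q2 := pow_mul_sq_le hm (r s t) (r s k)
    have q3 := pow_mul_sq_le hm (r s t) (r t k)
    have q1 : r s t ^ (m + 1) * r s t ^ 2 = r s t ^ (m + 3) := by rw [← pow_add]
    have q : r s t ^ (m + 1) * (r s t ^ 2 + r s k ^ 2 + r t k ^ 2) ≤
        3 * r s t ^ (m + 3) + r s k ^ (m + 3) + r t k ^ (m + 3) := by
      rw [mul_add, mul_add, q1]; linarith
    have := mul_le_mul_of_nonneg_left q (by positivity : 0 ≤ 4 * (KT + 1))
    linarith
  refine le_trans ?_ (ev_mono hp fun s => ev_mono hp fun t => ev_mono hp fun k => hbound s t k)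
  simp only [ev_add, ev_sub, ev_mul_left, ev_const hp1]
  linarith

/-- Averages of nonnegative functions decrease at most by a constant factor when a site is
added. -/
lemma cavity_cosh_ge_div [Nonempty S] (h : CavGram u v r x y a) (hp : ∀ s, 0 ≤ p s)
    (hp1 : ∑ s, p s = 1) (hq : ∀ s, 0 ≤ q s) (hq1 : ∑ s, q s = 1) {Φ : S → S → ℝ}
    (hΦ : ∀ s t, 0 ≤ Φ s t) :
    (ev p fun s => ev q fun t => Φ s t) ≤ rexp 6 *
    ∫ ω, (ev p fun s => ev q fun t => Φ s t * (cosh (u s ⬝ᵥ ω) * cosh (v t ⬝ᵥ ω))) /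
      ((ev p fun s => cosh (u s ⬝ᵥ ω)) * ev q fun t => cosh (v t ⬝ᵥ ω)) ∂stdGauss K := by
  have ha := h.a_le
  have hd : ∀ s, u s ⬝ᵥ u s = a := fun s => by rw [h.uu, h.diag]
  have hd' : ∀ s, v s ⬝ᵥ v s = a := fun s => by rw [h.vv, h.diag]
  have hC : ∀ s t, |u s ⬝ᵥ u t| ≤ 1 := fun s t => by rw [h.uu]; exact h.abs_mul_le s t
  have hC' : ∀ s t, |v s ⬝ᵥ v t| ≤ 1 := fun s t => by rw [h.vv]; exact h.abs_mul_le s t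
  have hC'' : ∀ s t, |u s ⬝ᵥ v t| ≤ 1 := fun s t => by rw [h.uv]; exact h.abs_mul_le' s t
  have hC3 : ∀ s t, |v s ⬝ᵥ u t| ≤ 1 := fun s t => by rw [dotProduct_comm]; exact hC'' t s
  simp_rw [ev_ratio_cosh (u := u) (v := v) _ _ a]
  set M := rexp 6 with hM
  have hM0 : 0 < M := Real.exp_pos _
  set F : S → S → S → S → (K → ℝ) → ℝ := fun s t k l ω =>
    Φ s t * (2 / M * (nch a (u s) ω * nch a (v t) ω) -
      1 / M ^ 2 * (nch a (u s) ω * nch a (v t) ω * nch a (u k) ω * nch a (v l) ω)) with hF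
  have b2 : ∀ s t, ExpBdd fun ω => nch a (u s) ω * nch a (v t) ω := fun s t =>
    (ExpBdd.nch a (u s)).mul (ExpBdd.nch a (v t))
  have b4 : ∀ s t k l, ExpBdd fun ω =>
      nch a (u s) ω * nch a (v t) ω * nch a (u k) ω * nch a (v l) ω := fun s t k l =>
    ((b2 s t).mul (ExpBdd.nch a (u k))).mul (ExpBdd.nch a (v l))
  have bF : ∀ s t k l, ExpBdd (F s t k l) := fun s t k l =>
    (ExpBdd.const _).mul (((ExpBdd.const _).mul (b2 s t)).sub ((ExpBdd.const _).mul (b4 s t k l)))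
  have hpt : ∀ ω, (ev p fun s => ev q fun t => ev p fun k => ev q fun l => F s t k l ω) ≤
      (ev p fun s => ev q fun t => Φ s t * (nch a (u s) ω * nch a (v t) ω)) /
      ((ev p fun s => nch a (u s) ω) * ev q fun t => nch a (v t) ω) := by
    intro ω
    set A := ev p fun s => ev q fun t => Φ s t * (nch a (u s) ω * nch a (v t) ω) with hA
    set z := ev p fun s => nch a (u s) ω with hz
    set z' := ev q fun s => nch a (v s) ω with hz'
    have hA0 : 0 ≤ A := ev_nonneg hp fun s => ev_nonneg hq fun t =>
      mul_nonneg (hΦ _ _) (mul_nonneg (nch_pos _ _ _).le (nch_pos _ _ _).le)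
    have hz0 : 3 / 5 ≤ z := le_ev_nch (u := u) hp hp1 ha ω
    have hz0' : 3 / 5 ≤ z' := le_ev_nch (u := v) hq hq1 ha ω
    have hD : 0 < z * z' := mul_pos (by linarith) (by linarith)
    have hz1 : 2 / M - 1 / M ^ 2 * (z * z') ≤ 1 / (z * z') := by
      rw [le_div_iff₀ hD]
      have : 0 ≤ (1 / M * (z * z') - 1) ^ 2 := sq_nonneg _
      have e : (2 / M - 1 / M ^ 2 * (z * z')) * (z * z') = 1 - (1 / M * (z * z') - 1) ^ 2 := by
        field_simp; ring
      linarith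
    have e2 : (ev p fun s => ev q fun t => ev p fun k => ev q fun l => F s t k l ω) =
        A * (2 / M - 1 / M ^ 2 * (z * z')) := by
      simp only [hF, ev_sub, ev_mul_left, ev_mul_right, ev_const hp1, ev_const hq1]
      rw [hA]
      simp only [← ev_mul_right, ← hz, ← hz']
      congr 1; ext s; congr 1; ext t; ring
    rw [e2, div_eq_mul_one_div A]
    exact mul_le_mul_of_nonneg_left hz1 hA0
  have bL : ExpBdd fun ω =>
      (ev p fun s => ev q fun t => Φ s t * (nch a (u s) ω * nch a (v t) ω)) /
      ((ev p fun s => nch a (u s) ω) * ev q fun t => nch a (v t) ω) :=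
    ExpBdd.div_ev_nch (ExpBdd.ev fun s => ExpBdd.ev fun t => (ExpBdd.const _).mul (b2 s t))
      hp hp1 hq hq1 ha
  have hmain := integral_mono (ExpBdd.ev fun s => ExpBdd.ev fun t => ExpBdd.ev fun k =>
    ExpBdd.ev fun l => bF s t k l).integrable bL.integrable hpt
  rw [integral_ev fun s => ExpBdd.ev fun t => ExpBdd.ev fun k => ExpBdd.ev fun l => bF s t k l]
    at hmain
  simp_rw [integral_ev fun t => ExpBdd.ev fun k => ExpBdd.ev fun l => bF _ t k l,
    integral_ev fun k => ExpBdd.ev fun l => bF _ _ k l, integral_ev fun l => bF _ _ _ l] at hmain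
  have hbound : ∀ s t k l, Φ s t * (1 / M) ≤ ∫ ω, F s t k l ω ∂stdGauss K := by
    intro s t k l
    have i1 := (b2 s t).integrable
    have i2 := (b4 s t k l).integrable
    simp only [hF]
    rw [integral_const_mul, integral_sub (by fun_prop) (by fun_prop), integral_const_mul,
      integral_const_mul]
    have k1 := nch_two_ge_one (hd s) (hd' t)
    have k2 := nch_four_le (hd s) (hd' t) (hd k) (hd' l) (hC'' s t) (hC s k) (hC'' s l)
      (hC3 t k) (hC' t l) (hC'' k l)
    refine mul_le_mul_of_nonneg_left ?_ (hΦ s t)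
    have j1 := mul_le_mul_of_nonneg_left k1 (by positivity : 0 ≤ 2 / M)
    have j2 := mul_le_mul_of_nonneg_left k2 (by positivity : 0 ≤ 1 / M ^ 2)
    have j3 : 1 / M ^ 2 * M = 1 / M := by field_simp
    have j4 : 2 / M = 1 / M + 1 / M := by ring
    rw [← hM, j3] at j2
    linarith
  have := (ev_mono hp fun s => ev_mono hq fun t => ev_mono hp fun k => ev_mono hq fun l =>
    hbound s t k l).trans hmain
  simp only [ev_mul_right, ev_const hp1, ev_const hq1] at this
  rw [mul_one_div, div_le_iff₀ hM0] at this
  linarith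

end CavityTwo

section CavityPair

variable {S K : Type*} [Fintype S] [Fintype K] {u v : S → K → ℝ} {r : S → S → ℝ} {x y a : ℝ}
  {p q : S → ℝ}

lemma abs_ev_le (hp : ∀ s, 0 ≤ p s) (f : S → ℝ) : |ev p f| ≤ ev p fun s => |f s| := by
  refine (Finset.abs_sum_le_sum_abs _ _).trans (le_of_eq (Finset.sum_congr rfl fun s _ => ?_))
  rw [abs_mul, abs_of_nonneg (hp s)]

lemma abs_inv_mul_sub_le {z z' : ℝ} (hz : 3 / 5 ≤ z) (hz' : 3 / 5 ≤ z') :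
    |1 / (z * z') - (1 - (z - 1) - (z' - 1))| ≤ 4 * ((z - 1) ^ 2 + (z' - 1) ^ 2) := by
  have hz0 : 0 < z := by linarith
  have hz0' : 0 < z' := by linarith
  set b := 1 / z with hb
  set b' := 1 / z' with hb'
  have e : 1 / (z * z') - (1 - (z - 1) - (z' - 1)) =
      (z' - 1) ^ 2 * b' + (z - 1) * (z' - 1) * b' + (z - 1) ^ 2 * (b * b') := by
    rw [hb, hb']; field_simp; ring
  have hb0 : 0 ≤ b := by positivity
  have hb0' : 0 ≤ b' := by positivity
  have hb1 : b ≤ 5 / 3 := by rw [hb, div_le_iff₀ hz0]; linarith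
  have hb1' : b' ≤ 5 / 3 := by rw [hb', div_le_iff₀ hz0']; linarith
  have hbb : b * b' ≤ 25 / 9 := by nlinarith
  have hbb0 : 0 ≤ b * b' := by positivity
  rw [e]
  set d := z - 1
  set d' := z' - 1
  have t1 : |d' ^ 2 * b'| ≤ 5 / 3 * d' ^ 2 := by
    rw [abs_of_nonneg (by positivity)]; nlinarith [sq_nonneg d']
  have t3 : |d ^ 2 * (b * b')| ≤ 25 / 9 * d ^ 2 := by
    rw [abs_of_nonneg (by positivity)]; nlinarith [sq_nonneg d]
  have t2 : |d * d' * b'| ≤ 5 / 6 * (d ^ 2 + d' ^ 2) := by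
    rw [abs_mul, abs_of_nonneg hb0']
    have : |d * d'| ≤ (d ^ 2 + d' ^ 2) / 2 := by
      rw [abs_le]; constructor <;> nlinarith [sq_nonneg (d - d'), sq_nonneg (d + d')]
    nlinarith [abs_nonneg (d * d')]
  refine (abs_add_three _ _ _).trans ?_
  nlinarith [sq_nonneg d, sq_nonneg d']

lemma abs_mul_sq_le {ϱ : ℝ} (hϱ : 0 < ϱ) (φ w : ℝ) :
    |φ| * w ^ 2 ≤ (ϱ * φ ^ 2 + ϱ⁻¹ * w ^ 4) / 2 := by
  have h : 0 ≤ ϱ⁻¹ * (ϱ * |φ| - w ^ 2) ^ 2 := by positivity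
  have e : ϱ⁻¹ * (ϱ * |φ| - w ^ 2) ^ 2 = ϱ * φ ^ 2 + ϱ⁻¹ * w ^ 4 - 2 * (|φ| * w ^ 2) := by
    rw [← sq_abs φ]; field_simp; ring
  linarith

/-- The fourth moment of the deviation of a normalised cavity partition function. -/
lemma integral_ev_dev_four_le {w : S → K → ℝ} (hp : ∀ s, 0 ≤ p s)
    (hp1 : ∑ s, p s = 1) (hd : ∀ s, w s ⬝ᵥ w s = a) (hC : ∀ s t, |w s ⬝ᵥ w t| ≤ 1)
    (hr : ∀ s t, |w s ⬝ᵥ w t| ≤ |r s t|) :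
    ∫ ω, ((ev p fun s => nch a (w s) ω) - 1) ^ 4 ∂stdGauss K ≤
      24 * KT * ev p fun s => ev p fun t => r s t ^ 4 := by
  have e : ∀ ω, ((ev p fun s => nch a (w s) ω) - 1) ^ 4 =
      ev p fun s => ev p fun t => ev p fun k => ev p fun l => (nch a (w s) ω - 1) *
        (nch a (w t) ω - 1) * (nch a (w k) ω - 1) * (nch a (w l) ω - 1) := by
    intro ω
    have e1 : (ev p fun s => nch a (w s) ω - 1) = (ev p fun s => nch a (w s) ω) - 1 := by
      rw [ev_sub, ev_const hp1]
    simp only [ev_mul_left, ev_mul_right, e1]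
    ring
  have bd : ∀ s, ExpBdd fun ω => nch a (w s) ω - 1 := fun s =>
    (ExpBdd.nch a (w s)).sub (ExpBdd.const 1)
  have b4 : ∀ s t k l, ExpBdd fun ω => (nch a (w s) ω - 1) *
        (nch a (w t) ω - 1) * (nch a (w k) ω - 1) * (nch a (w l) ω - 1) := fun s t k l =>
    (((bd s).mul (bd t)).mul (bd k)).mul (bd l)
  simp_rw [e]
  rw [integral_ev fun s => ExpBdd.ev fun t => ExpBdd.ev fun k => ExpBdd.ev fun l => b4 s t k l]
  simp_rw [integral_ev fun t => ExpBdd.ev fun k => ExpBdd.ev fun l => b4 _ t k l,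
    integral_ev fun k => ExpBdd.ev fun l => b4 _ _ k l, integral_ev fun l => b4 _ _ _ l]
  have hr4 : ∀ s t, (w s ⬝ᵥ w t) ^ 4 ≤ r s t ^ 4 := fun s t => by
    have he : Even 4 := by decide
    rw [← he.pow_abs (w s ⬝ᵥ w t), ← he.pow_abs (r s t)]
    exact pow_le_pow_left₀ (abs_nonneg _) (hr s t) 4
  have hK := KT_pos
  have hbound : ∀ s t k l, ∫ ω, (nch a (w s) ω - 1) * (nch a (w t) ω - 1) *
      (nch a (w k) ω - 1) * (nch a (w l) ω - 1) ∂stdGauss K ≤ 4 * KT * (r s t ^ 4 + r s k ^ 4 +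
        r s l ^ 4 + r t k ^ 4 + r t l ^ 4 + r k l ^ 4) := fun s t k l =>
    (nch_dev_four_le (hd s) (hd t) (hd k) (hd l) (hC s t) (hC s k) (hC s l) (hC t k) (hC t l)
      (hC k l)).trans (mul_le_mul_of_nonneg_left (by
        linarith [hr4 s t, hr4 s k, hr4 s l, hr4 t k, hr4 t l, hr4 k l]) (by positivity))
  refine (ev_mono hp fun s => ev_mono hp fun t => ev_mono hp fun k => ev_mono hp fun l =>
    hbound s t k l).trans (le_of_eq ?_)
  simp only [ev_add, ev_mul_left, ev_const hp1]
  ring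

/-- The constant in the two-system cavity estimate. -/
def KP : ℝ := 4 * rexp 6 + 56 * KT + 8

/-- Two-system cavity estimate, for generic insertions dominated by the hyperbolic cosine. -/
lemma cavity_pair_estimate [Nonempty S] (h : CavGram u v r x y a) (hp : ∀ s, 0 ≤ p s)
    (hp1 : ∑ s, p s = 1) (hq : ∀ s, 0 ≤ q s) (hq1 : ∑ s, q s = 1) (Φ : S → S → ℝ)
    {ϱ : ℝ} (hϱ : 0 < ϱ) {n n' : S → (K → ℝ) → ℝ} (bn : ∀ s, ExpBdd (n s))
    (bn' : ∀ s, ExpBdd (n' s)) (hn : ∀ s ω, |n s ω| ≤ nch a (u s) ω)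
    (hn' : ∀ s ω, |n' s ω| ≤ nch a (v s) ω) {G : S → S → ℝ}
    (hG : ∀ s t, |∫ ω, n s ω * n' t ω ∂stdGauss K - G s t| ≤ 2 * (KT + 1) * r s t ^ 2)
    (hGu : ∀ s t k, |∫ ω, n s ω * n' t ω * (nch a (u k) ω - 1) ∂stdGauss K| ≤
      2 * (KT + 1) * (r s t ^ 2 + r s k ^ 2 + r t k ^ 2))
    (hGv : ∀ s t k, |∫ ω, n s ω * n' t ω * (nch a (v k) ω - 1) ∂stdGauss K| ≤
      2 * (KT + 1) * (r s t ^ 2 + r s k ^ 2 + r t k ^ 2)) :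
    |∫ ω, (ev p fun s => ev q fun t => Φ s t * (n s ω * n' t ω)) /
      ((ev p fun s => nch a (u s) ω) * ev q fun t => nch a (v t) ω) ∂stdGauss K -
      ev p fun s => ev q fun t => Φ s t * G s t| ≤
    KP * (ϱ * (ev p fun s => ev q fun t => Φ s t ^ 2) +
      ϱ⁻¹ * ((ev p fun s => ev p fun t => r s t ^ 4) + (ev p fun s => ev q fun t => r s t ^ 4) +
        ev q fun s => ev q fun t => r s t ^ 4)) := by
  have ha := h.a_le
  have hK := KT_pos
  have hd : ∀ s, u s ⬝ᵥ u s = a := fun s => by rw [h.uu, h.diag]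
  have hd' : ∀ s, v s ⬝ᵥ v s = a := fun s => by rw [h.vv, h.diag]
  have hC : ∀ s t, |u s ⬝ᵥ u t| ≤ 1 := fun s t => by rw [h.uu]; exact h.abs_mul_le s t
  have hC' : ∀ s t, |v s ⬝ᵥ v t| ≤ 1 := fun s t => by rw [h.vv]; exact h.abs_mul_le s t
  have hC'' : ∀ s t, |u s ⬝ᵥ v t| ≤ 1 := fun s t => by rw [h.uv]; exact h.abs_mul_le' s t
  have hxr : ∀ s t, |x * r s t| ≤ |r s t| := fun s t => by
    rw [abs_mul, abs_of_nonneg h.x_nonneg]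
    exact mul_le_of_le_one_left (abs_nonneg _) h.x_le
  set A : (K → ℝ) → ℝ := fun ω => ev p fun s => ev q fun t => Φ s t * (n s ω * n' t ω) with hA
  set z : (K → ℝ) → ℝ := fun ω => ev p fun s => nch a (u s) ω with hz
  set z' : (K → ℝ) → ℝ := fun ω => ev q fun s => nch a (v s) ω with hz'
  set F : S → S → S → S → (K → ℝ) → ℝ := fun s t k l ω =>
    Φ s t * (n s ω * n' t ω - n s ω * n' t ω * (nch a (u k) ω - 1) -
      n s ω * n' t ω * (nch a (v l) ω - 1)) with hF
  have b2 : ∀ s t, ExpBdd fun ω => n s ω * n' t ω := fun s t => (bn s).mul (bn' t)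
  have bu : ∀ s t k, ExpBdd fun ω => n s ω * n' t ω * (nch a (u k) ω - 1) := fun s t k =>
    (b2 s t).mul ((ExpBdd.nch a (u k)).sub (ExpBdd.const 1))
  have bv : ∀ s t k, ExpBdd fun ω => n s ω * n' t ω * (nch a (v k) ω - 1) := fun s t k =>
    (b2 s t).mul ((ExpBdd.nch a (v k)).sub (ExpBdd.const 1))
  have bF : ∀ s t k l, ExpBdd (F s t k l) := fun s t k l =>
    (ExpBdd.const _).mul (((b2 s t).sub (bu s t k)).sub (bv s t l))
  have bcc : ∀ s t, ExpBdd fun ω =>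
      nch a (u s) ω * nch a (v t) ω * nch a (u s) ω * nch a (v t) ω := fun s t =>
    (((ExpBdd.nch a (u s)).mul (ExpBdd.nch a (v t))).mul (ExpBdd.nch a (u s))).mul
      (ExpBdd.nch a (v t))
  have bz : ExpBdd z := ExpBdd.ev fun s => ExpBdd.nch a (u s)
  have bz' : ExpBdd z' := ExpBdd.ev fun s => ExpBdd.nch a (v s)
  have bz4 : ExpBdd fun ω => (z ω - 1) ^ 4 := (bz.sub (ExpBdd.const 1)).pow 4
  have bz4' : ExpBdd fun ω => (z' ω - 1) ^ 4 := (bz'.sub (ExpBdd.const 1)).pow 4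
  have bA : ExpBdd A := ExpBdd.ev fun s => ExpBdd.ev fun t => (ExpBdd.const _).mul (b2 s t)
  have bL : ExpBdd fun ω => A ω / (z ω * z' ω) := ExpBdd.div_ev_nch bA hp hp1 hq hq1 ha
  have bFF : ExpBdd fun ω => ev p fun s => ev q fun t => ev p fun k => ev q fun l => F s t k l ω :=
    ExpBdd.ev fun s => ExpBdd.ev fun t => ExpBdd.ev fun k => ExpBdd.ev fun l => bF s t k l
  set E : (K → ℝ) → ℝ := fun ω => 4 * ϱ * (ev p fun s => ev q fun t => Φ s t ^ 2 *
      (nch a (u s) ω * nch a (v t) ω * nch a (u s) ω * nch a (v t) ω)) +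
      2 * ϱ⁻¹ * ((z ω - 1) ^ 4 + (z' ω - 1) ^ 4) with hE
  have bΦcc : ExpBdd fun ω => ev p fun s => ev q fun t => Φ s t ^ 2 *
      (nch a (u s) ω * nch a (v t) ω * nch a (u s) ω * nch a (v t) ω) :=
    ExpBdd.ev fun s => ExpBdd.ev fun t => (ExpBdd.const _).mul (bcc s t)
  have bE : ExpBdd E :=
    ((ExpBdd.const _).mul bΦcc).add ((ExpBdd.const _).mul (bz4.add bz4'))
  have hpt : ∀ ω, |A ω / (z ω * z' ω) -
      ev p fun s => ev q fun t => ev p fun k => ev q fun l => F s t k l ω| ≤ E ω := by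
    intro ω
    have hz0 : 3 / 5 ≤ z ω := le_ev_nch (u := u) hp hp1 ha ω
    have hz0' : 3 / 5 ≤ z' ω := le_ev_nch (u := v) hq hq1 ha ω
    have e1 : (ev p fun s => nch a (u s) ω - 1) = z ω - 1 := by rw [ev_sub, ev_const hp1]
    have e1' : (ev q fun s => nch a (v s) ω - 1) = z' ω - 1 := by rw [ev_sub, ev_const hq1]
    have e2 : (ev p fun s => ev q fun t => ev p fun k => ev q fun l => F s t k l ω) =
        A ω * (1 - (z ω - 1) - (z' ω - 1)) := by
      have : ∀ s t, (ev p fun k => ev q fun l => F s t k l ω) =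
          Φ s t * (n s ω * n' t ω) * (1 - (z ω - 1) - (z' ω - 1)) := by
        intro s t
        simp only [hF, ev_mul_left]
        simp only [ev_sub (p := q) (fun l => n s ω * n' t ω - _), ev_mul_left, e1', ev_const hq1]
        simp only [ev_sub (p := p) (fun k => n s ω * n' t ω - _),
          ev_sub (p := p) (fun k => n s ω * n' t ω), ev_mul_left, e1, ev_const hp1]
        ring
      simp only [this, ev_mul_right, hA]
    rw [e2, div_eq_mul_one_div (A ω), ← mul_sub, abs_mul]
    have hAabs : |A ω| ≤ ev p fun s => ev q fun t => |Φ s t| * (nch a (u s) ω * nch a (v t) ω) := by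
      refine (abs_ev_le hp _).trans (ev_mono hp fun s => (abs_ev_le hq _).trans
        (ev_mono hq fun t => ?_))
      rw [abs_mul, abs_mul]
      exact mul_le_mul_of_nonneg_left (mul_le_mul (hn s ω) (hn' t ω) (abs_nonneg _)
        (nch_pos _ _ _).le) (abs_nonneg _)
    refine (mul_le_mul hAabs (abs_inv_mul_sub_le hz0 hz0') (abs_nonneg _) (ev_nonneg hp fun s =>
      ev_nonneg hq fun t => mul_nonneg (abs_nonneg _) (mul_nonneg (nch_pos _ _ _).le
        (nch_pos _ _ _).le))).trans ?_
    have key : ∀ s t, |Φ s t| * (nch a (u s) ω * nch a (v t) ω) *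
        (4 * ((z ω - 1) ^ 2 + (z' ω - 1) ^ 2)) ≤
        4 * ϱ * (Φ s t ^ 2 * (nch a (u s) ω * nch a (v t) ω * nch a (u s) ω * nch a (v t) ω)) +
        2 * ϱ⁻¹ * ((z ω - 1) ^ 4 + (z' ω - 1) ^ 4) := by
      intro s t
      set c := nch a (u s) ω * nch a (v t) ω with hc
      have hc0 : 0 ≤ c := mul_nonneg (nch_pos _ _ _).le (nch_pos _ _ _).le
      have j1 := abs_mul_sq_le hϱ (Φ s t * c) (z ω - 1)
      have j2 := abs_mul_sq_le hϱ (Φ s t * c) (z' ω - 1)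
      rw [abs_mul, abs_of_nonneg hc0] at j1 j2
      rw [mul_assoc c]
      nlinarith
    have := ev_mono hp fun s => ev_mono hq fun t => key s t
    simp only [ev_mul_right, ev_add, ev_mul_left, ev_const hp1, ev_const hq1] at this
    exact this
  have hI : |∫ ω, A ω / (z ω * z' ω) ∂stdGauss K - ∫ ω, (ev p fun s => ev q fun t =>
      ev p fun k => ev q fun l => F s t k l ω) ∂stdGauss K| ≤ ∫ ω, E ω ∂stdGauss K := by
    rw [← integral_sub bL.integrable bFF.integrable]
    exact abs_integral_le_integral_abs.trans (integral_mono
      (bL.sub bFF).integrable.abs bE.integrable hpt)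
  have hEI : ∫ ω, E ω ∂stdGauss K ≤ 4 * rexp 6 * (ϱ * (ev p fun s => ev q fun t => Φ s t ^ 2)) +
      48 * KT * (ϱ⁻¹ * ((ev p fun s => ev p fun t => r s t ^ 4) +
        ev q fun s => ev q fun t => r s t ^ 4)) := by
    have i1 := bΦcc.integrable
    have i2 := bz4.integrable
    have i3 := bz4'.integrable
    simp only [hE]
    rw [integral_add (by fun_prop) (by fun_prop), integral_const_mul, integral_const_mul,
      integral_add (by fun_prop) (by fun_prop),
      integral_ev fun s => ExpBdd.ev fun t => (ExpBdd.const _).mul (bcc s t)]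
    simp_rw [integral_ev fun t => (ExpBdd.const (Φ _ t ^ 2)).mul (bcc _ t)]
    have hcc : (ev p fun s => ev q fun t => ∫ ω, Φ s t ^ 2 *
        (nch a (u s) ω * nch a (v t) ω * nch a (u s) ω * nch a (v t) ω) ∂stdGauss K) ≤
        (ev p fun s => ev q fun t => Φ s t ^ 2) * rexp 6 := by
      simp only [← ev_mul_right]
      refine ev_mono hp fun s => ev_mono hq fun t => ?_
      rw [integral_const_mul]
      refine mul_le_mul_of_nonneg_left (nch_four_le (hd s) (hd' t) (hd s) (hd' t) (hC'' s t)
        (hC s s) (hC'' s t) ?_ (hC' t t) (hC'' s t)) (sq_nonneg _)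
      rw [dotProduct_comm]; exact hC'' s t
    have k1 := integral_ev_dev_four_le (r := r) (w := u) hp hp1 hd hC fun s t => by
      rw [h.uu]; exact hxr s t
    have k2 := integral_ev_dev_four_le (r := r) (w := v) hq hq1 hd' hC' fun s t => by
      rw [h.vv]; exact hxr s t
    have m1 := mul_le_mul_of_nonneg_left hcc (by positivity : 0 ≤ 4 * ϱ)
    have m2 := mul_le_mul_of_nonneg_left (add_le_add k1 k2) (by positivity : 0 ≤ 2 * ϱ⁻¹)
    linarith
  have hFI : |∫ ω, (ev p fun s => ev q fun t =>
      ev p fun k => ev q fun l => F s t k l ω) ∂stdGauss K -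
      ev p fun s => ev q fun t => Φ s t * G s t| ≤ (KT + 1) * (7 * (ϱ * (ev p fun s => ev q fun t =>
        Φ s t ^ 2)) + ϱ⁻¹ * ((ev p fun s => ev p fun t => r s t ^ 4) +
        5 * (ev p fun s => ev q fun t => r s t ^ 4) + ev q fun s => ev q fun t => r s t ^ 4)) := by
    rw [integral_ev fun s => ExpBdd.ev fun t => ExpBdd.ev fun k => ExpBdd.ev fun l => bF s t k l]
    simp_rw [integral_ev fun t => ExpBdd.ev fun k => ExpBdd.ev fun l => bF _ t k l,
      integral_ev fun k => ExpBdd.ev fun l => bF _ _ k l, integral_ev fun l => bF _ _ _ l]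
    have hG' : (ev p fun s => ev q fun t => Φ s t * G s t) =
        ev p fun s => ev q fun t => ev p fun _ => ev q fun _ => Φ s t * G s t := by
      simp only [ev_const hp1, ev_const hq1]
    rw [hG']
    simp only [← ev_sub]
    have hbound : ∀ s t k l, |∫ ω, F s t k l ω ∂stdGauss K - Φ s t * G s t| ≤
        (KT + 1) * (7 * (ϱ * Φ s t ^ 2) + ϱ⁻¹ * (3 * r s t ^ 4 + r s k ^ 4 + r k t ^ 4 + r s l ^ 4 +
          r t l ^ 4)) := by
      intro s t k l
      have i1 := (b2 s t).integrable
      have i2 := (bu s t k).integrable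
      have i3 := (bv s t l).integrable
      simp only [hF]
      rw [integral_const_mul, integral_sub (by fun_prop) (by fun_prop),
        integral_sub (by fun_prop) (by fun_prop), ← mul_sub, abs_mul]
      have g1 := hG s t
      have g2 := hGu s t k
      have g3 := hGv s t l
      set I1 := ∫ ω, n s ω * n' t ω ∂stdGauss K
      set I2 := ∫ ω, n s ω * n' t ω * (nch a (u k) ω - 1) ∂stdGauss K
      set I3 := ∫ ω, n s ω * n' t ω * (nch a (v l) ω - 1) ∂stdGauss K
      have hs : |I1 - I2 - I3 - G s t| ≤ 2 * (KT + 1) * (3 * r s t ^ 2 + r s k ^ 2 + r k t ^ 2 +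
          r s l ^ 2 + r t l ^ 2) := by
        rw [h.symm t k] at g2
        rw [abs_le] at g1 g2 g3 ⊢
        constructor <;> linarith
      refine (mul_le_mul_of_nonneg_left hs (abs_nonneg _)).trans ?_
      have j1 := abs_mul_sq_le hϱ (Φ s t) (r s t)
      have j2 := abs_mul_sq_le hϱ (Φ s t) (r s k)
      have j3 := abs_mul_sq_le hϱ (Φ s t) (r k t)
      have j4 := abs_mul_sq_le hϱ (Φ s t) (r s l)
      have j5 := abs_mul_sq_le hϱ (Φ s t) (r t l)
      have j : |Φ s t| * (3 * r s t ^ 2 + r s k ^ 2 + r k t ^ 2 + r s l ^ 2 + r t l ^ 2) ≤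
        (7 * (ϱ * Φ s t ^ 2) + ϱ⁻¹ * (3 * r s t ^ 4 + r s k ^ 4 + r k t ^ 4 + r s l ^ 4 +
          r t l ^ 4)) / 2 := by linarith
      have := mul_le_mul_of_nonneg_left j (by positivity : 0 ≤ 2 * (KT + 1))
      linarith
    refine ((abs_ev_le hp _).trans (ev_mono hp fun s => (abs_ev_le hq _).trans
      (ev_mono hq fun t => (abs_ev_le hp _).trans (ev_mono hp fun k => (abs_ev_le hq _).trans
      (ev_mono hq fun l => hbound s t k l))))).trans (le_of_eq ?_)
    have c1 : (ev q fun t => ev p fun k => r k t ^ 4) = ev p fun s => ev q fun t => r s t ^ 4 :=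
      ev_comm fun t k => r k t ^ 4
    simp only [ev_add, ev_mul_left, ev_const hp1, ev_const hq1, c1]
    ring
  refine (abs_sub_le _ (∫ ω, (ev p fun s => ev q fun t =>
      ev p fun k => ev q fun l => F s t k l ω) ∂stdGauss K) _).trans
    ((add_le_add (hI.trans hEI) hFI).trans ?_)
  have hE6 := Real.exp_pos 6
  have n1 : 0 ≤ ϱ * (ev p fun s => ev q fun t => Φ s t ^ 2) :=
    mul_nonneg hϱ.le (ev_nonneg hp fun s => ev_nonneg hq fun t => sq_nonneg _)
  have hr4 : ∀ s t, 0 ≤ r s t ^ 4 := fun s t => by positivity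
  have n2 : 0 ≤ ϱ⁻¹ * (ev p fun s => ev p fun t => r s t ^ 4) :=
    mul_nonneg (by positivity) (ev_nonneg hp fun s => ev_nonneg hp fun t => hr4 s t)
  have n3 : 0 ≤ ϱ⁻¹ * (ev p fun s => ev q fun t => r s t ^ 4) :=
    mul_nonneg (by positivity) (ev_nonneg hp fun s => ev_nonneg hq fun t => hr4 s t)
  have n4 : 0 ≤ ϱ⁻¹ * (ev q fun s => ev q fun t => r s t ^ 4) :=
    mul_nonneg (by positivity) (ev_nonneg hq fun s => ev_nonneg hq fun t => hr4 s t)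
  simp only [KP, mul_add]
  nlinarith [mul_nonneg hK.le n1, mul_nonneg hK.le n2, mul_nonneg hK.le n3, mul_nonneg hK.le n4,
    mul_nonneg hE6.le n1, mul_nonneg hE6.le n2, mul_nonneg hE6.le n3, mul_nonneg hE6.le n4]

lemma abs_pow_three_le_sq {z w : ℝ} (hw : w ≤ 1) (h : |z| ≤ w) : |z| ^ 3 ≤ w ^ 2 := by
  have h0 := abs_nonneg z
  calc |z| ^ 3 = |z| ^ 2 * |z| := by ring
    _ ≤ w ^ 2 * 1 := mul_le_mul (pow_le_pow_left₀ h0 h 2) (h.trans hw) h0 (by positivity)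
    _ = w ^ 2 := mul_one _

lemma cavity_pair_sinh [Nonempty S] (h : CavGram u v r x y a) (hp : ∀ s, 0 ≤ p s)
    (hp1 : ∑ s, p s = 1) (hq : ∀ s, 0 ≤ q s) (hq1 : ∑ s, q s = 1) (Φ : S → S → ℝ)
    {ϱ : ℝ} (hϱ : 0 < ϱ) :
    |∫ ω, (ev p fun s => ev q fun t => Φ s t * (sinh (u s ⬝ᵥ ω) * sinh (v t ⬝ᵥ ω))) /
      ((ev p fun s => cosh (u s ⬝ᵥ ω)) * ev q fun t => cosh (v t ⬝ᵥ ω)) ∂stdGauss K -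
      ev p fun s => ev q fun t => Φ s t * (y * r s t)| ≤
    KP * (ϱ * (ev p fun s => ev q fun t => Φ s t ^ 2) +
      ϱ⁻¹ * ((ev p fun s => ev p fun t => r s t ^ 4) + (ev p fun s => ev q fun t => r s t ^ 4) +
        ev q fun s => ev q fun t => r s t ^ 4)) := by
  have hK := KT_pos
  have hd : ∀ s, u s ⬝ᵥ u s = a := fun s => by rw [h.uu, h.diag]
  have hd' : ∀ s, v s ⬝ᵥ v s = a := fun s => by rw [h.vv, h.diag]
  have hxr : ∀ s t, |x * r s t| ≤ |r s t| := fun s t => by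
    rw [abs_mul, abs_of_nonneg h.x_nonneg]
    exact mul_le_of_le_one_left (abs_nonneg _) h.x_le
  have hyr : ∀ s t, |y * r s t| ≤ |r s t| := fun s t => by
    rw [abs_mul, abs_of_nonneg h.y_nonneg]
    exact mul_le_of_le_one_left (abs_nonneg _) h.y_le
  have hprod : ∀ {z z' w w' : ℝ}, |z| ≤ |w| → |z'| ≤ |w'| → |z * z'| ≤ w ^ 2 + w' ^ 2 := by
    intro z z' w w' h1 h2
    rw [abs_mul, ← sq_abs w, ← sq_abs w']
    have := mul_le_mul h1 h2 (abs_nonneg _) (abs_nonneg _)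
    nlinarith [sq_nonneg (|w| - |w'|), sq_nonneg |w|, sq_nonneg |w'|]
  have hcx : ∀ s t, |x * r s t| ^ 3 ≤ r s t ^ 2 := fun s t => by
    rw [← sq_abs (r s t)]; exact abs_pow_three_le_sq (h.abs_le s t) (hxr s t)
  have hcy : ∀ s t, |y * r s t| ^ 3 ≤ r s t ^ 2 := fun s t => by
    rw [← sq_abs (r s t)]; exact abs_pow_three_le_sq (h.abs_le s t) (hyr s t)
  have hvu : ∀ s t, v s ⬝ᵥ u t = y * r s t := h.swap.uv
  simp_rw [ev_ratio_sinh (u := u) (v := v) _ _ a]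
  refine cavity_pair_estimate h hp hp1 hq hq1 Φ hϱ (n := fun s ω => nsh a (u s) ω)
    (n' := fun s ω => nsh a (v s) ω) (fun s => ExpBdd.nsh a _) (fun s => ExpBdd.nsh a _)
    (fun s ω => abs_nsh_le_nch _ _ _) (fun s ω => abs_nsh_le_nch _ _ _) (fun s t => ?_)
    (fun s t k => ?_) fun s t k => ?_
  · have k1 := nsh_two_estimate (hd s) (hd' t) (by rw [h.uv]; exact h.abs_mul_le' s t)
    rw [h.uv] at k1
    refine k1.trans ?_
    nlinarith [mul_le_mul_of_nonneg_left (hcy s t) hK.le, mul_nonneg hK.le (sq_nonneg (r s t)),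
      sq_nonneg (r s t)]
  · have k1 := nsh_dev_estimate (hd s) (hd' t) (hd k) (by rw [h.uv]; exact h.abs_mul_le' s t)
      (by rw [h.uu]; exact h.abs_mul_le s k) (by rw [hvu]; exact h.abs_mul_le' t k)
    rw [h.uv, h.uu, hvu] at k1
    have k2 := hprod (hxr s k) (hyr t k)
    have n1 := mul_le_mul_of_nonneg_left (add_le_add (add_le_add (hcy s t) (hcx s k)) (hcy t k))
      (by positivity : 0 ≤ 2 * KT)
    rw [abs_le] at k1 k2 ⊢
    constructor <;> linarith [sq_nonneg (r s t), sq_nonneg (r s k), sq_nonneg (r t k)]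
  · have k1 := nsh_dev_estimate (hd s) (hd' t) (hd' k) (by rw [h.uv]; exact h.abs_mul_le' s t)
      (by rw [h.uv]; exact h.abs_mul_le' s k) (by rw [h.vv]; exact h.abs_mul_le t k)
    rw [h.uv, h.uv, h.vv] at k1
    have k2 := hprod (hyr s k) (hxr t k)
    have n1 := mul_le_mul_of_nonneg_left (add_le_add (add_le_add (hcy s t) (hcy s k)) (hcx t k))
      (by positivity : 0 ≤ 2 * KT)
    rw [abs_le] at k1 k2 ⊢
    constructor <;> linarith [sq_nonneg (r s t), sq_nonneg (r s k), sq_nonneg (r t k)]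

lemma cavity_pair_cosh [Nonempty S] (h : CavGram u v r x y a) (hp : ∀ s, 0 ≤ p s)
    (hp1 : ∑ s, p s = 1) (hq : ∀ s, 0 ≤ q s) (hq1 : ∑ s, q s = 1) (Φ : S → S → ℝ)
    {ϱ : ℝ} (hϱ : 0 < ϱ) :
    |∫ ω, (ev p fun s => ev q fun t => Φ s t * (cosh (u s ⬝ᵥ ω) * cosh (v t ⬝ᵥ ω))) /
      ((ev p fun s => cosh (u s ⬝ᵥ ω)) * ev q fun t => cosh (v t ⬝ᵥ ω)) ∂stdGauss K -
      ev p fun s => ev q fun t => Φ s t| ≤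
    KP * (ϱ * (ev p fun s => ev q fun t => Φ s t ^ 2) +
      ϱ⁻¹ * ((ev p fun s => ev p fun t => r s t ^ 4) + (ev p fun s => ev q fun t => r s t ^ 4) +
        ev q fun s => ev q fun t => r s t ^ 4)) := by
  have hK := KT_pos
  have hd : ∀ s, u s ⬝ᵥ u s = a := fun s => by rw [h.uu, h.diag]
  have hd' : ∀ s, v s ⬝ᵥ v s = a := fun s => by rw [h.vv, h.diag]
  have hvu : ∀ s t, v s ⬝ᵥ u t = y * r s t := h.swap.uv
  simp_rw [ev_ratio_cosh (u := u) (v := v) _ _ a]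
  have hone : (ev p fun s => ev q fun t => Φ s t) = ev p fun s => ev q fun t => Φ s t * 1 := by
    simp only [mul_one]
  rw [hone]
  refine cavity_pair_estimate h hp hp1 hq hq1 Φ hϱ (n := fun s ω => nch a (u s) ω)
    (n' := fun s ω => nch a (v s) ω) (fun s => ExpBdd.nch a _) (fun s => ExpBdd.nch a _)
    (fun s ω => (abs_of_pos (nch_pos _ _ _)).le) (fun s ω => (abs_of_pos (nch_pos _ _ _)).le)
    (fun s t => ?_) (fun s t k => ?_) fun s t k => ?_
  · have k1 := nch_two_estimate (hd s) (hd' t) (by rw [h.uv]; exact h.abs_mul_le' s t)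
    rw [h.uv] at k1
    refine k1.trans ?_
    nlinarith [mul_le_mul_of_nonneg_left (h.sq_mul_le' s t) hK.le, h.sq_mul_le' s t,
      mul_nonneg hK.le (sq_nonneg (r s t)), sq_nonneg (r s t)]
  · refine (nch_dev_estimate (hd s) (hd' t) (hd k) (by rw [h.uv]; exact h.abs_mul_le' s t)
      (by rw [h.uu]; exact h.abs_mul_le s k) (by rw [hvu]; exact h.abs_mul_le' t k)).trans ?_
    rw [h.uv, h.uu, hvu]
    exact mul_le_mul_of_nonneg_left (add_le_add (add_le_add (h.sq_mul_le' s t) (h.sq_mul_le s k))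
      (h.sq_mul_le' t k)) (by positivity)
  · refine (nch_dev_estimate (hd s) (hd' t) (hd' k) (by rw [h.uv]; exact h.abs_mul_le' s t)
      (by rw [h.uv]; exact h.abs_mul_le' s k) (by rw [h.vv]; exact h.abs_mul_le t k)).trans ?_
    rw [h.uv, h.uv, h.vv]
    exact mul_le_mul_of_nonneg_left (add_le_add (add_le_add (h.sq_mul_le' s t) (h.sq_mul_le' s k))
      (h.sq_mul_le t k)) (by positivity)

/-- Mixed moments are dominated by the moments of the two systems. -/
lemma PSDKernel.ev_pair_le {k : S → S → ℝ} (h : PSDKernel k) (hs : ∀ s t, k s t = k t s) :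
    2 * (ev p fun s => ev q fun t => k s t) ≤
      (ev p fun s => ev p fun t => k s t) + ev q fun s => ev q fun t => k s t := by
  have := h fun s => p s - q s
  have e : (ev q fun s => ev p fun t => k s t) = ev p fun s => ev q fun t => k s t := by
    rw [ev_comm]
    simp only [hs]
  have e2 : ∑ s, ∑ t, (p s - q s) * (p t - q t) * k s t =
      (ev p fun s => ev p fun t => k s t) - (ev p fun s => ev q fun t => k s t) -
      (ev q fun s => ev p fun t => k s t) + ev q fun s => ev q fun t => k s t := by
    simp only [ev, Finset.mul_sum, ← Finset.sum_sub_distrib, ← Finset.sum_add_distrib]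
    exact Finset.sum_congr rfl fun _ _ => Finset.sum_congr rfl fun _ _ => by ring
  rw [e2, e] at this
  linarith

end CavityPair

/-! ### Gibbs measures with Gaussian linear energies -/

section GibbsWeights

variable {S K : Type*} [Fintype S] [Fintype K]

/-- Gibbs weights of the energies `w s ⬝ᵥ ω`. -/
def gw (w : S → K → ℝ) (ω : K → ℝ) (s : S) : ℝ :=
  rexp (w s ⬝ᵥ ω) / ∑ t, rexp (w t ⬝ᵥ ω)

/-- Expected two-replica average of `f` under the Gibbs measures of `w` and `w'`. -/
def gE (w w' : S → K → ℝ) (f : S → S → ℝ) : ℝ :=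
  ∫ ω, (ev (gw w ω) fun s => ev (gw w' ω) fun t => f s t) ∂stdGauss K

lemma sum_exp_pos [Nonempty S] (w : S → K → ℝ) (ω : K → ℝ) : 0 < ∑ t, rexp (w t ⬝ᵥ ω) :=
  Finset.sum_pos (fun _ _ => Real.exp_pos _) Finset.univ_nonempty

lemma gw_nonneg (w : S → K → ℝ) (ω : K → ℝ) (s : S) : 0 ≤ gw w ω s :=
  div_nonneg (Real.exp_nonneg _) (Finset.sum_nonneg fun _ _ => Real.exp_nonneg _)

lemma sum_gw [Nonempty S] (w : S → K → ℝ) (ω : K → ℝ) : ∑ s, gw w ω s = 1 := by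
  simp only [gw, ← Finset.sum_div]
  exact div_self (sum_exp_pos w ω).ne'

lemma continuous_gw [Nonempty S] (w : S → K → ℝ) (s : S) : Continuous fun ω => gw w ω s := by
  have hc : ∀ t, Continuous fun ω => rexp (w t ⬝ᵥ ω) := fun t =>
    Real.continuous_exp.comp (continuous_dotProduct_left (w t))
  exact (hc s).div (continuous_finsetSum _ fun t _ => hc t) fun ω => (sum_exp_pos w ω).ne'

lemma gw_le_one [Nonempty S] (w : S → K → ℝ) (ω : K → ℝ) (s : S) : gw w ω s ≤ 1 := by
  rw [← sum_gw w ω]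
  exact Finset.single_le_sum (fun t _ => gw_nonneg w ω t) (Finset.mem_univ s)

lemma ExpBdd.gw [Nonempty S] (w : S → K → ℝ) (s : S) : ExpBdd fun ω => _root_.gw w ω s :=
  ExpBdd.of_le (continuous_gw w s) (ExpBdd.const 1) fun ω => by
    rw [abs_of_nonneg (gw_nonneg w ω s), abs_one]
    exact gw_le_one w ω s

lemma ExpBdd.gibbs [Nonempty S] (w : S → K → ℝ) {F : S → (K → ℝ) → ℝ} (h : ∀ s, ExpBdd (F s)) :
    ExpBdd fun ω => _root_.ev (_root_.gw w ω) fun s => F s ω :=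
  ExpBdd.sum _ fun s => (ExpBdd.gw w s).mul (h s)

lemma gibbs_integrable [Nonempty S] (w w' : S → K → ℝ) (f : S → S → ℝ) :
    Integrable (fun ω => ev (gw w ω) fun s => ev (gw w' ω) fun t => f s t) (stdGauss K) :=
  (ExpBdd.gibbs w fun _ => ExpBdd.gibbs w' fun _ => ExpBdd.const _).integrable

variable [Nonempty S] {w w' : S → K → ℝ} {f g : S → S → ℝ}

lemma gE_add : gE w w' (fun s t => f s t + g s t) = gE w w' f + gE w w' g := by
  unfold gE
  simp only [ev_add]
  exact integral_add (gibbs_integrable w w' f) (gibbs_integrable w w' g)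

lemma gE_sub : gE w w' (fun s t => f s t - g s t) = gE w w' f - gE w w' g := by
  unfold gE
  simp only [ev_sub]
  exact integral_sub (gibbs_integrable w w' f) (gibbs_integrable w w' g)

lemma gE_mul_left (c : ℝ) : gE w w' (fun s t => c * f s t) = c * gE w w' f := by
  unfold gE
  simp only [ev_mul_left]
  exact integral_const_mul _ _

lemma gE_const (c : ℝ) : gE w w' (fun _ _ => c) = c := by
  simp [gE, ev_const (sum_gw _ _)]

lemma gE_mono (h : ∀ s t, f s t ≤ g s t) : gE w w' f ≤ gE w w' g :=
  integral_mono (gibbs_integrable w w' f) (gibbs_integrable w w' g) fun ω =>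
    ev_mono (gw_nonneg _ _) fun s => ev_mono (gw_nonneg _ _) fun t => h s t

lemma gE_nonneg (h : ∀ s t, 0 ≤ f s t) : 0 ≤ gE w w' f := by
  rw [← gE_const (w := w) (w' := w') 0]
  exact gE_mono h

lemma gE_sum {ι : Type*} (A : Finset ι) (F : ι → S → S → ℝ) :
    gE w w' (fun s t => ∑ i ∈ A, F i s t) = ∑ i ∈ A, gE w w' (F i) := by
  classical
  induction A using Finset.induction_on with
  | empty => simpa using gE_const (w := w) (w' := w') 0
  | insert i A hi ih => simp only [Finset.sum_insert hi, gE_add, ih]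

end GibbsWeights

/-! ### Isolating one site -/

section Split

variable {S K : Type*} [Fintype S] [Fintype K]

/-- Replace the coordinates in `T` of the first argument by those of the second. -/
def mergeOn (T : K → Prop) [DecidablePred T] (z : (K → ℝ) × (K → ℝ)) : K → ℝ :=
  fun k => if T k then z.2 k else z.1 k

lemma measurePreserving_mergeOn (T : K → Prop) [DecidablePred T] :
    MeasurePreserving (mergeOn T) ((stdGauss K).prod (stdGauss K)) (stdGauss K) := by
  classical
  have hm : Measurable (mergeOn T) := by
    refine measurable_pi_lambda _ fun k => ?_
    unfold mergeOn
    split_ifs <;> fun_prop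
  refine ⟨hm, ?_⟩
  symm
  refine Measure.pi_eq fun s hs => ?_
  rw [Measure.map_apply hm (MeasurableSet.univ_pi hs)]
  have e : mergeOn T ⁻¹' Set.univ.pi s =
      (Set.univ.pi fun k => if T k then Set.univ else s k) ×ˢ
        Set.univ.pi fun k => if T k then s k else Set.univ := by
    ext z
    simp only [Set.mem_preimage, Set.mem_univ_pi, Set.mem_prod, mergeOn, ← forall_and]
    refine forall_congr' fun k => ?_
    by_cases hk : T k <;> simp [hk]
  rw [e, Measure.prod_prod]
  unfold stdGauss
  rw [Measure.pi_pi, Measure.pi_pi, ← Finset.prod_mul_distrib]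
  refine Finset.prod_congr rfl fun k _ => ?_
  by_cases hk : T k <;> simp [hk]

lemma integral_eq_integral_mergeOn (T : K → Prop) [DecidablePred T] {f : (K → ℝ) → ℝ}
    (hf : Integrable f (stdGauss K)) :
    ∫ ω, f ω ∂stdGauss K = ∫ ω, ∫ ω', f (mergeOn T (ω, ω')) ∂stdGauss K ∂stdGauss K := by
  have hmp := measurePreserving_mergeOn (K := K) T
  rw [← hmp.map_eq] at hf ⊢
  rw [integral_map hmp.measurable.aemeasurable hf.aestronglyMeasurable]
  rw [hmp.map_eq]
  exact integral_prod _ (hf.comp_measurable hmp.measurable)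

lemma integrable_integral_mergeOn (T : K → Prop) [DecidablePred T] {f : (K → ℝ) → ℝ}
    (hf : Integrable f (stdGauss K)) :
    Integrable (fun ω => ∫ ω', f (mergeOn T (ω, ω')) ∂stdGauss K) (stdGauss K) := by
  have hmp := measurePreserving_mergeOn (K := K) T
  rw [← hmp.map_eq] at hf
  exact (hf.comp_measurable hmp.measurable).integral_prod_left

/-- The part of the energy not involving the couplings in `T`. -/
def cavW (T : K → Prop) [DecidablePred T] (w : S → K → ℝ) (s : S) (k : K) : ℝ :=
  if T k then 0 else w s k

/-- The field acting on the isolated site, whose spin is `ε`. -/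
def cavV (T : K → Prop) [DecidablePred T] (ε : S → ℝ) (w : S → K → ℝ) (s : S) (k : K) : ℝ :=
  if T k then ε s * w s k else 0

/-- The flip `fl` reverses the spin `ε` and exactly the energies of couplings in `T`. -/
structure IsSiteFlip (T : K → Prop) (fl : S ≃ S) (ε : S → ℝ) (w : S → K → ℝ) : Prop where
  sq : ∀ s, ε s * ε s = 1
  spin_flip : ∀ s, ε (fl s) = -ε s
  mem : ∀ s k, T k → w (fl s) k = -w s k
  not_mem : ∀ s k, ¬ T k → w (fl s) k = w s k

variable {T : K → Prop} [DecidablePred T] {fl : S ≃ S} {ε : S → ℝ} {w w' : S → K → ℝ}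

lemma IsSiteFlip.dot_mergeOn (h : IsSiteFlip T fl ε w) (s : S) (ω ω' : K → ℝ) :
    w s ⬝ᵥ mergeOn T (ω, ω') = cavW T w s ⬝ᵥ ω + ε s * (cavV T ε w s ⬝ᵥ ω') := by
  simp only [dotProduct, Finset.mul_sum, ← Finset.sum_add_distrib]
  refine Finset.sum_congr rfl fun k _ => ?_
  by_cases hk : T k
  · simp only [mergeOn, cavW, cavV, hk, if_true]
    linear_combination (- w s k * ω' k) * h.sq s
  · simp [mergeOn, cavW, cavV, hk]

lemma IsSiteFlip.cavW_flip (h : IsSiteFlip T fl ε w) (s : S) : cavW T w (fl s) = cavW T w s := by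
  ext k
  by_cases hk : T k
  · simp [cavW, hk]
  · simp [cavW, hk, h.not_mem s k hk]

lemma IsSiteFlip.cavV_flip (h : IsSiteFlip T fl ε w) (s : S) :
    cavV T ε w (fl s) = cavV T ε w s := by
  ext k
  by_cases hk : T k
  · simp [cavV, hk, h.mem s k hk, h.spin_flip]
  · simp [cavV, hk]

lemma IsSiteFlip.cases (h : IsSiteFlip T fl ε w) (s : S) : ε s = 1 ∨ ε s = -1 :=
  mul_self_eq_one_iff.1 (h.sq s)

lemma IsSiteFlip.sum_even (h : IsSiteFlip T fl ε w) {f : S → ℝ} (hf : ∀ s, f (fl s) = f s)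
    (ω ω' : K → ℝ) :
    ∑ s, rexp (w s ⬝ᵥ mergeOn T (ω, ω')) * f s =
      ∑ s, rexp (cavW T w s ⬝ᵥ ω) * (f s * cosh (cavV T ε w s ⬝ᵥ ω')) := by
  have e1 := Equiv.sum_comp fl fun s => rexp (w s ⬝ᵥ mergeOn T (ω, ω')) * f s
  have e2 : ∑ s, rexp (w s ⬝ᵥ mergeOn T (ω, ω')) * f s =
      ∑ s, (rexp (w s ⬝ᵥ mergeOn T (ω, ω')) * f s +
        rexp (w (fl s) ⬝ᵥ mergeOn T (ω, ω')) * f (fl s)) / 2 := by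
    rw [← Finset.sum_div, Finset.sum_add_distrib, e1]; ring
  rw [e2]
  refine Finset.sum_congr rfl fun s _ => ?_
  rw [h.dot_mergeOn, h.dot_mergeOn, h.cavW_flip, h.cavV_flip, h.spin_flip, hf, Real.exp_add,
    Real.exp_add, Real.cosh_eq]
  rcases h.cases s with hs | hs <;> rw [hs] <;> ring_nf

lemma IsSiteFlip.sum_odd (h : IsSiteFlip T fl ε w) {f : S → ℝ} (hf : ∀ s, f (fl s) = f s)
    (ω ω' : K → ℝ) :
    ∑ s, rexp (w s ⬝ᵥ mergeOn T (ω, ω')) * (ε s * f s) =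
      ∑ s, rexp (cavW T w s ⬝ᵥ ω) * (f s * sinh (cavV T ε w s ⬝ᵥ ω')) := by
  have e1 := Equiv.sum_comp fl fun s => rexp (w s ⬝ᵥ mergeOn T (ω, ω')) * (ε s * f s)
  have e2 : ∑ s, rexp (w s ⬝ᵥ mergeOn T (ω, ω')) * (ε s * f s) =
      ∑ s, (rexp (w s ⬝ᵥ mergeOn T (ω, ω')) * (ε s * f s) +
        rexp (w (fl s) ⬝ᵥ mergeOn T (ω, ω')) * (ε (fl s) * f (fl s))) / 2 := by
    rw [← Finset.sum_div, Finset.sum_add_distrib, e1]; ring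
  rw [e2]
  refine Finset.sum_congr rfl fun s _ => ?_
  rw [h.dot_mergeOn, h.dot_mergeOn, h.cavW_flip, h.cavV_flip, h.spin_flip, hf, Real.exp_add,
    Real.exp_add, Real.sinh_eq]
  rcases h.cases s with hs | hs <;> rw [hs] <;> ring_nf

lemma ev_gw (w : S → K → ℝ) (ω : K → ℝ) (f : S → ℝ) :
    ev (gw w ω) f = (∑ s, rexp (w s ⬝ᵥ ω) * f s) / ∑ t, rexp (w t ⬝ᵥ ω) := by
  simp only [ev, gw, Finset.sum_div]
  exact Finset.sum_congr rfl fun _ _ => by ring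

lemma IsSiteFlip.sum_exp (h : IsSiteFlip T fl ε w) (ω ω' : K → ℝ) :
    ∑ s, rexp (w s ⬝ᵥ mergeOn T (ω, ω')) =
      ∑ s, rexp (cavW T w s ⬝ᵥ ω) * cosh (cavV T ε w s ⬝ᵥ ω') := by
  simpa using h.sum_even (f := fun _ => 1) (fun _ => rfl) ω ω'

lemma IsSiteFlip.ev_even [Nonempty S] (h : IsSiteFlip T fl ε w) {f : S → ℝ}
    (hf : ∀ s, f (fl s) = f s) (ω ω' : K → ℝ) :
    ev (gw w (mergeOn T (ω, ω'))) f =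
      (ev (gw (cavW T w) ω) fun s => f s * cosh (cavV T ε w s ⬝ᵥ ω')) /
        ev (gw (cavW T w) ω) fun s => cosh (cavV T ε w s ⬝ᵥ ω') := by
  simp only [ev_gw, h.sum_even hf, h.sum_exp]
  rw [div_div_div_cancel_right₀ (sum_exp_pos _ _).ne']

lemma IsSiteFlip.ev_odd [Nonempty S] (h : IsSiteFlip T fl ε w) {f : S → ℝ}
    (hf : ∀ s, f (fl s) = f s) (ω ω' : K → ℝ) :
    (ev (gw w (mergeOn T (ω, ω'))) fun s => ε s * f s) =
      (ev (gw (cavW T w) ω) fun s => f s * sinh (cavV T ε w s ⬝ᵥ ω')) /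
        ev (gw (cavW T w) ω) fun s => cosh (cavV T ε w s ⬝ᵥ ω') := by
  simp only [ev_gw, h.sum_odd hf, h.sum_exp]
  rw [div_div_div_cancel_right₀ (sum_exp_pos _ _).ne']

lemma IsSiteFlip.ev_even_even [Nonempty S] (h : IsSiteFlip T fl ε w) (h' : IsSiteFlip T fl ε w')
    {Φ : S → S → ℝ} (hΦ : ∀ s t, Φ (fl s) t = Φ s t) (hΦ' : ∀ s t, Φ s (fl t) = Φ s t)
    (ω ω' : K → ℝ) :
    (ev (gw w (mergeOn T (ω, ω'))) fun s => ev (gw w' (mergeOn T (ω, ω'))) fun t => Φ s t) =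
      (ev (gw (cavW T w) ω) fun s => ev (gw (cavW T w') ω) fun t =>
        Φ s t * (cosh (cavV T ε w s ⬝ᵥ ω') * cosh (cavV T ε w' t ⬝ᵥ ω'))) /
      ((ev (gw (cavW T w) ω) fun s => cosh (cavV T ε w s ⬝ᵥ ω')) *
        ev (gw (cavW T w') ω) fun t => cosh (cavV T ε w' t ⬝ᵥ ω')) := by
  simp only [fun s => h'.ev_even (f := fun t => Φ s t) (hΦ' s) ω ω']
  rw [h.ev_even (fun s => by simp only [hΦ]) ω ω']
  simp only [div_mul_eq_mul_div, ev_div, ← ev_mul_right]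
  rw [div_div, mul_comm (ev (gw (cavW T w') ω) _)]
  congr 1
  · congr 1; ext s; congr 1; ext t; ring
  · exact (ev_mul_right _ _).symm

lemma IsSiteFlip.ev_odd_odd [Nonempty S] (h : IsSiteFlip T fl ε w) (h' : IsSiteFlip T fl ε w')
    {Φ : S → S → ℝ} (hΦ : ∀ s t, Φ (fl s) t = Φ s t) (hΦ' : ∀ s t, Φ s (fl t) = Φ s t)
    (ω ω' : K → ℝ) :
    (ev (gw w (mergeOn T (ω, ω'))) fun s => ev (gw w' (mergeOn T (ω, ω'))) fun t =>
      ε s * ε t * Φ s t) =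
      (ev (gw (cavW T w) ω) fun s => ev (gw (cavW T w') ω) fun t =>
        Φ s t * (sinh (cavV T ε w s ⬝ᵥ ω') * sinh (cavV T ε w' t ⬝ᵥ ω'))) /
      ((ev (gw (cavW T w) ω) fun s => cosh (cavV T ε w s ⬝ᵥ ω')) *
        ev (gw (cavW T w') ω) fun t => cosh (cavV T ε w' t ⬝ᵥ ω')) := by
  simp only [mul_assoc, ev_mul_left, fun s => h'.ev_odd (f := fun t => Φ s t) (hΦ' s) ω ω']
  rw [h.ev_odd (fun s => by simp only [hΦ]) ω ω']
  simp only [div_mul_eq_mul_div, ev_div, ← ev_mul_right]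
  rw [div_div, mul_comm (ev (gw (cavW T w') ω) _)]
  congr 1
  · congr 1; ext s; congr 1; ext t; ring
  · exact (ev_mul_right _ _).symm

variable [Nonempty S] {r : S → S → ℝ} {x y a : ℝ}

lemma gE_even_ge (h : IsSiteFlip T fl ε w) (h' : IsSiteFlip T fl ε w')
    (hg : CavGram (cavV T ε w) (cavV T ε w') r x y a) {Φ : S → S → ℝ}
    (hΦ : ∀ s t, Φ (fl s) t = Φ s t) (hΦ' : ∀ s t, Φ s (fl t) = Φ s t)
    (hΦ0 : ∀ s t, 0 ≤ Φ s t) :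
    gE (cavW T w) (cavW T w') Φ ≤ rexp 6 * gE w w' Φ := by
  rw [gE.eq_def w, integral_eq_integral_mergeOn T (gibbs_integrable _ _ _),
    ← integral_const_mul]
  refine integral_mono (gibbs_integrable _ _ _)
    ((integrable_integral_mergeOn T (gibbs_integrable w w' _)).const_mul _) fun ω => ?_
  simp only [h.ev_even_even h' hΦ hΦ' ω]
  exact cavity_cosh_ge_div hg (gw_nonneg _ _) (sum_gw _ _) (gw_nonneg _ _) (sum_gw _ _) hΦ0

/-- Upper bound for odd moments, one system. -/
lemma gE_odd_le (h : IsSiteFlip T fl ε w)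
    (hg : CavGram (cavV T ε w) (cavV T ε w) r x x a) (hr : ∀ s t, r (fl s) t = r s t)
    {m : ℕ} (hm : Even (m + 3)) (hpsd : PSDKernel fun s t => r s t ^ m) :
    gE w w (fun s t => ε s * ε t * r s t ^ m) ≤
      x * gE w w (fun s t => r s t ^ (m + 1)) +
        (396 * KT + 20 * (KT + 1)) * rexp 6 * gE w w (fun s t => r s t ^ (m + 3)) := by
  have hr' : ∀ s t, r s (fl t) = r s t := fun s t => by rw [hg.symm, hr, hg.symm]
  have hK := KT_pos
  have hx := hg.x_nonneg
  have hx1 := hg.x_le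
  set W := cavW T w
  have c1 : gE w w (fun s t => ε s * ε t * r s t ^ m) ≤
      x * gE W W (fun s t => r s t ^ (m + 1)) + 396 * KT * gE W W fun s t => r s t ^ (m + 3) := by
    rw [← gE_mul_left, ← gE_mul_left, ← gE_add, gE,
      integral_eq_integral_mergeOn T (gibbs_integrable _ _ _)]
    refine integral_mono (integrable_integral_mergeOn T (gibbs_integrable w w _))
      (gibbs_integrable _ _ _) fun ω => ?_
    simp only [h.ev_odd_odd h (Φ := fun s t => r s t ^ m) (fun s t => by rw [hr])
      (fun s t => by rw [hr']) ω]
    refine (cavity_sinh_le hg (gw_nonneg _ _) (sum_gw _ _) hm hpsd).trans (le_of_eq ?_)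
    simp only [ev_add, ev_mul_left]
    rfl
  have c2 : gE W W (fun s t => r s t ^ (m + 1)) - 20 * (KT + 1) * gE W W
      (fun s t => r s t ^ (m + 3)) ≤ gE w w fun s t => r s t ^ (m + 1) := by
    rw [← gE_mul_left, ← gE_sub, gE.eq_def w,
      integral_eq_integral_mergeOn T (gibbs_integrable _ _ _)]
    refine integral_mono (gibbs_integrable _ _ _)
      (integrable_integral_mergeOn T (gibbs_integrable w w _)) fun ω => ?_
    simp only [h.ev_even_even h (Φ := fun s t => r s t ^ (m + 1)) (fun s t => by rw [hr])
      (fun s t => by rw [hr']) ω]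
    refine le_trans (le_of_eq ?_) (cavity_cosh_ge hg (gw_nonneg _ _) (sum_gw _ _) hm)
    simp only [ev_sub, ev_mul_left]
    rfl
  have c3 : gE W W (fun s t => r s t ^ (m + 3)) ≤ rexp 6 * gE w w fun s t => r s t ^ (m + 3) :=
    gE_even_ge h h hg (fun s t => by rw [hr]) (fun s t => by rw [hr']) fun s t => hm.pow_nonneg _
  have hn : 0 ≤ gE W W fun s t => r s t ^ (m + 3) := gE_nonneg fun s t => hm.pow_nonneg _
  have d1 := mul_le_mul_of_nonneg_left c2 hx
  have d2 := mul_le_mul_of_nonneg_left c3 (by positivity : 0 ≤ 396 * KT + 20 * (KT + 1))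
  have d3 := mul_le_mul_of_nonneg_right hx1 (mul_nonneg (by positivity : 0 ≤ 20 * (KT + 1)) hn)
  linarith

end Split

section PairEstimate

variable {S K : Type*} [Fintype S] [Fintype K] {T : K → Prop} [DecidablePred T] {fl : S ≃ S}
  {ε : S → ℝ} {w w' : S → K → ℝ} {r : S → S → ℝ} {x y a : ℝ}

lemma CavGram.left {u v : S → K → ℝ} (h : CavGram u v r x y a) : CavGram u u r x x a :=
  ⟨h.uu, h.uu, h.uu, h.diag, h.symm, h.abs_le, h.x_nonneg, h.x_le, h.x_nonneg, h.x_le⟩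

lemma CavGram.right {u v : S → K → ℝ} (h : CavGram u v r x y a) : CavGram v v r x x a :=
  ⟨h.vv, h.vv, h.vv, h.diag, h.symm, h.abs_le, h.x_nonneg, h.x_le, h.x_nonneg, h.x_le⟩

lemma abs_integral_sub_le {α : Type*} [MeasurableSpace α] {μ : Measure α} {F G B : α → ℝ}
    (hF : Integrable F μ) (hG : Integrable G μ) (hB : Integrable B μ)
    (h : ∀ z, |F z - G z| ≤ B z) : |∫ z, F z ∂μ - ∫ z, G z ∂μ| ≤ ∫ z, B z ∂μ := by
  rw [← integral_sub hF hG]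
  exact (abs_integral_le_integral_abs).trans (integral_mono (hF.sub hG).abs hB h)

variable [Nonempty S]

/-- First order expansion of the odd pair moment of two coupled systems. -/
lemma gE_pair_odd (h : IsSiteFlip T fl ε w) (h' : IsSiteFlip T fl ε w')
    (hg : CavGram (cavV T ε w) (cavV T ε w') r x y a) (hr : ∀ s t, r (fl s) t = r s t)
    (hpsd : PSDKernel fun s t => r s t ^ 4) {ϱ : ℝ} (hϱ : 0 < ϱ) :
    |gE w w' (fun s t => ε s * ε t * r s t) - y * gE w w' (fun s t => r s t ^ 2)| ≤
      3 * KP * rexp 6 * (ϱ * gE w w' (fun s t => r s t ^ 2) +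
        ϱ⁻¹ * (gE w w (fun s t => r s t ^ 4) + gE w' w' (fun s t => r s t ^ 4))) := by
  have hr' : ∀ s t, r s (fl t) = r s t := fun s t => by rw [hg.symm, hr, hg.symm]
  have hK : 0 < KP := by have := KT_pos; unfold KP; positivity
  have hy := hg.y_nonneg
  have hy1 := hg.y_le
  have hϱ' : 0 < ϱ⁻¹ := inv_pos.2 hϱ
  set W := cavW T w
  set W' := cavW T w'
  set q := fun s t => r s t ^ 4 with hq
  set Q : (K → ℝ) → ℝ := fun ω => (ev (gw W ω) fun s => ev (gw W ω) fun t => q s t) +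
        (ev (gw W ω) fun s => ev (gw W' ω) fun t => q s t) +
        ev (gw W' ω) fun s => ev (gw W' ω) fun t => q s t with hQ
  set B : (S → S → ℝ) → (K → ℝ) → ℝ := fun Ψ ω =>
    KP * (ϱ * (ev (gw W ω) fun s => ev (gw W' ω) fun t => Ψ s t) + ϱ⁻¹ * Q ω) with hB
  have iQ : Integrable Q (stdGauss K) :=
    ((gibbs_integrable W W q).add (gibbs_integrable W W' q)).add (gibbs_integrable W' W' q)
  have eQ : ∫ ω, Q ω ∂stdGauss K = gE W W q + gE W W' q + gE W' W' q := by
    have i1 : Integrable (fun ω => (ev (gw W ω) fun s => ev (gw W ω) fun t => q s t) +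
        ev (gw W ω) fun s => ev (gw W' ω) fun t => q s t) (stdGauss K) :=
      (gibbs_integrable W W q).add (gibbs_integrable W W' q)
    rw [hQ, integral_add i1 (gibbs_integrable W' W' q),
      integral_add (gibbs_integrable W W q) (gibbs_integrable W W' q)]
    rfl
  have iB : ∀ Ψ, Integrable (B Ψ) (stdGauss K) := fun Ψ =>
    (((gibbs_integrable W W' Ψ).const_mul ϱ).add (iQ.const_mul ϱ⁻¹)).const_mul KP
  have eB : ∀ Ψ, ∫ ω, B Ψ ω ∂stdGauss K =
      KP * (ϱ * gE W W' Ψ + ϱ⁻¹ * (gE W W q + gE W W' q + gE W' W' q)) := fun Ψ => by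
    rw [hB, integral_const_mul, integral_add ((gibbs_integrable W W' Ψ).const_mul ϱ)
      (iQ.const_mul ϱ⁻¹), integral_const_mul, integral_const_mul, eQ]
    rfl
  have c1 : |gE w w' (fun s t => ε s * ε t * r s t) - gE W W' (fun s t => r s t * (y * r s t))| ≤
      KP * (ϱ * gE W W' (fun s t => r s t ^ 2) +
        ϱ⁻¹ * (gE W W q + gE W W' q + gE W' W' q)) := by
    rw [← eB, gE.eq_def w, integral_eq_integral_mergeOn T (gibbs_integrable _ _ _)]
    refine abs_integral_sub_le (integrable_integral_mergeOn T (gibbs_integrable w w' _))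
      (gibbs_integrable _ _ _) (iB _) fun ω => ?_
    simp only [h.ev_odd_odd h' hr hr' ω]
    exact cavity_pair_sinh hg (gw_nonneg _ _) (sum_gw _ _) (gw_nonneg _ _) (sum_gw _ _) r hϱ
  have c2 : |gE w w' (fun s t => r s t ^ 2) - gE W W' (fun s t => r s t ^ 2)| ≤
      KP * (ϱ * gE W W' (fun s t => (r s t ^ 2) ^ 2) +
        ϱ⁻¹ * (gE W W q + gE W W' q + gE W' W' q)) := by
    rw [← eB, gE.eq_def w, integral_eq_integral_mergeOn T (gibbs_integrable _ _ _)]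
    refine abs_integral_sub_le (integrable_integral_mergeOn T (gibbs_integrable w w' _))
      (gibbs_integrable _ _ _) (iB _) fun ω => ?_
    simp only [h.ev_even_even h' (Φ := fun s t => r s t ^ 2) (fun s t => by rw [hr])
      (fun s t => by rw [hr']) ω]
    exact cavity_pair_cosh hg (gw_nonneg _ _) (sum_gw _ _) (gw_nonneg _ _) (sum_gw _ _)
      (fun s t => r s t ^ 2) hϱ
  have c3 : gE W W' (fun s t => r s t * (y * r s t)) = y * gE W W' fun s t => r s t ^ 2 := by
    rw [← gE_mul_left]
    congr 1; ext s t; ring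
  have c4 : gE W W' (fun s t => (r s t ^ 2) ^ 2) ≤ gE W W' fun s t => r s t ^ 2 :=
    gE_mono fun s t => by
      have : r s t ^ 2 ≤ 1 := (sq_le_one_iff_abs_le_one _).2 (hg.abs_le s t)
      nlinarith [sq_nonneg (r s t)]
  have c5 : 2 * gE W W' q ≤ gE W W q + gE W' W' q := by
    rw [← gE_mul_left]
    unfold gE
    rw [← integral_add (gibbs_integrable _ _ _) (gibbs_integrable _ _ _)]
    refine integral_mono (gibbs_integrable _ _ _)
      ((gibbs_integrable _ _ _).add (gibbs_integrable _ _ _)) fun ω => ?_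
    simp only [ev_mul_left]
    exact hpsd.ev_pair_le fun s t => by simp only [hq, hg.symm s t]
  have q0 : ∀ s t, 0 ≤ q s t := fun s t => by positivity
  have qf : ∀ s t, q (fl s) t = q s t := fun s t => by simp only [hq, hr]
  have qf' : ∀ s t, q s (fl t) = q s t := fun s t => by simp only [hq, hr']
  have c6 : gE W W q ≤ rexp 6 * gE w w q := gE_even_ge h h hg.left qf qf' q0
  have c7 : gE W' W' q ≤ rexp 6 * gE w' w' q := gE_even_ge h' h' hg.right qf qf' q0
  have c8 : gE W W' (fun s t => r s t ^ 2) ≤ rexp 6 * gE w w' fun s t => r s t ^ 2 :=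
    gE_even_ge h h' hg (fun s t => by rw [hr]) (fun s t => by rw [hr']) fun s t => by positivity
  have n8 : 0 ≤ gE w w' fun s t => r s t ^ 2 := gE_nonneg fun s t => by positivity
  rw [c3] at c1
  set A := gE w w' (fun s t => ε s * ε t * r s t)
  set X := gE w w' fun s t => r s t ^ 2
  set X' := gE W W' fun s t => r s t ^ 2
  have d1 : |A - y * X| ≤ |A - y * X'| + |X - X'| := by
    have e : A - y * X = (A - y * X') - y * (X - X') := by ring
    rw [e]
    refine (abs_sub _ _).trans (add_le_add_right ?_ _)
    rw [abs_mul, abs_of_nonneg hy]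
    exact mul_le_of_le_one_left (abs_nonneg _) hy1
  have d2 : |A - y * X'| + |X - X'| ≤
      KP * (2 * (ϱ * X') + ϱ⁻¹ * (3 * (gE W W q + gE W' W' q))) := by
    refine (add_le_add c1 c2).trans ?_
    rw [← mul_add]
    refine mul_le_mul_of_nonneg_left ?_ hK.le
    have := mul_le_mul_of_nonneg_left c4 hϱ.le
    have := mul_le_mul_of_nonneg_left c5 hϱ'.le
    linarith
  refine d1.trans (d2.trans ?_)
  have e : 3 * KP * rexp 6 * (ϱ * X + ϱ⁻¹ * (gE w w q + gE w' w' q)) =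
      KP * (3 * (ϱ * (rexp 6 * X)) + ϱ⁻¹ * (3 * (rexp 6 * gE w w q + rexp 6 * gE w' w' q))) := by
    ring
  rw [e]
  have f1 := mul_le_mul_of_nonneg_left c8 hϱ.le
  have f0 : 0 ≤ ϱ * (rexp 6 * X) := by positivity
  have f2 := mul_le_mul_of_nonneg_left (add_le_add c6 c7) hϱ'.le
  exact mul_le_mul_of_nonneg_left (by linarith) hK.le

end PairEstimate

/-! ### The coupled SK systems as Gaussian linear energies -/

section PSDPow

variable {S : Type*} [Fintype S]

lemma PSDKernel.mul_rank_one {k : S → S → ℝ} (h : PSDKernel k) (b : S → ℝ) :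
    PSDKernel fun s t => k s t * (b s * b t) := fun ψ => by
  refine (h fun s => ψ s * b s).trans_eq ?_
  exact Finset.sum_congr rfl fun _ _ => Finset.sum_congr rfl fun _ _ => by ring

lemma PSDKernel.sum {ι : Type*} (A : Finset ι) {k : ι → S → S → ℝ} (h : ∀ j, PSDKernel (k j)) :
    PSDKernel fun s t => ∑ j ∈ A, k j s t := fun ψ => by
  refine (Finset.sum_nonneg fun j (_ : j ∈ A) => h j ψ).trans_eq ?_
  rw [Finset.sum_comm]
  refine Finset.sum_congr rfl fun s _ => ?_
  rw [Finset.sum_comm]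
  exact Finset.sum_congr rfl fun t _ => by rw [Finset.mul_sum]

lemma PSDKernel.gram_pow {ι : Type*} (A : Finset ι) (b : ι → S → ℝ) (m : ℕ) :
    PSDKernel fun s t => (∑ j ∈ A, b j s * b j t) ^ m := by
  induction m with
  | zero =>
    intro ψ
    simp only [pow_zero, mul_one, ← Finset.mul_sum, ← Finset.sum_mul]
    exact mul_self_nonneg _
  | succ m ih =>
    simp only [pow_succ, Finset.mul_sum]
    exact PSDKernel.sum A fun j => ih.mul_rank_one (b j)

end PSDPow

section Model

variable {N : ℕ}

/-- Index set of the three families of couplings. -/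
abbrev Dis (N : ℕ) : Type := (Fin N × Fin N) ⊕ ((Fin N × Fin N) ⊕ (Fin N × Fin N))

/-- The pair of sites joined by a coupling. -/
def prj : Dis N → Fin N × Fin N := Sum.elim id (Sum.elim id id)

/-- The energy contribution of a pair of sites. -/
def bond (p : Fin N × Fin N) (σ : Config N) : ℝ :=
  if p.1 < p.2 then spin (σ p.1) * spin (σ p.2) else 0

/-- Energy vectors with coefficients `c` in front of the couplings. -/
def disW (c : Dis N → ℝ) (σ : Config N) (k : Dis N) : ℝ := c k * bond (prj k) σ

/-- The energies with coefficients `c`, `c'` have covariance `v` per pair of sites. -/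
def CovCond (c c' : Dis N → ℝ) (v : ℝ) : Prop :=
  ∀ φ : Fin N × Fin N → ℝ, ∑ k, c k * c' k * φ (prj k) = v * ∑ p, φ p

lemma spin_mul_self (b : Bool) : spin b * spin b = 1 := by cases b <;> norm_num [spin]

lemma spin_not (b : Bool) : spin (!b) = -spin b := by cases b <;> norm_num [spin]

lemma abs_spin (b : Bool) : |spin b| = 1 := by cases b <;> norm_num [spin]

/-- The overlap with site `i` removed. -/
def covl (i : Fin N) (σ τ : Config N) : ℝ :=
  (∑ j ∈ Finset.univ.erase i, spin (σ j) * spin (τ j)) / N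

lemma ovlp_eq_covl (i : Fin N) (σ τ : Config N) :
    ovlp N σ τ = covl i σ τ + spin (σ i) * spin (τ i) / N := by
  rw [ovlp, covl, ← add_div, Finset.sum_erase_add _ _ (Finset.mem_univ i)]

/-- Reversal of the spin at site `i`. -/
def flipAt (i : Fin N) : Config N ≃ Config N :=
  Function.Involutive.toPerm (fun σ => Function.update σ i (!σ i)) fun σ => by
    ext j; by_cases hj : j = i
    · subst hj; simp
    · simp [hj]

lemma flipAt_same (i : Fin N) (σ : Config N) : flipAt i σ i = !σ i :=
  Function.update_self ..

lemma flipAt_ne {i j : Fin N} (h : j ≠ i) (σ : Config N) : flipAt i σ j = σ j :=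
  Function.update_of_ne h ..

/-- The couplings that involve site `i`. -/
def Touches (i : Fin N) (k : Dis N) : Prop := (prj k).1 = i ∨ (prj k).2 = i

instance (i : Fin N) : DecidablePred (Touches i) := fun _ =>
  inferInstanceAs (Decidable (_ ∨ _))

lemma bond_flip_touch {i : Fin N} {p : Fin N × Fin N} (h : p.1 = i ∨ p.2 = i) (σ : Config N) :
    bond p (flipAt i σ) = -bond p σ := by
  unfold bond
  split_ifs with hp
  · rcases h with h | h
    · have h2 : p.2 ≠ i := fun e => by rw [h, e] at hp; exact lt_irrefl _ hp
      rw [flipAt_ne h2, h, flipAt_same, spin_not]; ring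
    · have h2 : p.1 ≠ i := fun e => by rw [h, e] at hp; exact lt_irrefl _ hp
      rw [flipAt_ne h2, h, flipAt_same, spin_not]; ring
  · simp

lemma isSiteFlip (i : Fin N) (c : Dis N → ℝ) :
    IsSiteFlip (Touches i) (flipAt i) (fun σ => spin (σ i)) (disW c) where
  sq σ := spin_mul_self _
  spin_flip σ := by rw [flipAt_same, spin_not]
  mem σ k hk := by rw [disW, bond_flip_touch hk, disW]; ring
  not_mem σ k hk := by
    obtain ⟨h1, h2⟩ := not_or.1 hk
    simp only [disW, bond, flipAt_ne h1, flipAt_ne h2]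

lemma covl_flip (i : Fin N) (σ τ : Config N) : covl i (flipAt i σ) τ = covl i σ τ := by
  unfold covl
  congr 1
  exact Finset.sum_congr rfl fun j hj => by rw [flipAt_ne (Finset.ne_of_mem_erase hj)]

lemma sum_touching_pairs (i : Fin N) (d : Fin N → ℝ) (hd : ∀ j, d j * d j = 1) :
    ∑ p : Fin N × Fin N, (if p.1 = i ∨ p.2 = i then
      d i * (if p.1 < p.2 then d p.1 * d p.2 else 0) else 0) = ∑ j ∈ Finset.univ.erase i, d j := by
  have e : ∀ a b : Fin N, (if a = i ∨ b = i then
      d i * (if a < b then d a * d b else 0) else 0) =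
      (if a = i then (if i < b then d b else 0) else 0) +
        (if b = i then (if a < i then d a else 0) else 0) := by
    intro a b
    by_cases ha : a = i
    · subst ha
      by_cases hb : b = a
      · subst hb; simp
      · by_cases hab : a < b
        · simp only [true_or, if_true, hab, hb, if_false]
          linear_combination d b * hd a
        · simp [hab, hb]
    · by_cases hb : b = i
      · subst hb
        by_cases hab : a < b
        · simp only [or_true, if_true, hab, ha, if_false]
          linear_combination d a * hd b
        · simp [hab, ha]
      · simp [ha, hb]
  rw [Fintype.sum_prod_type]
  simp only [e, Finset.sum_add_distrib]
  have e1 : ∑ a : Fin N, ∑ b : Fin N, (if a = i then (if i < b then d b else 0) else 0) =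
      ∑ b : Fin N, if i < b then d b else 0 := by
    rw [Finset.sum_comm]
    simp
  have e2 : ∑ a : Fin N, ∑ b : Fin N, (if b = i then (if a < i then d a else 0) else 0) =
      ∑ a : Fin N, if a < i then d a else 0 := by simp
  rw [e1, e2, ← Finset.sum_add_distrib, ← Finset.filter_ne' Finset.univ i, Finset.sum_filter]
  refine Finset.sum_congr rfl fun j _ => ?_
  rcases lt_trichotomy i j with h | h | h
  · simp [h, h.not_gt, h.ne']
  · simp [h]
  · simp [h, h.not_gt, h.ne]

lemma dot_cavV {c c' : Dis N → ℝ} {v : ℝ} (h : CovCond c c' (v / N)) (i : Fin N)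
    (σ τ : Config N) :
    cavV (Touches i) (fun σ => spin (σ i)) (disW c) σ ⬝ᵥ
      cavV (Touches i) (fun σ => spin (σ i)) (disW c') τ = v * covl i σ τ := by
  have hd : ∀ j, spin (σ j) * spin (τ j) * (spin (σ j) * spin (τ j)) = 1 := fun j => by
    rw [mul_mul_mul_comm, spin_mul_self, spin_mul_self, one_mul]
  have := h fun p => if p.1 = i ∨ p.2 = i then spin (σ i) * spin (τ i) *
    (if p.1 < p.2 then spin (σ p.1) * spin (τ p.1) * (spin (σ p.2) * spin (τ p.2)) else 0) else 0
  rw [sum_touching_pairs i (fun j => spin (σ j) * spin (τ j)) hd] at this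
  rw [covl, mul_div_assoc', mul_div_right_comm, ← this, dotProduct]
  refine Finset.sum_congr rfl fun k _ => ?_
  by_cases hk : Touches i k
  · have hk' : (prj k).1 = i ∨ (prj k).2 = i := hk
    simp only [cavV, hk, hk', if_true, disW, bond]
    split_ifs <;> ring
  · have hk' : ¬ ((prj k).1 = i ∨ (prj k).2 = i) := hk
    simp [cavV, hk, hk']

lemma abs_covl_le (i : Fin N) (σ τ : Config N) : |covl i σ τ| ≤ 1 := by
  have hN : (0 : ℝ) < N := by exact_mod_cast i.pos
  rw [covl, abs_div, abs_of_pos hN, div_le_one hN]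
  refine (Finset.abs_sum_le_sum_abs _ _).trans ?_
  simp only [abs_mul, abs_spin, mul_one, Finset.sum_const, nsmul_eq_mul]
  exact_mod_cast (Finset.card_le_univ _).trans_eq (Fintype.card_fin N)

lemma covl_self (i : Fin N) (σ : Config N) : covl i σ σ = ((N : ℝ) - 1) / N := by
  have : 1 ≤ N := i.pos
  simp only [covl, spin_mul_self, Finset.sum_const, nsmul_eq_mul, mul_one]
  rw [Finset.card_erase_of_mem (Finset.mem_univ i), Finset.card_univ, Fintype.card_fin,
    Nat.cast_sub this, Nat.cast_one]

lemma cavGram_site {c c' : Dis N → ℝ} {x y : ℝ} (h : CovCond c c (x / N))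
    (h' : CovCond c' c' (x / N)) (hcc : CovCond c c' (y / N)) (hx : 0 ≤ x) (hx1 : x ≤ 1)
    (hy : 0 ≤ y) (hy1 : y ≤ 1) (i : Fin N) :
    CavGram (cavV (Touches i) (fun σ => spin (σ i)) (disW c))
      (cavV (Touches i) (fun σ => spin (σ i)) (disW c')) (covl i) x y (x * (((N : ℝ) - 1) / N)) where
  uu := dot_cavV h i
  vv := dot_cavV h' i
  uv := dot_cavV hcc i
  diag σ := by rw [covl_self]
  symm σ τ := by simp only [covl, mul_comm]
  abs_le := abs_covl_le i
  x_nonneg := hx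
  x_le := hx1
  y_nonneg := hy
  y_le := hy1

lemma psd_covl_pow (i : Fin N) (m : ℕ) : PSDKernel fun σ τ => covl i σ τ ^ m := by
  have hN : (0 : ℝ) ≤ N := Nat.cast_nonneg _
  have := PSDKernel.gram_pow (S := Config N) (Finset.univ.erase i)
    (fun j σ => spin (σ j) / √(N : ℝ)) m
  convert this using 5
  rw [covl, Finset.sum_div]
  refine Finset.sum_congr rfl fun j _ => ?_
  rw [div_mul_div_comm, Real.mul_self_sqrt hN]

end Model

section Link

variable (N : ℕ) (β t : ℝ)

/-- Coupling coefficients of the first system. -/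
def coefOne : Dis N → ℝ := Sum.elim (fun _ => √t * (β / √(N : ℝ)))
  (Sum.elim (fun _ => √(1 - t) * (β / √(N : ℝ))) fun _ => 0)

/-- Coupling coefficients of the second system. -/
def coefTwo : Dis N → ℝ := Sum.elim (fun _ => √t * (β / √(N : ℝ)))
  (Sum.elim (fun _ => 0) fun _ => √(1 - t) * (β / √(N : ℝ)))

variable {N β t}

lemma covCond_one (ht : t ∈ Set.Icc (0 : ℝ) 1) :
    CovCond (coefOne N β t) (coefOne N β t) (β ^ 2 / N) := fun φ => by
  have h1 := Real.mul_self_sqrt ht.1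
  have h2 := Real.mul_self_sqrt (sub_nonneg.2 ht.2)
  have h3 : β / √(N : ℝ) * (β / √(N : ℝ)) = β ^ 2 / N := by
    rw [div_mul_div_comm, Real.mul_self_sqrt (Nat.cast_nonneg _), sq]
  simp only [Fintype.sum_sum_type, coefOne, prj, Sum.elim_inl, Sum.elim_inr, id, zero_mul,
    Finset.sum_const_zero, add_zero, ← Finset.mul_sum]
  rw [mul_mul_mul_comm, mul_mul_mul_comm √(1 - t), h1, h2, h3]
  ring

lemma covCond_two (ht : t ∈ Set.Icc (0 : ℝ) 1) :
    CovCond (coefTwo N β t) (coefTwo N β t) (β ^ 2 / N) := fun φ => by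
  have h1 := Real.mul_self_sqrt ht.1
  have h2 := Real.mul_self_sqrt (sub_nonneg.2 ht.2)
  have h3 : β / √(N : ℝ) * (β / √(N : ℝ)) = β ^ 2 / N := by
    rw [div_mul_div_comm, Real.mul_self_sqrt (Nat.cast_nonneg _), sq]
  simp only [Fintype.sum_sum_type, coefTwo, prj, Sum.elim_inl, Sum.elim_inr, id, zero_mul,
    Finset.sum_const_zero, zero_add, ← Finset.mul_sum]
  rw [mul_mul_mul_comm, mul_mul_mul_comm √(1 - t), h1, h2, h3]
  ring

lemma covCond_one_two (ht : t ∈ Set.Icc (0 : ℝ) 1) :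
    CovCond (coefOne N β t) (coefTwo N β t) (β ^ 2 * t / N) := fun φ => by
  have h1 := Real.mul_self_sqrt ht.1
  have h3 : β / √(N : ℝ) * (β / √(N : ℝ)) = β ^ 2 / N := by
    rw [div_mul_div_comm, Real.mul_self_sqrt (Nat.cast_nonneg _), sq]
  simp only [Fintype.sum_sum_type, coefOne, coefTwo, prj, Sum.elim_inl, Sum.elim_inr, id, zero_mul,
    mul_zero, Finset.sum_const_zero, add_zero, ← Finset.mul_sum, mul_mul_mul_comm, h1, h3]
  ring

lemma sum_mul_bond (g : Fin N × Fin N → ℝ) (σ : Config N) :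
    ∑ p ∈ Finset.univ.filter (fun p : Fin N × Fin N => p.1 < p.2),
      g p * spin (σ p.1) * spin (σ p.2) = ∑ p, bond p σ * g p := by
  rw [Finset.sum_filter]
  refine Finset.sum_congr rfl fun p _ => ?_
  unfold bond
  split_ifs <;> ring

lemma hamT_eq_one (ω : Dis N → ℝ) (σ : Config N) :
    hamT N β t (fun p => ω (.inl p)) (fun p => ω (.inr (.inl p))) σ =
      disW (coefOne N β t) σ ⬝ᵥ ω := by
  simp only [hamT, ham, sum_mul_bond]
  simp only [dotProduct, Fintype.sum_sum_type, disW, coefOne, prj,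
    Sum.elim_inl, Sum.elim_inr, id, zero_mul, Finset.sum_const_zero, add_zero, mul_assoc,
    ← Finset.mul_sum]

lemma hamT_eq_two (ω : Dis N → ℝ) (σ : Config N) :
    hamT N β t (fun p => ω (.inl p)) (fun p => ω (.inr (.inr p))) σ =
      disW (coefTwo N β t) σ ⬝ᵥ ω := by
  simp only [hamT, ham, sum_mul_bond]
  simp only [dotProduct, Fintype.sum_sum_type, disW, coefTwo, prj,
    Sum.elim_inl, Sum.elim_inr, id, zero_mul, Finset.sum_const_zero, zero_add, mul_assoc,
    ← Finset.mul_sum]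

lemma gibbsT_eq (ω : Dis N → ℝ) (f : Config N × Config N → ℝ) :
    gibbsT N β t (fun p => ω (.inl p)) (fun p => ω (.inr (.inl p)))
      (fun p => ω (.inr (.inr p))) f =
    ev (gw (disW (coefOne N β t)) ω) fun σ => ev (gw (disW (coefTwo N β t)) ω) fun τ =>
      f (σ, τ) := by
  simp only [gibbsT, wT, hamT_eq_one, hamT_eq_two, ev_gw, Fintype.sum_prod_type, Real.exp_add]
  simp only [← Finset.mul_sum, ← Finset.sum_mul, mul_div_assoc', ← Finset.sum_div]
  rw [div_div, mul_comm (∑ σ, rexp (disW (coefTwo N β t) σ ⬝ᵥ ω))]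
  congr 1
  refine Finset.sum_congr rfl fun σ _ => ?_
  rw [Finset.mul_sum]
  exact Finset.sum_congr rfl fun τ _ => by ring

lemma EgibbsT_eq_gE (f : Config N × Config N → ℝ) :
    EgibbsT N β t f = gE (disW (coefOne N β t)) (disW (coefTwo N β t)) fun σ τ => f (σ, τ) := by
  have m1 := measurePreserving_sumPiEquivProdPi (X := fun _ : Dis N => ℝ)
    fun _ => gaussianReal 0 1
  have m2 := measurePreserving_sumPiEquivProdPi
    (X := fun _ : (Fin N × Fin N) ⊕ (Fin N × Fin N) => ℝ) fun _ => gaussianReal 0 1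
  have m3 := ((MeasurePreserving.id (gaussPi N)).prod m2).comp m1
  have e3 : MeasurableEmbedding (Prod.map (id : (Fin N × Fin N → ℝ) → _)
      (MeasurableEquiv.sumPiEquivProdPi fun _ : (Fin N × Fin N) ⊕ (Fin N × Fin N) => ℝ) ∘
        MeasurableEquiv.sumPiEquivProdPi fun _ : Dis N => ℝ) :=
    (((MeasurableEquiv.refl _).prodCongr (MeasurableEquiv.sumPiEquivProdPi _)).measurableEmbedding).comp
      (MeasurableEquiv.measurableEmbedding _)
  refine (m3.integral_comp e3 fun ω => gibbsT N β t ω.1 ω.2.1 ω.2.2 f).symm.trans ?_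
  exact integral_congr_ae (Filter.Eventually.of_forall fun ω => gibbsT_eq ω f)

end Link

/-! ### Tail bound for the two-replica measure from a second moment estimate -/

section Tail

variable {S K : Type*} [Fintype S] [Fintype K] [Nonempty S]

lemma gaussian_integral_mul_le_one {f g : (K → ℝ) → ℝ} (hf : ExpBdd f) (hg : ExpBdd g)
    (hf0 : ∀ x, 0 ≤ f x) (hg0 : ∀ x, 0 ≤ g x)
    (hfg : ∀ x y, f x * g y ≤ rexp (∑ k, (x k - y k) ^ 2 / 4)) :
    (∫ x, f x ∂stdGauss K) * ∫ x, g x ∂stdGauss K ≤ 1 := by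
  classical
  have h := gaussian_lintegral_mul_le_one (f := fun x => ENNReal.ofReal (f x))
    (g := fun x => ENNReal.ofReal (g x)) hf.1.measurable.ennreal_ofReal
    hg.1.measurable.ennreal_ofReal fun x y => by
      rw [← ENNReal.ofReal_mul (hf0 x)]
      exact ENNReal.ofReal_le_ofReal (hfg x y)
  change (∫⁻ x, ENNReal.ofReal (f x) ∂stdGauss K) * (∫⁻ x, ENNReal.ofReal (g x) ∂stdGauss K) ≤ 1
    at h
  rw [← ofReal_integral_eq_lintegral_ofReal hf.integrable (Filter.Eventually.of_forall hf0),
    ← ofReal_integral_eq_lintegral_ofReal hg.integrable (Filter.Eventually.of_forall hg0),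
    ← ENNReal.ofReal_mul (integral_nonneg hf0)] at h
  exact ENNReal.ofReal_le_one.1 h

lemma exp_ev_le {p : S → ℝ} (hp : ∀ s, 0 ≤ p s) (hp1 : ∑ s, p s = 1) (f : S → ℝ) :
    rexp (ev p f) ≤ ev p fun s => rexp (f s) := by
  have := convexOn_exp.map_sum_le (t := Finset.univ) (w := p) (p := f) (fun s _ => hp s) hp1
    fun _ _ => Set.mem_univ _
  simpa [ev] using this

/-- The partition function of `w`, normalized to have mean one when `w s ⬝ᵥ w s = A`. -/
def nz (w : S → K → ℝ) (A : ℝ) (ω : K → ℝ) : ℝ :=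
  (∑ s, rexp (w s ⬝ᵥ ω)) / (Fintype.card S * rexp (A / 2))

variable {w : S → K → ℝ} {A : ℝ}

lemma nz_pos (w : S → K → ℝ) (A : ℝ) (ω : K → ℝ) : 0 < nz w A ω := by
  have := sum_exp_pos w ω
  have : 0 < Fintype.card S := Fintype.card_pos
  unfold nz; positivity

lemma ExpBdd.nz (w : S → K → ℝ) (A : ℝ) : ExpBdd (nz w A) := by
  have := (ExpBdd.sum Finset.univ fun s => ExpBdd.exp_dot (w s)).mul
    (ExpBdd.const (K := K) ((Fintype.card S : ℝ) * rexp (A / 2))⁻¹)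
  exact this

lemma integral_nz (hA : ∀ s, w s ⬝ᵥ w s = A) : ∫ ω, nz w A ω ∂stdGauss K = 1 := by
  have : 0 < Fintype.card S := Fintype.card_pos
  simp only [nz, integral_div]
  rw [integral_finsetSum _ fun s _ => (ExpBdd.exp_dot (w s)).integrable]
  simp only [integral_exp_dot, hA, Finset.sum_const, Finset.card_univ, nsmul_eq_mul]
  exact div_self (by positivity)

lemma nz_sq_mul_gibbs (w : S → K → ℝ) (A : ℝ) (χ : S → S → ℝ) (ω : K → ℝ) :
    nz w A ω ^ 2 * (ev (gw w ω) fun s => ev (gw w ω) fun t => χ s t) =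
      ((Fintype.card S : ℝ) ^ 2 * rexp A)⁻¹ * ∑ s, ∑ t, χ s t * rexp ((w s + w t) ⬝ᵥ ω) := by
  have hc : 0 < Fintype.card S := Fintype.card_pos
  have hz := sum_exp_pos w ω
  have e : rexp A = rexp (A / 2) ^ 2 := by rw [← Real.exp_nat_mul]; congr 1; push_cast; ring
  have e2 : ∑ s, ∑ t, χ s t * rexp ((w s + w t) ⬝ᵥ ω) =
      ∑ s, rexp (w s ⬝ᵥ ω) * ∑ t, rexp (w t ⬝ᵥ ω) * χ s t := by
    refine Finset.sum_congr rfl fun s _ => ?_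
    rw [Finset.mul_sum]
    refine Finset.sum_congr rfl fun t _ => ?_
    rw [add_dotProduct, Real.exp_add]; ring
  simp only [ev_gw, mul_div_assoc', ← Finset.sum_div]
  rw [e2, nz, e]
  field_simp

lemma integral_nz_sq_mul_gibbs (hA : ∀ s, w s ⬝ᵥ w s = A) (χ : S → S → ℝ) :
    ∫ ω, nz w A ω ^ 2 * (ev (gw w ω) fun s => ev (gw w ω) fun t => χ s t) ∂stdGauss K =
      ((Fintype.card S : ℝ) ^ 2)⁻¹ * ∑ s, ∑ t, χ s t * rexp (w s ⬝ᵥ w t) := by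
  simp only [nz_sq_mul_gibbs]
  rw [integral_const_mul, integral_finsetSum _ fun s _ => (ExpBdd.sum Finset.univ fun t =>
    (ExpBdd.const (χ s t)).mul (ExpBdd.exp_dot (w s + w t))).integrable, mul_inv, mul_assoc]
  congr 1
  rw [Finset.mul_sum]
  refine Finset.sum_congr rfl fun s _ => ?_
  rw [integral_finsetSum _ fun t _ =>
    ((ExpBdd.const (χ s t)).mul (ExpBdd.exp_dot (w s + w t))).integrable, Finset.mul_sum]
  refine Finset.sum_congr rfl fun t _ => ?_
  rw [integral_const_mul, integral_exp_dot, mul_left_comm, ← Real.exp_neg, ← Real.exp_add]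
  congr 2
  simp only [add_dotProduct, dotProduct_add, hA, dotProduct_comm (w t) (w s)]
  ring

lemma continuous_nz (w : S → K → ℝ) (A : ℝ) : Continuous (nz w A) := (ExpBdd.nz w A).1

lemma ExpBdd.nz_rpow_neg (w : S → K → ℝ) (A : ℝ) {κ : ℝ} (hκ : 0 ≤ κ) :
    ExpBdd fun ω => _root_.nz w A ω ^ (-κ) := by
  obtain ⟨s⟩ := ‹Nonempty S›
  have hc : 0 < Fintype.card S := Fintype.card_pos_iff.2 ⟨s⟩
  have : Nonempty S := ⟨s⟩
  refine ExpBdd.of_le ((continuous_nz w A).rpow_const fun ω => Or.inl (nz_pos w A ω).ne')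
    ((ExpBdd.exp_dot ((-κ) • w s)).mul
      (ExpBdd.const (((Fintype.card S : ℝ) * rexp (A / 2))⁻¹ ^ (-κ)))) fun ω => ?_
  rw [abs_of_pos (Real.rpow_pos_of_pos (nz_pos w A ω) _), abs_of_pos (by positivity)]
  have h1 : rexp (w s ⬝ᵥ ω) * ((Fintype.card S : ℝ) * rexp (A / 2))⁻¹ ≤ _root_.nz w A ω := by
    unfold _root_.nz
    rw [div_eq_mul_inv]
    refine mul_le_mul_of_nonneg_right ?_ (by positivity)
    exact Finset.single_le_sum (f := fun s => rexp (w s ⬝ᵥ ω)) (fun t _ => Real.exp_nonneg _)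
      (Finset.mem_univ s)
  refine (Real.rpow_le_rpow_of_nonpos (by positivity) h1 (neg_nonpos.2 hκ)).trans_eq ?_
  rw [Real.mul_rpow (Real.exp_nonneg _) (by positivity), ← Real.exp_mul, smul_dotProduct,
    smul_eq_mul, mul_comm (-κ)]

lemma ExpBdd.nz_rpow (w : S → K → ℝ) (A : ℝ) {κ : ℝ} (hκ : 0 ≤ κ) (hκ1 : κ ≤ 1) :
    ExpBdd fun ω => _root_.nz w A ω ^ κ := by
  refine ExpBdd.of_le ((continuous_nz w A).rpow_const fun ω => Or.inl (nz_pos w A ω).ne')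
    ((ExpBdd.const 1).add (ExpBdd.nz w A)) fun ω => ?_
  have h0 := nz_pos w A ω
  rw [abs_of_pos (Real.rpow_pos_of_pos h0 _), abs_of_pos (by positivity)]
  rcases le_total (_root_.nz w A ω) 1 with h | h
  · linarith [Real.rpow_le_one h0.le h hκ]
  · linarith [Real.rpow_le_self_of_one_le h hκ1]

lemma nz_div_nz_le (w : S → K → ℝ) (A : ℝ) (x y : K → ℝ) :
    nz w A x / nz w A y ≤ rexp (ev (gw w x) fun s => w s ⬝ᵥ (x - y)) := by
  have hc : 0 < Fintype.card S := Fintype.card_pos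
  have hx := sum_exp_pos w x
  have h := exp_ev_le (gw_nonneg w x) (sum_gw w x) fun s => -(w s ⬝ᵥ (x - y))
  have e : (ev (gw w x) fun s => rexp (-(w s ⬝ᵥ (x - y)))) = nz w A y / nz w A x := by
    rw [ev_gw, nz, nz, div_div_div_cancel_right₀ (by positivity)]
    congr 1
    refine Finset.sum_congr rfl fun s _ => ?_
    rw [← Real.exp_add, dotProduct_sub]
    congr 1; ring
  have e2 : (ev (gw w x) fun s => -(w s ⬝ᵥ (x - y))) = -ev (gw w x) fun s => w s ⬝ᵥ (x - y) := by
    simp only [ev, mul_neg, Finset.sum_neg_distrib]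
  rw [e, e2, Real.exp_neg] at h
  rw [← inv_div]
  exact inv_le_of_inv_le₀ (Real.exp_pos _) h

lemma ev_dot_le {p : S → ℝ} {q : S → S → ℝ} (hp : ∀ s, 0 ≤ p s)
    (hq : ∀ s t, w s ⬝ᵥ w t ≤ q s t) (κ : ℝ) (z : K → ℝ) :
    κ * (ev p fun s => w s ⬝ᵥ z) ≤
      κ ^ 2 * (ev p fun s => ev p fun t => q s t) + ∑ k, z k ^ 2 / 4 := by
  set b : K → ℝ := fun k => ev p fun s => w s k
  have e1 : (ev p fun s => w s ⬝ᵥ z) = ∑ k, b k * z k := by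
    simp only [ev, dotProduct, b, Finset.mul_sum, Finset.sum_mul]
    rw [Finset.sum_comm]
    exact Finset.sum_congr rfl fun _ _ => Finset.sum_congr rfl fun _ _ => by ring
  have e2 : ∑ k, b k ^ 2 = ev p fun s => ev p fun t => w s ⬝ᵥ w t := by
    simp only [sq, b]
    simp only [ev, dotProduct, Finset.mul_sum, Finset.sum_mul]
    rw [Finset.sum_comm]
    refine Finset.sum_congr rfl fun s _ => ?_
    rw [Finset.sum_comm]
    exact Finset.sum_congr rfl fun t _ => Finset.sum_congr rfl fun _ _ => by ring
  have e3 : ∑ k, b k ^ 2 ≤ ev p fun s => ev p fun t => q s t := by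
    rw [e2]; exact ev_mono hp fun s => ev_mono hp fun t => hq s t
  have e4 : κ * ∑ k, b k * z k ≤ κ ^ 2 * ∑ k, b k ^ 2 + ∑ k, z k ^ 2 / 4 := by
    rw [Finset.mul_sum, Finset.mul_sum, ← Finset.sum_add_distrib]
    exact Finset.sum_le_sum fun k _ => by nlinarith [sq_nonneg (κ * b k - z k / 2)]
  rw [e1]
  nlinarith [mul_le_mul_of_nonneg_left e3 (sq_nonneg κ)]

lemma rpow_div_ge {z E κ θ : ℝ} (hz : 0 < z) (hE : 1 ≤ E) (hκ : 0 ≤ κ) (hκ1 : κ ≤ 1 / 2)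
    (hθ : 0 < θ) (hθ1 : θ ≤ 1) : θ * z - θ ^ 2 * (z ^ 2 * E ^ 2) ≤ z ^ κ / E := by
  have hE0 : 0 < E := by linarith
  have hh : 0 < θ * z := by positivity
  rcases le_total 1 (θ * z * E ^ 2) with h | h
  · have : 0 ≤ z ^ κ / E := by positivity
    nlinarith [mul_le_mul_of_nonneg_left h hh.le]
  · have h1 : θ * z ≤ 1 := by nlinarith [one_le_pow₀ hE (n := 2)]
    have h2 : (θ * z) ^ (1 / 2 : ℝ) ≤ z ^ κ :=
      (Real.rpow_le_rpow_of_exponent_ge hh h1 hκ1).trans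
        (Real.rpow_le_rpow hh.le (mul_le_of_le_one_left hz.le hθ1) hκ)
    rw [← Real.sqrt_eq_rpow] at h2
    have h3 : √(θ * z) * E ≤ 1 := by
      refine abs_le_of_sq_le_sq' ?_ zero_le_one |>.2
      rw [mul_pow, Real.sq_sqrt hh.le]; simpa using h
    have h4 : θ * z ≤ z ^ κ / E := by
      rw [le_div_iff₀ hE0]
      have := Real.mul_self_sqrt hh.le
      nlinarith [Real.sqrt_nonneg (θ * z)]
    nlinarith [sq_nonneg (θ * (z * E))]

lemma integral_nz_rpow_neg_le (hA : ∀ s, w s ⬝ᵥ w s = A) {q : S → S → ℝ}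
    (hq0 : ∀ s t, 0 ≤ q s t) (hq : ∀ s t, w s ⬝ᵥ w t ≤ q s t) {κ W : ℝ} (hκ : 0 ≤ κ)
    (hκ1 : κ ≤ 1 / 2) (hW : 1 ≤ W)
    (hS : ∑ s, ∑ t, rexp (w s ⬝ᵥ w t + 2 * κ ^ 2 * q s t) ≤ (Fintype.card S : ℝ) ^ 2 * W) :
    ∫ ω, nz w A ω ^ (-κ) ∂stdGauss K ≤ 4 * W := by
  have hc : 0 < Fintype.card S := Fintype.card_pos
  set Y : (K → ℝ) → ℝ := fun ω => ev (gw w ω) fun s => ev (gw w ω) fun t => q s t with hY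
  have hYc : ExpBdd Y := ExpBdd.gibbs w fun _ => ExpBdd.gibbs w fun _ => ExpBdd.const _
  have hY0 : ∀ ω, 0 ≤ Y ω := fun ω =>
    ev_nonneg (gw_nonneg _ _) fun s => ev_nonneg (gw_nonneg _ _) fun t => hq0 s t
  set f : (K → ℝ) → ℝ := fun ω => nz w A ω ^ κ * rexp (-(κ ^ 2 * Y ω)) with hf
  have bf : ExpBdd f := (ExpBdd.nz_rpow w A hκ (by linarith)).mul <|
    ExpBdd.of_le (by have := hYc.1; fun_prop) (ExpBdd.const 1) fun ω => by
      rw [abs_one, abs_of_pos (Real.exp_pos _), Real.exp_le_one_iff]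
      have := hY0 ω
      have : 0 ≤ κ ^ 2 * Y ω := by positivity
      linarith
  have bg := ExpBdd.nz_rpow_neg w A hκ
  have f0 : ∀ ω, 0 ≤ f ω := fun ω =>
    mul_nonneg (Real.rpow_nonneg (nz_pos _ _ _).le _) (Real.exp_nonneg _)
  have g0 : ∀ ω, 0 ≤ nz w A ω ^ (-κ) := fun ω => Real.rpow_nonneg (nz_pos _ _ _).le _
  have key := gaussian_integral_mul_le_one bf bg f0 g0 fun x y => by
    have hx := nz_pos w A x
    have hy := nz_pos w A y
    have h1 : nz w A x ^ κ * nz w A y ^ (-κ) ≤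
        rexp (κ * ev (gw w x) fun s => w s ⬝ᵥ (x - y)) := by
      rw [Real.rpow_neg hy.le, ← div_eq_mul_inv, ← Real.div_rpow hx.le hy.le, mul_comm κ,
        Real.exp_mul]
      exact Real.rpow_le_rpow (by positivity) (nz_div_nz_le w A x y) hκ
    have h2 := ev_dot_le (gw_nonneg w x) hq κ (x - y)
    calc f x * nz w A y ^ (-κ)
        = nz w A x ^ κ * nz w A y ^ (-κ) * rexp (-(κ ^ 2 * Y x)) := by rw [hf]; ring
      _ ≤ rexp (κ * ev (gw w x) fun s => w s ⬝ᵥ (x - y)) * rexp (-(κ ^ 2 * Y x)) := by gcongr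
      _ ≤ rexp (∑ k, (x k - y k) ^ 2 / 4) := by
        rw [← Real.exp_add, Real.exp_le_exp]
        simp only [Pi.sub_apply] at h2
        linarith
  set θ := 1 / (2 * W) with hθ
  have hθ0 : 0 < θ := by positivity
  have hθ1 : θ ≤ 1 := by rw [hθ, div_le_one (by positivity)]; linarith
  have bsec : ExpBdd fun ω => nz w A ω ^ 2 *
      (ev (gw w ω) fun s => ev (gw w ω) fun t => rexp (2 * κ ^ 2 * q s t)) :=
    ((ExpBdd.nz w A).pow 2).mul (ExpBdd.gibbs w fun _ => ExpBdd.gibbs w fun _ => ExpBdd.const _)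
  have low : θ - θ ^ 2 * W ≤ ∫ ω, f ω ∂stdGauss K := by
    have h1 : ∫ ω, θ * nz w A ω - θ ^ 2 * (nz w A ω ^ 2 *
        (ev (gw w ω) fun s => ev (gw w ω) fun t => rexp (2 * κ ^ 2 * q s t))) ∂stdGauss K ≤
        ∫ ω, f ω ∂stdGauss K := by
      refine integral_mono (((ExpBdd.nz w A).integrable.const_mul θ).sub
        (bsec.integrable.const_mul _)) bf.integrable fun ω => ?_
      have hz := nz_pos w A ω
      have hE : 1 ≤ rexp (κ ^ 2 * Y ω) := by
        have := hY0 ω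
        rw [Real.one_le_exp_iff]; positivity
      have h2 := rpow_div_ge hz hE hκ hκ1 hθ0 hθ1
      have h3 : rexp (κ ^ 2 * Y ω) ^ 2 ≤
          ev (gw w ω) fun s => ev (gw w ω) fun t => rexp (2 * κ ^ 2 * q s t) := by
        have e : rexp (κ ^ 2 * Y ω) ^ 2 =
            rexp (ev (gw w ω) fun s => ev (gw w ω) fun t => 2 * κ ^ 2 * q s t) := by
          rw [← Real.exp_nat_mul]
          congr 1
          simp only [ev_mul_left, hY]; push_cast; ring
        rw [e]
        refine (exp_ev_le (gw_nonneg w ω) (sum_gw w ω) _).trans ?_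
        exact ev_mono (gw_nonneg w ω) fun s => exp_ev_le (gw_nonneg w ω) (sum_gw w ω) _
      have h4 := mul_le_mul_of_nonneg_left (mul_le_mul_of_nonneg_left h3 (sq_nonneg (nz w A ω)))
        (sq_nonneg θ)
      have e5 : f ω = nz w A ω ^ κ / rexp (κ ^ 2 * Y ω) := by
        simp only [hf]; rw [Real.exp_neg, div_eq_mul_inv]
      simp only [e5]
      linarith
    rw [integral_sub ((ExpBdd.nz w A).integrable.const_mul θ) (bsec.integrable.const_mul _),
      integral_const_mul, integral_const_mul, integral_nz hA, integral_nz_sq_mul_gibbs hA] at h1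
    have h6 : ((Fintype.card S : ℝ) ^ 2)⁻¹ *
        ∑ s, ∑ t, rexp (2 * κ ^ 2 * q s t) * rexp (w s ⬝ᵥ w t) ≤ W := by
      rw [inv_mul_le_iff₀ (by positivity)]
      refine le_trans (le_of_eq ?_) hS
      exact Finset.sum_congr rfl fun s _ => Finset.sum_congr rfl fun t _ => by
        rw [← Real.exp_add, add_comm]
    have := mul_le_mul_of_nonneg_left h6 (sq_nonneg θ)
    linarith
  have low' : 1 / (4 * W) ≤ ∫ ω, f ω ∂stdGauss K := by
    refine le_trans (le_of_eq ?_) low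
    rw [hθ]; field_simp; norm_num
  have hG : 0 ≤ ∫ ω, nz w A ω ^ (-κ) ∂stdGauss K := integral_nonneg g0
  have := (mul_le_mul_of_nonneg_right low' hG).trans key
  rwa [one_div, inv_mul_le_iff₀ (by positivity), mul_one] at this

/-- Two-replica tail bound. -/
lemma gE_tail_le (hA : ∀ s, w s ⬝ᵥ w s = A) {q : S → S → ℝ}
    (hq0 : ∀ s t, 0 ≤ q s t) (hq : ∀ s t, w s ⬝ᵥ w t ≤ q s t) {κ W : ℝ} (hκ : 0 ≤ κ)
    (hκ1 : κ ≤ 1 / 2) (hW : 1 ≤ W)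
    (hS : ∑ s, ∑ t, rexp (w s ⬝ᵥ w t + 2 * κ ^ 2 * q s t) ≤ (Fintype.card S : ℝ) ^ 2 * W)
    {χ : S → S → ℝ} {u : ℝ} (hχ0 : ∀ s t, 0 ≤ χ s t) (hχ1 : ∀ s t, χ s t ≤ 1)
    (hχ : ∀ s t, χ s t ≤ rexp (2 * κ ^ 2 * q s t - 4 * u)) :
    gE w w χ ≤ W * rexp (-(2 * u)) + 4 * W * rexp (-(κ * u)) := by
  have hc : 0 < Fintype.card S := Fintype.card_pos
  have bsec : ExpBdd fun ω => nz w A ω ^ 2 *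
      (ev (gw w ω) fun s => ev (gw w ω) fun t => χ s t) :=
    ((ExpBdd.nz w A).pow 2).mul (ExpBdd.gibbs w fun _ => ExpBdd.gibbs w fun _ => ExpBdd.const _)
  have bneg := ExpBdd.nz_rpow_neg w A hκ
  have h1 : gE w w χ ≤ ∫ ω, rexp (2 * u) * (nz w A ω ^ 2 *
      (ev (gw w ω) fun s => ev (gw w ω) fun t => χ s t)) +
      rexp (-(κ * u)) * nz w A ω ^ (-κ) ∂stdGauss K := by
    refine integral_mono (gibbs_integrable w w χ) ((bsec.integrable.const_mul _).add
      (bneg.integrable.const_mul _)) fun ω => ?_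
    have hz := nz_pos w A ω
    have t0 : 0 ≤ ev (gw w ω) fun s => ev (gw w ω) fun t => χ s t :=
      ev_nonneg (gw_nonneg _ _) fun s => ev_nonneg (gw_nonneg _ _) fun t => hχ0 s t
    have t1 : (ev (gw w ω) fun s => ev (gw w ω) fun t => χ s t) ≤ 1 := by
      refine (ev_mono (gw_nonneg _ _) fun s => (ev_mono (gw_nonneg _ _) fun t => hχ1 s t)).trans ?_
      simp only [ev_const (sum_gw w ω), le_refl]
    have r0 : 0 ≤ nz w A ω ^ (-κ) := Real.rpow_nonneg hz.le _
    set t := ev (gw w ω) fun s => ev (gw w ω) fun t => χ s t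
    change t ≤ rexp (2 * u) * (nz w A ω ^ 2 * t) + rexp (-(κ * u)) * nz w A ω ^ (-κ)
    rcases le_total (rexp (-u)) (nz w A ω) with h | h
    · have h2 : 1 ≤ rexp (2 * u) * nz w A ω ^ 2 := by
        calc 1 = rexp (2 * u) * rexp (-u) ^ 2 := by
              rw [← Real.exp_nat_mul, ← Real.exp_add]; norm_num
          _ ≤ _ := by gcongr
      have h3 := mul_le_mul_of_nonneg_right h2 t0
      have : 0 ≤ rexp (-(κ * u)) * nz w A ω ^ (-κ) := by positivity
      linarith
    · have h2 : 1 ≤ rexp (-(κ * u)) * nz w A ω ^ (-κ) := by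
        calc 1 = rexp (-(κ * u)) * rexp (-u) ^ (-κ) := by
              rw [← Real.exp_mul, ← Real.exp_add]; ring_nf; simp
          _ ≤ _ := mul_le_mul_of_nonneg_left
            (Real.rpow_le_rpow_of_nonpos hz h (neg_nonpos.2 hκ)) (Real.exp_nonneg _)
      have : 0 ≤ rexp (2 * u) * (nz w A ω ^ 2 * t) := by positivity
      linarith
  rw [integral_add (bsec.integrable.const_mul _) (bneg.integrable.const_mul _),
    integral_const_mul, integral_const_mul, integral_nz_sq_mul_gibbs hA] at h1
  have h2 := integral_nz_rpow_neg_le hA hq0 hq hκ hκ1 hW hS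
  have h3 : ((Fintype.card S : ℝ) ^ 2)⁻¹ * ∑ s, ∑ t, χ s t * rexp (w s ⬝ᵥ w t) ≤
      rexp (-(4 * u)) * W := by
    rw [inv_mul_le_iff₀ (by positivity), mul_left_comm]
    refine le_trans ?_ (mul_le_mul_of_nonneg_left hS (Real.exp_nonneg _))
    simp only [Finset.mul_sum]
    refine Finset.sum_le_sum fun s _ => Finset.sum_le_sum fun t _ => ?_
    rw [← Real.exp_add]
    refine (mul_le_mul_of_nonneg_right (hχ s t) (Real.exp_nonneg _)).trans_eq ?_
    rw [← Real.exp_add]; congr 1; ring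
  have h4 := mul_le_mul_of_nonneg_left h3 (Real.exp_nonneg (2 * u))
  have h5 := mul_le_mul_of_nonneg_left h2 (Real.exp_nonneg (-(κ * u)))
  have e : rexp (2 * u) * (rexp (-(4 * u)) * W) = W * rexp (-(2 * u)) := by
    rw [← mul_assoc, ← Real.exp_add, mul_comm]; congr 2; ring
  linarith

end Tail

/-! ### Exponential moments and tails of the overlap -/

section SKTail

variable {N : ℕ}

lemma integral_exp_mul_std (s : ℝ) : ∫ z, rexp (s * z) ∂gaussianReal 0 1 = rexp (s ^ 2 / 2) := by
  have h := congrFun (mgf_id_gaussianReal (μ := 0) (v := 1)) s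
  simpa [mgf] using h

lemma gaussianReal_exp_sq {μ : ℝ} (hμ : μ < 1) :
    Integrable (fun z => rexp (μ * z ^ 2 / 2)) (gaussianReal 0 1) ∧
      ∫ z, rexp (μ * z ^ 2 / 2) ∂gaussianReal 0 1 = (√(1 - μ))⁻¹ := by
  have hb : 0 < (1 - μ) / 2 := by linarith
  have e : ∀ z : ℝ, gaussianPDFReal 0 1 z * rexp (μ * z ^ 2 / 2) =
      (√(2 * π))⁻¹ * rexp (-((1 - μ) / 2) * z ^ 2) := by
    intro z
    rw [gaussianPDFReal_def]
    simp only [NNReal.coe_one, mul_one, sub_zero]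
    rw [mul_assoc, ← Real.exp_add]
    congr 2; ring
  constructor
  · rw [gaussianReal_of_var_ne_zero 0 one_ne_zero,
      integrable_withDensity_iff_integrable_smul' (measurable_gaussianPDF 0 1)
        (Eventually.of_forall fun _ => gaussianPDF_lt_top)]
    simp only [toReal_gaussianPDF, smul_eq_mul, e]
    exact (integrable_exp_neg_mul_sq hb).const_mul _
  · rw [integral_gaussianReal_eq_integral_smul one_ne_zero]
    simp only [smul_eq_mul, e]
    rw [integral_const_mul, integral_gaussian, ← Real.sqrt_inv, ← Real.sqrt_inv,
      ← Real.sqrt_mul (by positivity)]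
    congr 1
    have : 1 - μ ≠ 0 := by linarith
    field_simp

lemma sum_exp_config (a : ℝ) (σ : Config N) :
    ∑ τ : Config N, rexp (a * ∑ j, spin (σ j) * spin (τ j)) = (2 * Real.cosh a) ^ N := by
  have h1 : ∀ τ : Config N, rexp (a * ∑ j, spin (σ j) * spin (τ j)) =
      ∏ j, rexp (a * (spin (σ j) * spin (τ j))) := fun τ => by
    rw [Finset.mul_sum, Real.exp_sum]
  simp only [h1]
  have h2 := Finset.prod_univ_sum (fun _ : Fin N => (Finset.univ : Finset Bool))
    (fun j b => rexp (a * (spin (σ j) * spin b)))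
  rw [Fintype.piFinset_univ] at h2
  rw [← h2]
  have h3 : ∀ j, ∑ b : Bool, rexp (a * (spin (σ j) * spin b)) = 2 * Real.cosh a := fun j => by
    rw [Real.cosh_eq]
    cases σ j <;> simp [spin] <;> ring
  simp only [h3, Finset.prod_const, Finset.card_univ, Fintype.card_fin]

lemma sum_exp_ovlp_sq_le (hN : 1 ≤ N) {μ : ℝ} (hμ0 : 0 ≤ μ) (hμ : μ < 1) :
    ∑ σ : Config N, ∑ τ : Config N, rexp (μ * (N * ovlp N σ τ ^ 2) / 2) ≤
      (Fintype.card (Config N) : ℝ) ^ 2 * (√(1 - μ))⁻¹ := by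
  have hN0 : (0 : ℝ) < N := by exact_mod_cast hN
  obtain ⟨hintg, hval⟩ := gaussianReal_exp_sq hμ
  have hcard : (Fintype.card (Config N) : ℝ) = 2 ^ N := by simp
  have e : ∀ σ τ : Config N, rexp (μ * (N * ovlp N σ τ ^ 2) / 2) =
      ∫ z, rexp (√(μ / N) * (∑ j, spin (σ j) * spin (τ j)) * z) ∂gaussianReal 0 1 := by
    intro σ τ
    rw [integral_exp_mul_std, mul_pow, Real.sq_sqrt (by positivity), ovlp]
    congr 1; field_simp
  have hτ : ∀ σ : Config N, ∑ τ : Config N, rexp (μ * (N * ovlp N σ τ ^ 2) / 2) ≤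
      2 ^ N * (√(1 - μ))⁻¹ := by
    intro σ
    simp only [e]
    have hi : ∀ τ : Config N, Integrable
        (fun z => rexp (√(μ / N) * (∑ j, spin (σ j) * spin (τ j)) * z)) (gaussianReal 0 1) :=
      fun τ => integrable_exp_mul_gaussianReal _
    rw [← integral_finsetSum _ fun τ _ => hi τ, ← hval, ← integral_const_mul]
    refine integral_mono (integrable_finsetSum _ fun τ _ => hi τ) (hintg.const_mul _) fun z => ?_
    have h1 : ∀ τ : Config N, rexp (√(μ / N) * (∑ j, spin (σ j) * spin (τ j)) * z) =
        rexp ((√(μ / N) * z) * ∑ j, spin (σ j) * spin (τ j)) := fun τ => by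
      congr 1; ring
    simp only [h1, sum_exp_config, mul_pow]
    refine mul_le_mul_of_nonneg_left ?_ (by positivity)
    refine (pow_le_pow_left₀ (Real.cosh_pos _).le (Real.cosh_le_exp_half_sq _) N).trans_eq ?_
    rw [← Real.exp_nat_mul, mul_pow, Real.sq_sqrt (by positivity)]
    congr 1; field_simp
  refine (Finset.sum_le_sum fun σ _ => hτ σ).trans_eq ?_
  rw [Finset.sum_const, Finset.card_univ, nsmul_eq_mul, hcard]
  ring

lemma sum_ordered_pairs (d : Fin N → ℝ) (hd : ∀ j, d j * d j = 1) :
    ∑ p : Fin N × Fin N, (if p.1 < p.2 then d p.1 * d p.2 else 0) =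
      ((∑ j, d j) ^ 2 - N) / 2 := by
  have h1 : ∀ a b : Fin N, d a * d b = (if a < b then d a * d b else 0) +
      (if b < a then d b * d a else 0) + if a = b then 1 else 0 := by
    intro a b
    rcases lt_trichotomy a b with h | h | h
    · simp [h, h.not_gt, h.ne]
    · subst h; simp [hd]
    · simp [h, h.not_gt, h.ne', mul_comm]
  have h2 : (∑ j, d j) ^ 2 = ∑ a, ∑ b, d a * d b := by
    rw [sq, Finset.sum_mul_sum]
  have h3 : ∑ a : Fin N, ∑ b : Fin N, (if b < a then d b * d a else 0) =
      ∑ a : Fin N, ∑ b : Fin N, if a < b then d a * d b else 0 := Finset.sum_comm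
  rw [h2, Fintype.sum_prod_type]
  have h4 : ∑ a, ∑ b, d a * d b = ∑ a, ∑ b, ((if a < b then d a * d b else 0) +
      (if b < a then d b * d a else 0) + if a = b then 1 else 0) :=
    Finset.sum_congr rfl fun a _ => Finset.sum_congr rfl fun b _ => h1 a b
  simp only [Finset.sum_add_distrib] at h4
  rw [h3] at h4
  rw [h4]
  simp

lemma dot_disW (hN : 1 ≤ N) {c c' : Dis N → ℝ} {v : ℝ} (h : CovCond c c' (v / N))
    (σ τ : Config N) :
    disW c σ ⬝ᵥ disW c' τ = v / 2 * (N * ovlp N σ τ ^ 2 - 1) := by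
  have hN0 : (0 : ℝ) < N := by exact_mod_cast hN
  have e : disW c σ ⬝ᵥ disW c' τ =
      ∑ k, c k * c' k * (fun p : Fin N × Fin N => if p.1 < p.2 then
        (spin (σ p.1) * spin (τ p.1)) * (spin (σ p.2) * spin (τ p.2)) else 0) (prj k) := by
    refine Finset.sum_congr rfl fun k _ => ?_
    simp only [disW, bond]
    split_ifs <;> ring
  rw [e, h (fun p : Fin N × Fin N => if p.1 < p.2 then
    (spin (σ p.1) * spin (τ p.1)) * (spin (σ p.2) * spin (τ p.2)) else 0), sum_ordered_pairs (fun j => spin (σ j) * spin (τ j)) fun j => by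
    rw [mul_mul_mul_comm, spin_mul_self, spin_mul_self, one_mul], ovlp]
  field_simp

lemma ovlp_self (hN : 1 ≤ N) (σ : Config N) : ovlp N σ σ = 1 := by
  have hN0 : (N : ℝ) ≠ 0 := by positivity
  simp [ovlp, spin_mul_self, hN0]

/-- The exponential overlap tail at distance `√δ` from the critical temperature. -/
lemma gE_ovlp_tail_exp (hN : 1 ≤ N) {c : Dis N → ℝ} {s ε : ℝ} (hs : 0 < s) (hs1 : s ≤ 1)
    (hε : 0 < ε) (h : CovCond c c ((1 - s ^ 2) / N)) :
    gE (disW c) (disW c) (fun σ τ => if ε * s ^ 2 < ovlp N σ τ ^ 2 then 1 else 0) ≤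
      10 / s * rexp (-(ε * N * s ^ 5 / 32)) := by
  have hN0 : (0 : ℝ) < N := by exact_mod_cast hN
  have hss : s ^ 2 ≤ 1 := pow_le_one₀ hs.le hs1
  set W : ℝ := (√(1 - (1 - s ^ 2 / 2)))⁻¹ with hWdef
  have hWs : W = √2 / s := by
    rw [hWdef, show 1 - (1 - s ^ 2 / 2) = s ^ 2 / 2 by ring, Real.sqrt_div (by positivity),
      Real.sqrt_sq hs.le, inv_div]
  have h2 : √2 ≤ 2 := by rw [Real.sqrt_le_left (by norm_num)]; norm_num
  have h21 : 1 ≤ √2 := by rw [Real.one_le_sqrt]; norm_num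
  have hW1 : 1 ≤ W := by rw [hWs, le_div_iff₀ hs]; linarith
  have key := gE_tail_le (w := disW c) (A := (1 - s ^ 2) / 2 * (N - 1))
    (fun σ => by rw [dot_disW hN h, ovlp_self hN]; ring)
    (q := fun σ τ => N * ovlp N σ τ ^ 2 / 2) (fun σ τ => by positivity)
    (fun σ τ => by
      rw [dot_disW hN h]
      have : 0 ≤ N * ovlp N σ τ ^ 2 := by positivity
      nlinarith [sq_nonneg s])
    (κ := s / 2) (W := W) (by positivity) (by linarith) hW1
    ((Finset.sum_le_sum fun σ _ => Finset.sum_le_sum fun τ _ => Real.exp_le_exp.2 (by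
      rw [dot_disW hN h]
      have : 0 ≤ N * ovlp N σ τ ^ 2 := by positivity
      nlinarith [sq_nonneg s])).trans (sum_exp_ovlp_sq_le hN (μ := 1 - s ^ 2 / 2)
        (by linarith) (by nlinarith)))
    (χ := fun σ τ => if ε * s ^ 2 < ovlp N σ τ ^ 2 then 1 else 0) (u := ε * N * s ^ 4 / 16)
    (fun σ τ => by split_ifs <;> norm_num) (fun σ τ => by split_ifs <;> norm_num)
    (fun σ τ => by
      split_ifs with hR
      · refine Real.one_le_exp ?_
        have : N * s ^ 2 * (ε * s ^ 2) ≤ N * s ^ 2 * ovlp N σ τ ^ 2 := by gcongr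
        nlinarith
      · positivity)
  refine key.trans ?_
  have e1 : rexp (-(2 * (ε * N * s ^ 4 / 16))) ≤ rexp (-(ε * N * s ^ 5 / 32)) := by
    refine Real.exp_le_exp.2 ?_
    have : ε * N * s ^ 4 * s ≤ ε * N * s ^ 4 * 1 := by gcongr
    have h0 : 0 ≤ ε * N * s ^ 4 := by positivity
    nlinarith
  have e2 : s / 2 * (ε * N * s ^ 4 / 16) = ε * N * s ^ 5 / 32 := by ring
  rw [e2]
  have hE := Real.exp_pos (-(ε * N * s ^ 5 / 32))
  have hW2 : W ≤ 2 / s := by rw [hWs]; gcongr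
  calc _ ≤ W * rexp (-(ε * N * s ^ 5 / 32)) + 4 * W * rexp (-(ε * N * s ^ 5 / 32)) := by gcongr
    _ = 5 * W * rexp (-(ε * N * s ^ 5 / 32)) := by ring
    _ ≤ 5 * (2 / s) * rexp (-(ε * N * s ^ 5 / 32)) := by gcongr
    _ = _ := by ring

/-- Large overlaps have probability `O(N⁻²)` up to the edge of the critical window. -/
lemma gE_ovlp_tail (hN : 1 ≤ N) {c : Dis N → ℝ} {s ε κ : ℝ} (hs : 0 < s) (hs1 : s ≤ 1)
    (hε : 0 < ε) (hκ : 0 < κ) (hsN : κ ≤ N * s ^ 6) (h : CovCond c c ((1 - s ^ 2) / N)) :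
    gE (disW c) (disW c) (fun σ τ => if ε * s ^ 2 < ovlp N σ τ ^ 2 then 1 else 0) ≤
      10 * (Nat.factorial 13 : ℝ) * (32 / ε) ^ 13 / κ ^ 11 / N ^ 2 := by
  have hN0 : (0 : ℝ) < N := by exact_mod_cast hN
  refine (gE_ovlp_tail_exp hN hs hs1 hε h).trans ?_
  have hx : 0 < ε * N * s ^ 5 / 32 := by positivity
  have h1 := Real.pow_div_factorial_le_exp _ hx.le 13
  have hF : (0 : ℝ) < Nat.factorial 13 := by exact_mod_cast Nat.factorial_pos 13
  have h2 : rexp (-(ε * N * s ^ 5 / 32)) ≤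
      (Nat.factorial 13 : ℝ) / (ε * N * s ^ 5 / 32) ^ 13 := by
    rw [Real.exp_neg]
    exact (inv_anti₀ (by positivity) h1).trans_eq (inv_div _ _)
  calc _ ≤ 10 / s * ((Nat.factorial 13 : ℝ) / (ε * N * s ^ 5 / 32) ^ 13) := by gcongr
    _ = 10 * (Nat.factorial 13 : ℝ) * (32 / ε) ^ 13 / (N * s ^ 6) ^ 11 / N ^ 2 := by
      generalize (Nat.factorial 13 : ℝ) = F
      field_simp
    _ ≤ _ := by gcongr

end SKTail

/-! ### Moments of the overlap -/

section Moments

variable {N : ℕ}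

lemma sum_affine_spins (hN : 1 ≤ N) (a b : ℝ) (σ τ : Config N) :
    ∑ i, (a + b * (spin (σ i) * spin (τ i))) = N * (a + b * ovlp N σ τ) := by
  have hN0 : (N : ℝ) ≠ 0 := by positivity
  rw [Finset.sum_add_distrib, ← Finset.mul_sum, ovlp]
  simp only [Finset.sum_const, Finset.card_univ, Fintype.card_fin, nsmul_eq_mul]
  field_simp

lemma spins_sq (i : Fin N) (σ τ : Config N) :
    (spin (σ i) * spin (τ i)) * (spin (σ i) * spin (τ i)) = 1 := by
  rw [mul_mul_mul_comm, spin_mul_self, spin_mul_self, one_mul]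

lemma covl_eq_ovlp (i : Fin N) (σ τ : Config N) :
    covl i σ τ = ovlp N σ τ - spin (σ i) * spin (τ i) * (N : ℝ)⁻¹ := by
  rw [ovlp_eq_covl i σ τ]; ring

lemma abs_ovlp_le (σ τ : Config N) : |ovlp N σ τ| ≤ 1 := by
  rcases Nat.eq_zero_or_pos N with rfl | h
  · simp [ovlp]
  · have hN : (0 : ℝ) < N := by exact_mod_cast h
    rw [ovlp, abs_div, abs_of_pos hN, div_le_one hN]
    refine (Finset.abs_sum_le_sum_abs _ _).trans ?_
    simp [abs_mul, abs_spin]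

lemma sum_spins_covl (hN : 1 ≤ N) (σ τ : Config N) :
    ∑ i, spin (σ i) * spin (τ i) * covl i σ τ = N * ovlp N σ τ ^ 2 - 1 := by
  have hN0 : (N : ℝ) ≠ 0 := by positivity
  have e : ∀ i, spin (σ i) * spin (τ i) * covl i σ τ =
      -(N : ℝ)⁻¹ + ovlp N σ τ * (spin (σ i) * spin (τ i)) := fun i => by
    rw [covl_eq_ovlp]
    linear_combination (-(N : ℝ)⁻¹) * spins_sq i σ τ
  simp only [e, sum_affine_spins hN]
  field_simp
  ring

lemma sum_covl_sq (hN : 1 ≤ N) (σ τ : Config N) :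
    ∑ i, covl i σ τ ^ 2 = N * ovlp N σ τ ^ 2 - 2 * ovlp N σ τ ^ 2 + (N : ℝ)⁻¹ := by
  have hN0 : (N : ℝ) ≠ 0 := by positivity
  have e : ∀ i, covl i σ τ ^ 2 = (ovlp N σ τ ^ 2 + (N : ℝ)⁻¹ ^ 2) +
      (-2 * ovlp N σ τ * (N : ℝ)⁻¹) * (spin (σ i) * spin (τ i)) := fun i => by
    rw [covl_eq_ovlp]
    linear_combination ((N : ℝ)⁻¹ ^ 2) * spins_sq i σ τ
  simp only [e, sum_affine_spins hN]
  field_simp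
  ring

lemma sum_spins_covl_cube (hN : 1 ≤ N) (σ τ : Config N) :
    ∑ i, spin (σ i) * spin (τ i) * covl i σ τ ^ 3 =
      N * ovlp N σ τ ^ 4 - 3 * ovlp N σ τ ^ 2 + 3 * ovlp N σ τ ^ 2 * (N : ℝ)⁻¹ -
        (N : ℝ)⁻¹ ^ 2 := by
  have hN0 : (N : ℝ) ≠ 0 := by positivity
  have e : ∀ i, spin (σ i) * spin (τ i) * covl i σ τ ^ 3 =
      (-3 * ovlp N σ τ ^ 2 * (N : ℝ)⁻¹ - (N : ℝ)⁻¹ ^ 3) +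
      (ovlp N σ τ ^ 3 + 3 * ovlp N σ τ * (N : ℝ)⁻¹ ^ 2) * (spin (σ i) * spin (τ i)) :=
    fun i => by
      rw [covl_eq_ovlp]
      have h := spins_sq i σ τ
      generalize spin (σ i) * spin (τ i) = d at *
      linear_combination (-3 * ovlp N σ τ ^ 2 * (N : ℝ)⁻¹ + 3 * ovlp N σ τ * (N : ℝ)⁻¹ ^ 2 * d -
        (N : ℝ)⁻¹ ^ 3 * (d * d + 1)) * h
  simp only [e, sum_affine_spins hN]
  field_simp
  ring

lemma sum_covl_four (hN : 1 ≤ N) (σ τ : Config N) :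
    ∑ i, covl i σ τ ^ 4 = N * ovlp N σ τ ^ 4 - 4 * ovlp N σ τ ^ 4 +
      6 * ovlp N σ τ ^ 2 * (N : ℝ)⁻¹ - 4 * ovlp N σ τ ^ 2 * (N : ℝ)⁻¹ ^ 2 + (N : ℝ)⁻¹ ^ 3 := by
  have hN0 : (N : ℝ) ≠ 0 := by positivity
  have e : ∀ i, covl i σ τ ^ 4 =
      (ovlp N σ τ ^ 4 + 6 * ovlp N σ τ ^ 2 * (N : ℝ)⁻¹ ^ 2 + (N : ℝ)⁻¹ ^ 4) +
      (-4 * ovlp N σ τ ^ 3 * (N : ℝ)⁻¹ - 4 * ovlp N σ τ * (N : ℝ)⁻¹ ^ 3) *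
        (spin (σ i) * spin (τ i)) :=
    fun i => by
      rw [covl_eq_ovlp]
      have h := spins_sq i σ τ
      generalize spin (σ i) * spin (τ i) = d at *
      linear_combination (6 * ovlp N σ τ ^ 2 * (N : ℝ)⁻¹ ^ 2 -
        4 * ovlp N σ τ * (N : ℝ)⁻¹ ^ 3 * d + (N : ℝ)⁻¹ ^ 4 * (d * d + 1)) * h
  simp only [e, sum_affine_spins hN]
  field_simp
  ring

lemma sub_pow_four_le (a b : ℝ) : (a - b) ^ 4 ≤ 8 * (a ^ 4 + b ^ 4) := by
  nlinarith [sq_nonneg (a + b), sq_nonneg (a - b), sq_nonneg (a ^ 2 - b ^ 2),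
    mul_nonneg (sq_nonneg (a + b)) (sq_nonneg (a + b)),
    mul_nonneg (sq_nonneg (a + b)) (sq_nonneg (a - b))]

lemma sub_pow_six_le (a b : ℝ) : (a - b) ^ 6 ≤ 32 * (a ^ 6 + b ^ 6) := by
  have h := pow_le_pow_left₀ (abs_nonneg _) (abs_sub a b) 6
  have h2 := add_pow_le (abs_nonneg a) (abs_nonneg b) 6
  have e : ∀ x : ℝ, |x| ^ 6 = x ^ 6 := fun x => by
    rw [show 6 = 2 * 3 by norm_num, pow_mul, pow_mul, sq_abs]
  simp only [e] at h h2
  norm_num at h2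
  linarith

lemma spins_pow_even (i : Fin N) (σ τ : Config N) (m : ℕ) :
    (spin (σ i) * spin (τ i) * (N : ℝ)⁻¹) ^ (2 * m) = (N : ℝ)⁻¹ ^ (2 * m) := by
  rw [mul_pow, pow_mul, sq, spins_sq, one_pow, one_mul]

lemma covl_four_le (i : Fin N) (σ τ : Config N) :
    covl i σ τ ^ 4 ≤ 8 * (ovlp N σ τ ^ 4 + (N : ℝ)⁻¹ ^ 4) := by
  rw [covl_eq_ovlp]
  exact (sub_pow_four_le _ _).trans_eq (by rw [spins_pow_even i σ τ 2])

lemma covl_six_le (i : Fin N) (σ τ : Config N) :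
    covl i σ τ ^ 6 ≤ 32 * (ovlp N σ τ ^ 6 + (N : ℝ)⁻¹ ^ 6) := by
  rw [covl_eq_ovlp]
  exact (sub_pow_six_le _ _).trans_eq (by rw [spins_pow_even i σ τ 3])

/-- Truncation of an overlap moment. -/
lemma ovlp_pow_le_indicator {a : ℝ} (ha : 0 ≤ a) (m : ℕ) (σ τ : Config N) :
    ovlp N σ τ ^ (2 * m + 2) ≤
      a * ovlp N σ τ ^ (2 * m) + if a < ovlp N σ τ ^ 2 then 1 else 0 := by
  have h0 : 0 ≤ ovlp N σ τ ^ (2 * m) := by rw [pow_mul]; positivity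
  rw [pow_add]
  split_ifs with h
  · have h1 : ovlp N σ τ ^ 2 ≤ 1 := (sq_le_one_iff_abs_le_one _).2 (abs_ovlp_le σ τ)
    have h2 : ovlp N σ τ ^ (2 * m) ≤ 1 := by
      rw [pow_mul]; exact pow_le_one₀ (sq_nonneg _) h1
    have := mul_le_one₀ h2 (sq_nonneg _) h1
    nlinarith
  · push Not at h
    nlinarith [mul_le_mul_of_nonneg_left h h0]

section Averages

variable {K' : Type*} [Fintype K'] (w w' : Config N → K' → ℝ)

lemma sum_gE_spins_covl (hN : 1 ≤ N) :
    ∑ i, gE w w' (fun σ τ => spin (σ i) * spin (τ i) * covl i σ τ) =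
      N * gE w w' (fun σ τ => ovlp N σ τ ^ 2) - 1 := by
  rw [← gE_sum]
  simp only [sum_spins_covl hN]
  rw [gE_sub, gE_mul_left, gE_const]

lemma sum_gE_covl_sq (hN : 1 ≤ N) :
    ∑ i, gE w w' (fun σ τ => covl i σ τ ^ 2) =
      N * gE w w' (fun σ τ => ovlp N σ τ ^ 2) - 2 * gE w w' (fun σ τ => ovlp N σ τ ^ 2) +
        (N : ℝ)⁻¹ := by
  rw [← gE_sum]
  simp only [sum_covl_sq hN]
  rw [gE_add, gE_sub, gE_mul_left, gE_mul_left, gE_const]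

lemma gE_covl_four_le (i : Fin N) :
    gE w w' (fun σ τ => covl i σ τ ^ 4) ≤
      8 * (gE w w' (fun σ τ => ovlp N σ τ ^ 4) + (N : ℝ)⁻¹ ^ 4) := by
  refine (gE_mono fun σ τ => covl_four_le i σ τ).trans_eq ?_
  rw [gE_mul_left, gE_add, gE_const]

lemma gE_covl_six_le (i : Fin N) :
    gE w w' (fun σ τ => covl i σ τ ^ 6) ≤
      32 * (gE w w' (fun σ τ => ovlp N σ τ ^ 6) + (N : ℝ)⁻¹ ^ 6) := by
  refine (gE_mono fun σ τ => covl_six_le i σ τ).trans_eq ?_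
  rw [gE_mul_left, gE_add, gE_const]

lemma sum_gE_spins_covl_cube_ge (hN : 1 ≤ N) :
    N * gE w w' (fun σ τ => ovlp N σ τ ^ 4) - 3 * gE w w' (fun σ τ => ovlp N σ τ ^ 2) -
      (N : ℝ)⁻¹ ^ 2 ≤ ∑ i, gE w w' (fun σ τ => spin (σ i) * spin (τ i) * covl i σ τ ^ 3) := by
  rw [← gE_sum]
  simp only [sum_spins_covl_cube hN]
  rw [← gE_mul_left, ← gE_mul_left, ← gE_sub, ← gE_const (w := w) (w' := w') ((N : ℝ)⁻¹ ^ 2),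
    ← gE_sub]
  refine gE_mono fun σ τ => ?_
  have : 0 ≤ 3 * ovlp N σ τ ^ 2 * (N : ℝ)⁻¹ := by positivity
  rw [gE_const]
  linarith

lemma sum_gE_covl_four_le (hN : 1 ≤ N) :
    ∑ i, gE w w' (fun σ τ => covl i σ τ ^ 4) ≤
      N * gE w w' (fun σ τ => ovlp N σ τ ^ 4) + 6 * gE w w' (fun σ τ => ovlp N σ τ ^ 2) +
      (N : ℝ)⁻¹ ^ 3 := by
  rw [← gE_sum]
  simp only [sum_covl_four hN]
  have hN1 : (N : ℝ)⁻¹ ≤ 1 := inv_le_one_of_one_le₀ (by exact_mod_cast hN)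
  rw [← gE_mul_left, ← gE_mul_left, ← gE_add, ← gE_const (w := w) (w' := w') ((N : ℝ)⁻¹ ^ 3),
    ← gE_add]
  refine gE_mono fun σ τ => ?_
  rw [gE_const]
  have h1 : 6 * ovlp N σ τ ^ 2 * (N : ℝ)⁻¹ ≤ 6 * ovlp N σ τ ^ 2 * 1 := by gcongr
  have h2 : 0 ≤ 4 * ovlp N σ τ ^ 2 * (N : ℝ)⁻¹ ^ 2 := by positivity
  have h3 : 0 ≤ 4 * ovlp N σ τ ^ 4 := by positivity
  linarith

end Averages

end Moments

/-! ### A priori bounds for a single system -/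

section APriori

/-- The constant of the one-system cavity estimate. -/
def KO : ℝ := (396 * KT + 20 * (KT + 1)) * rexp 6

lemma KO_pos : 0 < KO := by
  have := KT_pos
  unfold KO; positivity

lemma second_moment_arith {n δ X Y K T : ℝ} (hn : 1 ≤ n) (hδ : 0 < δ) (hδ1 : δ ≤ 1) (hX : 0 ≤ X)
    (hK : 0 < K) (hT : 0 ≤ T)
    (h1 : n * X - 1 ≤ (1 - δ) * (n * X - 2 * X + n⁻¹) + K * (n * (8 * (Y + n⁻¹ ^ 4))))
    (h2 : Y ≤ 1 / (64 * K) * δ * X + T / n ^ 2) :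
    X ≤ (4 + 16 * K + 16 * K * T) / (n * δ) := by
  have hn0 : 0 < n := by linarith
  have hi : n⁻¹ ≤ 1 := inv_le_one_of_one_le₀ hn
  have hi0 : 0 < n⁻¹ := by positivity
  have e1 : n * n⁻¹ ^ 4 ≤ 1 := by
    have : n * n⁻¹ ^ 4 = n⁻¹ ^ 3 := by field_simp
    rw [this]; exact pow_le_one₀ hi0.le hi
  have e2 : K * n * Y ≤ n * δ * X / 64 + K * T := by
    have : K * n * Y ≤ K * n * (1 / (64 * K) * δ * X + T / n ^ 2) := by gcongr
    refine this.trans ?_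
    have : K * n * (1 / (64 * K) * δ * X + T / n ^ 2) = n * δ * X / 64 + K * T * n⁻¹ := by
      field_simp
    rw [this]
    have : K * T * n⁻¹ ≤ K * T * 1 := by gcongr
    linarith
  have e3 : (1 - δ) * n⁻¹ ≤ 1 := by nlinarith
  have e4 : 0 ≤ (1 - δ) * (2 * X) := mul_nonneg (by linarith) (by linarith)
  have e5 : K * (n * n⁻¹ ^ 4) ≤ K * 1 := by gcongr
  rw [le_div_iff₀ (by positivity)]
  nlinarith [mul_nonneg (mul_nonneg hn0.le hδ.le) hX, mul_nonneg hK.le hT]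

lemma fourth_moment_arith {n δ X Y Z K T A : ℝ} (hn : 1 ≤ n) (hδ : 0 < δ) (hδ1 : δ ≤ 1)
    (hX : 0 ≤ X) (hK : 0 < K) (hT : 0 ≤ T) (hA : X ≤ A / (n * δ))
    (h1 : n * Y - 3 * X - n⁻¹ ^ 2 ≤ (1 - δ) * (n * Y + 6 * X + n⁻¹ ^ 3) +
      K * (n * (32 * (Z + n⁻¹ ^ 6))))
    (h2 : Z ≤ 1 / (64 * K) * δ * Y + T / n ^ 2) :
    Y ≤ (18 * A + 4 + 64 * K + 64 * K * T) / (n * δ) ^ 2 := by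
  have hn0 : 0 < n := by linarith
  have hi : n⁻¹ ≤ 1 := inv_le_one_of_one_le₀ hn
  have hi0 : 0 < n⁻¹ := by positivity
  have p2 : n⁻¹ ^ 2 ≤ n⁻¹ := by nlinarith
  have p3 : n⁻¹ ^ 3 ≤ n⁻¹ := by nlinarith
  have e1 : n * n⁻¹ ^ 6 ≤ n⁻¹ := by
    have : n * n⁻¹ ^ 6 = n⁻¹ * n⁻¹ ^ 4 := by field_simp
    rw [this]
    exact mul_le_of_le_one_right hi0.le (pow_le_one₀ hi0.le hi)
  have e2 : K * n * Z ≤ n * δ * Y / 64 + K * T * n⁻¹ := by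
    have : K * n * Z ≤ K * n * (1 / (64 * K) * δ * Y + T / n ^ 2) := by gcongr
    refine this.trans_eq ?_
    field_simp
  have e3 : (1 - δ) * n⁻¹ ^ 3 ≤ n⁻¹ := by nlinarith [pow_pos hi0 3]
  have e4 : (1 - δ) * (6 * X) ≤ 6 * X := by nlinarith
  have e5 : K * (n * n⁻¹ ^ 6) ≤ K * n⁻¹ := by gcongr
  have main : n * δ * Y ≤ 18 * X + (4 + 64 * K + 64 * K * T) * n⁻¹ := by
    nlinarith
  have e6 : n⁻¹ ≤ 1 / (n * δ) := by
    rw [inv_eq_one_div]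
    exact one_div_le_one_div_of_le (by positivity) (by nlinarith)
  have main2 : n * δ * Y ≤ (18 * A + 4 + 64 * K + 64 * K * T) / (n * δ) := by
    refine main.trans ?_
    have : (4 + 64 * K + 64 * K * T) * n⁻¹ ≤ (4 + 64 * K + 64 * K * T) * (1 / (n * δ)) := by
      gcongr
    calc _ ≤ 18 * (A / (n * δ)) + (4 + 64 * K + 64 * K * T) * (1 / (n * δ)) := by linarith
      _ = _ := by ring
  rw [le_div_iff₀ (by positivity)]
  rw [le_div_iff₀ (by positivity)] at main2
  linarith [show Y * (n * δ) ^ 2 = n * δ * Y * (n * δ) by ring]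

/-- Fourth moment of the overlap for one system, up to the edge of the critical window. -/
lemma fourth_moment_le {κ : ℝ} (hκ : 0 < κ) :
    ∃ C : ℝ, 0 < C ∧ ∀ (N : ℕ) (c : Dis N → ℝ) (δ : ℝ), 1 ≤ N → 0 < δ → δ ≤ 1 →
      κ ≤ N * δ ^ 3 → CovCond c c ((1 - δ) / N) →
      gE (disW c) (disW c) (fun σ τ => ovlp N σ τ ^ 4) ≤ C / (N * δ) ^ 2 := by
  have hK := KO_pos
  set ε : ℝ := 1 / (64 * KO) with hεdef
  have hε : 0 < ε := by positivity
  set T : ℝ := 10 * (Nat.factorial 13 : ℝ) * (32 / ε) ^ 13 / κ ^ 11 with hTdef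
  have hT : 0 ≤ T := by positivity
  clear_value T
  refine ⟨18 * (4 + 16 * KO + 16 * KO * T) + 4 + 64 * KO + 64 * KO * T, by positivity, ?_⟩
  intro N c δ hN hδ hδ1 hNδ hc
  have hn : (1 : ℝ) ≤ N := by exact_mod_cast hN
  have hs : √δ ^ 2 = δ := Real.sq_sqrt hδ.le
  have htail : gE (disW c) (disW c) (fun σ τ => if ε * δ < ovlp N σ τ ^ 2 then 1 else 0) ≤
      T / N ^ 2 := by
    have := gE_ovlp_tail hN (c := c) (s := √δ) (ε := ε) (κ := κ) (Real.sqrt_pos.2 hδ)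
      (Real.sqrt_le_one.2 hδ1) hε hκ
      (by rwa [show √δ ^ 6 = (√δ ^ 2) ^ 3 by ring, hs]) (by rwa [hs])
    rwa [hs, ← hTdef] at this
  have hgram : ∀ i : Fin N, _ := fun i =>
    cavGram_site hc hc hc (by linarith) (by linarith) (by linarith) (by linarith) i
  have odd1 : ∀ i : Fin N, gE (disW c) (disW c) (fun σ τ => spin (σ i) * spin (τ i) * covl i σ τ) ≤
      (1 - δ) * gE (disW c) (disW c) (fun σ τ => covl i σ τ ^ 2) +
        KO * (8 * (gE (disW c) (disW c) (fun σ τ => ovlp N σ τ ^ 4) + (N : ℝ)⁻¹ ^ 4)) := by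
    intro i
    have := gE_odd_le (isSiteFlip i c) (hgram i) (covl_flip i) (m := 1) (by decide)
      (psd_covl_pow i 1)
    simp only [pow_one] at this
    refine this.trans ?_
    have h4 := mul_le_mul_of_nonneg_left (gE_covl_four_le (disW c) (disW c) i) hK.le
    unfold KO at h4 ⊢
    linarith
  have odd3 : ∀ i : Fin N,
      gE (disW c) (disW c) (fun σ τ => spin (σ i) * spin (τ i) * covl i σ τ ^ 3) ≤
      (1 - δ) * gE (disW c) (disW c) (fun σ τ => covl i σ τ ^ 4) +
        KO * (32 * (gE (disW c) (disW c) (fun σ τ => ovlp N σ τ ^ 6) + (N : ℝ)⁻¹ ^ 6)) := by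
    intro i
    have := gE_odd_le (isSiteFlip i c) (hgram i) (covl_flip i) (m := 3) (by decide)
      (psd_covl_pow i 3)
    refine this.trans ?_
    have h4 := mul_le_mul_of_nonneg_left (gE_covl_six_le (disW c) (disW c) i) hK.le
    unfold KO at h4 ⊢
    norm_num at h4 ⊢
    linarith
  have sum1 := Finset.sum_le_sum fun i (_ : i ∈ (Finset.univ : Finset (Fin N))) => odd1 i
  have sum3 := Finset.sum_le_sum fun i (_ : i ∈ (Finset.univ : Finset (Fin N))) => odd3 i
  rw [sum_gE_spins_covl _ _ hN, Finset.sum_add_distrib, ← Finset.mul_sum, sum_gE_covl_sq _ _ hN,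
    Finset.sum_const, Finset.card_univ, Fintype.card_fin, nsmul_eq_mul, mul_left_comm] at sum1
  rw [Finset.sum_add_distrib, ← Finset.mul_sum, Finset.sum_const, Finset.card_univ,
    Fintype.card_fin, nsmul_eq_mul, mul_left_comm] at sum3
  have sum3' := (sum_gE_spins_covl_cube_ge (disW c) (disW c) hN).trans (sum3.trans
    (add_le_add_left (mul_le_mul_of_nonneg_left (sum_gE_covl_four_le (disW c) (disW c) hN)
      (by linarith : (0 : ℝ) ≤ 1 - δ)) _))
  have trunc : ∀ m : ℕ, gE (disW c) (disW c) (fun σ τ => ovlp N σ τ ^ (2 * m + 2)) ≤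
      ε * δ * gE (disW c) (disW c) (fun σ τ => ovlp N σ τ ^ (2 * m)) + T / N ^ 2 := by
    intro m
    refine (gE_mono fun σ τ => ovlp_pow_le_indicator (by positivity : 0 ≤ ε * δ) m σ τ).trans ?_
    rw [gE_add, gE_mul_left]
    linarith
  have X0 : 0 ≤ gE (disW c) (disW c) (fun σ τ => ovlp N σ τ ^ 2) :=
    gE_nonneg fun σ τ => sq_nonneg _
  exact fourth_moment_arith hn hδ hδ1 X0 hK hT
    (second_moment_arith hn hδ hδ1 X0 hK hT sum1 (trunc 1)) sum3' (trunc 2)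

end APriori

/-! ### The second moment of the coupled overlap -/

section Coupled

/-- The constant of the two-system cavity estimate. -/
def KQ : ℝ := 3 * KP * rexp 6

lemma KQ_pos : 0 < KQ := by
  have := KT_pos
  unfold KQ KP; positivity

lemma coupled_cavity_bound {N : ℕ} (hN : 1 ≤ N) {c c' : Dis N → ℝ} {x y C : ℝ}
    (h : CovCond c c (x / N)) (h' : CovCond c' c' (x / N)) (hcc : CovCond c c' (y / N))
    (hx : 0 ≤ x) (hx1 : x ≤ 1) (hy : 0 ≤ y) (hy1 : y ≤ 1)
    (h4 : gE (disW c) (disW c) (fun σ τ => ovlp N σ τ ^ 4) ≤ C)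
    (h4' : gE (disW c') (disW c') (fun σ τ => ovlp N σ τ ^ 4) ≤ C) {ϱ X : ℝ} (hϱ : 0 < ϱ)
    (hX : gE (disW c) (disW c') (fun σ τ => ovlp N σ τ ^ 2) = X) :
    |(N * X - 1) - y * (N * X - 2 * X + (N : ℝ)⁻¹)| ≤
      KQ * (ϱ * (N * X - 2 * X + (N : ℝ)⁻¹) + ϱ⁻¹ * (16 * N * (C + (N : ℝ)⁻¹ ^ 4))) := by
  have site : ∀ i : Fin N, |gE (disW c) (disW c') (fun σ τ => spin (σ i) * spin (τ i) * covl i σ τ)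
      - y * gE (disW c) (disW c') (fun σ τ => covl i σ τ ^ 2)| ≤
      KQ * (ϱ * gE (disW c) (disW c') (fun σ τ => covl i σ τ ^ 2) +
        ϱ⁻¹ * (16 * (C + (N : ℝ)⁻¹ ^ 4))) := by
    intro i
    refine (gE_pair_odd (isSiteFlip i c) (isSiteFlip i c')
      (cavGram_site h h' hcc hx hx1 hy hy1 i) (covl_flip i) (psd_covl_pow i 4) hϱ).trans ?_
    have a1 := gE_covl_four_le (disW c) (disW c) i
    have a2 := gE_covl_four_le (disW c') (disW c') i
    refine mul_le_mul_of_nonneg_left (add_le_add_right (mul_le_mul_of_nonneg_left ?_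
      (by positivity)) _) KQ_pos.le
    linarith
  rw [← hX, ← sum_gE_spins_covl _ _ hN, ← sum_gE_covl_sq _ _ hN, Finset.mul_sum,
    ← Finset.sum_sub_distrib]
  refine (Finset.abs_sum_le_sum_abs _ _).trans ((Finset.sum_le_sum fun i _ => site i).trans_eq ?_)
  rw [← Finset.mul_sum, Finset.sum_add_distrib, ← Finset.mul_sum, Finset.sum_const,
    Finset.card_univ, Fintype.card_fin, nsmul_eq_mul]
  ring

lemma abs_sub_le_of_cavity {n δ y X K D ϱ B : ℝ} (hn : 1 ≤ n) (hX : 0 ≤ X) (hy : 0 ≤ y)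
    (hy1 : y ≤ 1) (hK : 0 < K) (hϱ : 0 < ϱ) (hB : 16 * n * (B + n⁻¹ ^ 4) ≤ D / (n * δ ^ 2))
    (h : |(n * X - 1) - y * (n * X - 2 * X + n⁻¹)| ≤
      K * (ϱ * (n * X - 2 * X + n⁻¹) + ϱ⁻¹ * (16 * n * (B + n⁻¹ ^ 4)))) :
    |(1 - y) * (n * X) - 1| ≤
      2 * X + n⁻¹ + K * (ϱ * (n * X + n⁻¹) + ϱ⁻¹ * (D / (n * δ ^ 2))) := by
  have hi0 : 0 < n⁻¹ := by positivity
  have e : (1 - y) * (n * X) - 1 = ((n * X - 1) - y * (n * X - 2 * X + n⁻¹)) +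
      y * (n⁻¹ - 2 * X) := by ring
  have h1 : |y * (n⁻¹ - 2 * X)| ≤ 2 * X + n⁻¹ := by
    rw [abs_mul, abs_of_nonneg hy]
    have : |n⁻¹ - 2 * X| ≤ 2 * X + n⁻¹ := abs_le.2 ⟨by linarith, by linarith⟩
    exact (mul_le_of_le_one_left (abs_nonneg _) hy1).trans this
  have h2 : K * (ϱ * (n * X - 2 * X + n⁻¹) + ϱ⁻¹ * (16 * n * (B + n⁻¹ ^ 4))) ≤
      K * (ϱ * (n * X + n⁻¹) + ϱ⁻¹ * (D / (n * δ ^ 2))) := by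
    gcongr
    linarith
  rw [e]
  exact (abs_add_le _ _).trans (by linarith)

lemma coupled_rough {n δ d X K D κ : ℝ} (hn : 1 ≤ n) (hδ : 0 < δ) (hδd : δ ≤ d)
    (hd1 : d ≤ 1) (hX : 0 ≤ X) (hX1 : X ≤ 1) (hK : 0 < K) (hD : 0 ≤ D) (hκ : 0 < κ)
    (hnδ : κ ≤ n * δ ^ 3)
    (h : ∀ ϱ : ℝ, 0 < ϱ → |d * (n * X) - 1| ≤
      2 * X + n⁻¹ + K * (ϱ * (n * X + n⁻¹) + ϱ⁻¹ * (D / (n * δ ^ 2)))) :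
    n * X ≤ (9 + 4 * K ^ 2 * D / κ) / d := by
  have hd : 0 < d := by linarith
  have hn0 : 0 < n := by linarith
  have hi : n⁻¹ ≤ 1 := inv_le_one_of_one_le₀ hn
  have hi0 : 0 < n⁻¹ := by positivity
  have h1 := (le_abs_self _).trans (h (d / (2 * K)) (by positivity))
  have e : K * (d / (2 * K) * (n * X + n⁻¹) + (d / (2 * K))⁻¹ * (D / (n * δ ^ 2))) =
      d * (n * X) / 2 + d * n⁻¹ / 2 + 2 * K ^ 2 * D / (n * δ ^ 2 * d) := by
    field_simp
  have h2 : 2 * K ^ 2 * D / (n * δ ^ 2 * d) ≤ 2 * K ^ 2 * D / κ := by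
    refine div_le_div_of_nonneg_left (by positivity) hκ (hnδ.trans ?_)
    calc n * δ ^ 3 = n * δ ^ 2 * δ := by ring
      _ ≤ n * δ ^ 2 * d := by gcongr
  have h3 : d * n⁻¹ ≤ 1 := mul_le_one₀ hd1 hi0.le hi
  rw [e] at h1
  rw [le_div_iff₀ hd]
  have : 4 * K ^ 2 * D / κ = 2 * (2 * K ^ 2 * D / κ) := by ring
  rw [this]
  linarith

lemma coupled_sharp {n δ d X K D A : ℝ} (hn : 1 ≤ n) (hδ : 0 < δ) (hδd : δ ≤ d) (hd1 : d ≤ 1)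
    (hK : 0 < K) (hA : 0 ≤ A) (hXA : n * X ≤ A / d)
    (h : ∀ ϱ : ℝ, 0 < ϱ → |d * (n * X) - 1| ≤
      2 * X + n⁻¹ + K * (ϱ * (n * X + n⁻¹) + ϱ⁻¹ * (D / (n * δ ^ 2)))) :
    |d * (n * X) - 1| ≤ (2 * A + 1 + K * (A + 1) + K * D) * ((√n)⁻¹ * δ⁻¹ * (√d)⁻¹) := by
  have hd : 0 < d := by linarith
  have hn0 : 0 < n := by linarith
  have hsn : 0 < √n := Real.sqrt_pos.2 hn0
  have hsd : 0 < √d := Real.sqrt_pos.2 hd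
  have en : √n * √n = n := Real.mul_self_sqrt hn0.le
  have ed : √d * √d = d := Real.mul_self_sqrt hd.le
  have hsn1 : 1 ≤ √n := Real.one_le_sqrt.2 hn
  have hsd1 : √d ≤ 1 := Real.sqrt_le_one.2 hd1
  have h1 := h ((√n)⁻¹ * δ⁻¹ * √d) (by positivity)
  have hinv : n⁻¹ ≤ 1 / d := by
    rw [inv_eq_one_div]; exact one_div_le_one_div_of_le hd (by linarith)
  have b1 : (√n)⁻¹ * δ⁻¹ * √d * (n * X + n⁻¹) ≤ (A + 1) * ((√n)⁻¹ * δ⁻¹ * (√d)⁻¹) := by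
    calc _ ≤ (√n)⁻¹ * δ⁻¹ * √d * (A / d + 1 / d) := by gcongr
      _ = (√n)⁻¹ * δ⁻¹ * √d * ((A + 1) / (√d * √d)) := by rw [ed]; ring
      _ = _ := by field_simp
  have b2 : ((√n)⁻¹ * δ⁻¹ * √d)⁻¹ * (D / (n * δ ^ 2)) = D * ((√n)⁻¹ * δ⁻¹ * (√d)⁻¹) := by
    nth_rewrite 2 [← en]
    field_simp
  have b3 : n⁻¹ * d⁻¹ ≤ (√n)⁻¹ * δ⁻¹ * (√d)⁻¹ := by
    rw [← mul_inv, ← mul_inv, ← mul_inv]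
    refine inv_anti₀ (by positivity) ?_
    calc √n * δ * √d ≤ √n * d * 1 := by gcongr
      _ ≤ √n * d * √n := by gcongr
      _ = n * d := by rw [mul_right_comm, en]
  have b4 : 2 * X + n⁻¹ ≤ (2 * A + 1) * (n⁻¹ * d⁻¹) := by
    have hX2 : X ≤ A * (n⁻¹ * d⁻¹) := by
      have : X = n⁻¹ * (n * X) := by field_simp
      rw [this]
      calc _ ≤ n⁻¹ * (A / d) := by gcongr
        _ = _ := by ring
    have : n⁻¹ * 1 ≤ n⁻¹ * d⁻¹ := by
      gcongr
      exact (one_le_inv₀ hd).2 hd1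
    linarith
  have b5 : (2 * A + 1) * (n⁻¹ * d⁻¹) ≤ (2 * A + 1) * ((√n)⁻¹ * δ⁻¹ * (√d)⁻¹) := by gcongr
  rw [b2] at h1
  have b6 := mul_le_mul_of_nonneg_left b1 hK.le
  linarith

/-- The distance to criticality stays of order at least `N^{-1/3}`. -/
lemma exists_window_constant {δ : ℕ → ℝ} (hδ : ∀ N, 0 < δ N)
    (h : ∃ a : ℝ, 0 < a ∧ ∀ᶠ N : ℕ in atTop, a ≤ (N : ℝ) ^ ((1 : ℝ) / 3) * δ N) :
    ∃ κ : ℝ, 0 < κ ∧ ∀ N : ℕ, 1 ≤ N → κ ≤ N * δ N ^ 3 := by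
  obtain ⟨a, ha, h⟩ := h
  obtain ⟨M, hM⟩ := eventually_atTop.1 h
  have hne : (Finset.range (M + 1)).Nonempty := ⟨0, by simp⟩
  set b : ℝ := (Finset.range (M + 1)).inf' hne fun N => δ N ^ 3
  have hb : 0 < b := by
    rw [Finset.lt_inf'_iff]
    exact fun N _ => pow_pos (hδ N) 3
  refine ⟨min (a ^ 3) b, lt_min (pow_pos ha 3) hb, fun N hN => ?_⟩
  rcases le_or_gt M N with hMN | hMN
  · refine (min_le_left _ _).trans ((pow_le_pow_left₀ ha.le (hM N hMN) 3).trans_eq ?_)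
    rw [mul_pow, ← Real.rpow_natCast, ← Real.rpow_mul (Nat.cast_nonneg _)]
    norm_num
  · have hmem : N ∈ Finset.range (M + 1) := Finset.mem_range.2 (by omega)
    refine (min_le_right _ _).trans ((Finset.inf'_le (fun N => δ N ^ 3) hmem).trans ?_)
    exact le_mul_of_one_le_left (pow_pos (hδ N) 3).le (by exact_mod_cast hN)

lemma coupled_second_moment {κ : ℝ} (hκ : 0 < κ) :
    ∃ L : ℝ, ∀ (N : ℕ) (β t : ℝ), 1 ≤ N → β ∈ Set.Ioo (0 : ℝ) 1 → t ∈ Set.Icc (0 : ℝ) 1 →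
      κ ≤ N * (1 - β ^ 2) ^ 3 →
      |(1 - β ^ 2 * t) * (N * EgibbsT N β t (fun ρ => ovlp N ρ.1 ρ.2 ^ 2)) - 1| ≤
        L * ((√(N : ℝ))⁻¹ * (1 - β ^ 2)⁻¹ * (√(1 - β ^ 2 * t))⁻¹) := by
  obtain ⟨C, hC, hfour⟩ := fourth_moment_le hκ
  have hK := KQ_pos
  refine ⟨2 * (9 + 4 * KQ ^ 2 * (16 * (C + 1)) / κ) + 1 +
    KQ * ((9 + 4 * KQ ^ 2 * (16 * (C + 1)) / κ) + 1) + KQ * (16 * (C + 1)),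
    fun N β t hN hβ ht hNδ => ?_⟩
  have hn : (1 : ℝ) ≤ N := by exact_mod_cast hN
  have hβ2 : β ^ 2 < 1 := by nlinarith [hβ.1, hβ.2]
  have hβ0 : 0 ≤ β ^ 2 := sq_nonneg β
  have hδ : 0 < 1 - β ^ 2 := by linarith
  have hδ1 : 1 - β ^ 2 ≤ 1 := by linarith
  have hy : 0 ≤ β ^ 2 * t := mul_nonneg hβ0 ht.1
  have hyx : β ^ 2 * t ≤ β ^ 2 := mul_le_of_le_one_right hβ0 ht.2
  have h11 := covCond_one (N := N) (β := β) ht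
  have h22 := covCond_two (N := N) (β := β) ht
  have f1 := hfour N (coefOne N β t) (1 - β ^ 2) hN hδ hδ1 hNδ (by simpa using h11)
  have f2 := hfour N (coefTwo N β t) (1 - β ^ 2) hN hδ hδ1 hNδ (by simpa using h22)
  rw [EgibbsT_eq_gE]
  generalize hX : gE (disW (coefOne N β t)) (disW (coefTwo N β t))
    (fun σ τ => ovlp N σ τ ^ 2) = X
  have hX0 : 0 ≤ X := hX ▸ gE_nonneg fun σ τ => sq_nonneg _
  have hX1 : X ≤ 1 := by
    rw [← hX, ← gE_const (w := disW (coefOne N β t)) (w' := disW (coefTwo N β t)) 1]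
    exact gE_mono fun σ τ => (sq_le_one_iff_abs_le_one _).2 (abs_ovlp_le σ τ)
  have hB : 16 * (N : ℝ) * (C / (N * (1 - β ^ 2)) ^ 2 + (N : ℝ)⁻¹ ^ 4) ≤
      16 * (C + 1) / (N * (1 - β ^ 2) ^ 2) := by
    have : (N : ℝ)⁻¹ ^ 4 ≤ 1 / (N * (1 - β ^ 2)) ^ 2 := by
      rw [inv_pow, inv_eq_one_div]
      refine one_div_le_one_div_of_le (by positivity) ?_
      rw [mul_pow]
      calc (N : ℝ) ^ 2 * (1 - β ^ 2) ^ 2 ≤ (N : ℝ) ^ 2 * 1 := by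
            gcongr; exact pow_le_one₀ hδ.le hδ1
        _ ≤ (N : ℝ) ^ 4 := by rw [mul_one]; exact pow_le_pow_right₀ hn (by norm_num)
    calc _ ≤ 16 * (N : ℝ) * (C / (N * (1 - β ^ 2)) ^ 2 + 1 / (N * (1 - β ^ 2)) ^ 2) := by gcongr
      _ = _ := by
        generalize 1 - β ^ 2 = δ at *
        field_simp
  have hcav : ∀ ϱ : ℝ, 0 < ϱ → |(1 - β ^ 2 * t) * (N * X) - 1| ≤ 2 * X + (N : ℝ)⁻¹ +
      KQ * (ϱ * (N * X + (N : ℝ)⁻¹) + ϱ⁻¹ * (16 * (C + 1) / (N * (1 - β ^ 2) ^ 2))) :=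
    fun ϱ hϱ => abs_sub_le_of_cavity hn hX0 hy (by linarith) hK hϱ hB
      (coupled_cavity_bound hN h11 h22 (covCond_one_two ht) hβ0 hβ2.le hy (by linarith) f1 f2
        hϱ hX)
  have hrough := coupled_rough (κ := κ) hn hδ (by linarith) (by linarith) hX0 hX1 hK
    (by positivity) hκ hNδ hcav
  exact coupled_sharp hn hδ (by linarith) (by linarith) hK (by positivity) hrough hcav

end Coupled

/-- Proposition (overlap concentration), part I:
`|N·E⟨R(σ,τ)²⟩_t − 1/(1−β_N²t)| ≤ L·N^{−1/2}(1−β_N²)^{−1}(1−β_N²t)^{−3/2}`. -/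
theorem sk_overlap_concentration_I
    (β : ℕ → ℝ) (hβmem : ∀ N, β N ∈ Set.Ioo (0 : ℝ) 1)
    (hβlim : Tendsto β atTop (nhds 1))
    (hc : (∃ c : ℝ, 0 < c ∧
        Tendsto (fun N : ℕ => (N : ℝ) ^ ((1 : ℝ) / 3) * (1 - β N ^ 2)) atTop (nhds c)) ∨
      Tendsto (fun N : ℕ => (N : ℝ) ^ ((1 : ℝ) / 3) * (1 - β N ^ 2)) atTop atTop) :
    ∃ L : ℝ, ∀ N : ℕ, 1 ≤ N → ∀ t ∈ Set.Icc (0 : ℝ) 1,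
      |(N : ℝ) * EgibbsT N (β N) t (fun ρ => ovlp N ρ.1 ρ.2 ^ 2) -
          1 / (1 - β N ^ 2 * t)| ≤
        L * (N : ℝ) ^ (-(1 : ℝ) / 2) * (1 - β N ^ 2)⁻¹ *
          (1 - β N ^ 2 * t) ^ (-(3 : ℝ) / 2) := by
  have hsq : ∀ N, β N ^ 2 < 1 := fun N => by nlinarith [(hβmem N).1, (hβmem N).2]
  obtain ⟨κ, hκ, hwin⟩ := exists_window_constant (δ := fun N => 1 - β N ^ 2)
    (fun N => sub_pos.2 (hsq N)) (by
      rcases hc with ⟨c, hc, h⟩ | h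
      · exact ⟨c / 2, by positivity, h.eventually (eventually_ge_nhds (by linarith))⟩
      · exact ⟨1, one_pos, h.eventually (eventually_ge_atTop 1)⟩)
  obtain ⟨L, hL⟩ := coupled_second_moment hκ
  refine ⟨L, fun N hN t ht => ?_⟩
  have key := hL N (β N) t hN (hβmem N) ht (hwin N hN)
  have hN0 : (0 : ℝ) < N := by exact_mod_cast hN
  have hd : 0 < 1 - β N ^ 2 * t := by
    nlinarith [mul_le_of_le_one_right (sq_nonneg (β N)) ht.2, hsq N]
  have e1 : (N : ℝ) ^ (-(1 : ℝ) / 2) = (√(N : ℝ))⁻¹ := by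
    rw [Real.sqrt_eq_rpow, ← Real.rpow_neg hN0.le]; norm_num
  have e2 : (1 - β N ^ 2 * t) ^ (-(3 : ℝ) / 2) =
      (1 - β N ^ 2 * t)⁻¹ * (√(1 - β N ^ 2 * t))⁻¹ := by
    rw [Real.sqrt_eq_rpow, ← Real.rpow_neg hd.le, ← Real.rpow_neg_one, ← Real.rpow_add hd]
    norm_num
  rw [e1, e2]
  generalize (N : ℝ) * EgibbsT N (β N) t (fun ρ => ovlp N ρ.1 ρ.2 ^ 2) = x at *
  generalize 1 - β N ^ 2 * t = d at *
  have e3 : x - 1 / d = d⁻¹ * (d * x - 1) := by field_simp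
  rw [e3, abs_mul, abs_of_pos (inv_pos.2 hd)]
  refine (mul_le_mul_of_nonneg_left key (inv_pos.2 hd).le).trans_eq ?_
  ring

end
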